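/- arXiv:1310.6249 — 7 statements merged into one kernel-verified Lean document; each statement's English description precedes it below -/
import Mathlib

section
/- Let m = 2.46 and ε₀ = √((m−1)/(m+1)) = √(73/173). For every ε ∈ (0, ε₀), setting θ = 2 arccos ε, there exist α = α(ε) ∈ (1,2) and K = K(ε) > 0 such that for every u ∈ C_0^∞(Q) and every real number a > 0: ∫_Q e^{2a(t^{−K}−1)φ(x) − (|x|²+K)/(8t)} (|u|² + |∇u|²) dx dt ≤ ∫_Q e^{2a(t^{−K}−1)φ(x) − (|x|²+K)/(8t)} |∂_t u + Δu|² dx dt. -/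
open Set MeasureTheory

/-- The open cone `C_θ = {x : x₁ > |x| cos(θ/2)}` in `ℝⁿ`. -/
def cone {n : ℕ} (hn : 0 < n) (θ : ℝ) : Set (EuclideanSpace ℝ (Fin n)) :=
  {x | ‖x‖ * Real.cos (θ / 2) < x ⟨0, hn⟩}

/-- `Q = {(x,t) : x ∈ C_θ, x₁ > 1, t ∈ (0,1)}`. -/
def Qset {n : ℕ} (hn : 0 < n) (θ : ℝ) : Set (EuclideanSpace ℝ (Fin n) × ℝ) :=
  {p | p.1 ∈ cone hn θ ∧ 1 < p.1 ⟨0, hn⟩ ∧ p.2 ∈ Ioo (0 : ℝ) 1}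

/-- The Carleman weight `φ(x) = |x|^α ((x₁/|x|)^m − ε^m)`. -/
noncomputable def φ {n : ℕ} (hn : 0 < n) (m ε α : ℝ)
    (x : EuclideanSpace ℝ (Fin n)) : ℝ :=
  ‖x‖ ^ α * ((x ⟨0, hn⟩ / ‖x‖) ^ m - ε ^ m)

/-- The Laplacian (in the `x` variables) of `g : ℝⁿ → ℝ` at `x`. -/
noncomputable def lap {n : ℕ} (g : EuclideanSpace ℝ (Fin n) → ℝ)
    (x : EuclideanSpace ℝ (Fin n)) : ℝ :=
  ∑ i : Fin n, iteratedFDeriv ℝ 2 g x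
    ![EuclideanSpace.single i 1, EuclideanSpace.single i 1]


open scoped ContDiff

set_option linter.unusedSectionVars false

section Abstract

variable {V : Type*} [NormedAddCommGroup V] [NormedSpace ℝ V]

/-- Directional derivative. -/
noncomputable def pd (e : V) (F : V → ℝ) : V → ℝ := fun p => fderiv ℝ F p e

/-- Smooth on `U`. -/
def Sm (U : Set V) (F : V → ℝ) : Prop := ContDiffOn ℝ ∞ F U

lemma Sm.diffAt {U : Set V} (hU : IsOpen U) {F : V → ℝ} (h : Sm U F) {p : V} (hp : p ∈ U) :
    DifferentiableAt ℝ F p :=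
  (h.contDiffAt (hU.mem_nhds hp)).differentiableAt (by simp)

lemma Sm.pd {U : Set V} (hU : IsOpen U) {F : V → ℝ} (h : Sm U F) (e : V) : Sm U (pd e F) := by
  have := ContDiffOn.fderiv_of_isOpen (m := ∞) h hU (by simp)
  exact this.clm_apply contDiffOn_const

lemma Sm.mul {U : Set V} {F G : V → ℝ} (h : Sm U F) (h' : Sm U G) :
    Sm U (fun p => F p * G p) := ContDiffOn.mul h h'
lemma Sm.add {U : Set V} {F G : V → ℝ} (h : Sm U F) (h' : Sm U G) :
    Sm U (fun p => F p + G p) := ContDiffOn.add h h'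
lemma Sm.sub {U : Set V} {F G : V → ℝ} (h : Sm U F) (h' : Sm U G) :
    Sm U (fun p => F p - G p) := ContDiffOn.sub h h'
lemma Sm.const {U : Set V} (c : ℝ) : Sm U (fun _ => c) := contDiffOn_const
lemma Sm.sum {ι : Type*} {U : Set V} {s : Finset ι} {F : ι → V → ℝ} (h : ∀ i, Sm U (F i)) :
    Sm U (fun p => ∑ i ∈ s, F i p) := ContDiffOn.sum (fun i _ => h i)
lemma Sm.exp {U : Set V} {F : V → ℝ} (h : Sm U F) : Sm U (fun p => Real.exp (F p)) :=
  ContDiffOn.exp h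
lemma Sm.congr {U : Set V} {F G : V → ℝ} (h : Sm U F) (h' : ∀ p ∈ U, G p = F p) : Sm U G :=
  ContDiffOn.congr h h'

lemma pd_congr {U : Set V} (hU : IsOpen U) {F G : V → ℝ} (h : ∀ p ∈ U, F p = G p) (e : V)
    {p : V} (hp : p ∈ U) : pd e F p = pd e G p := by
  unfold pd
  rw [Filter.EventuallyEq.fderiv_eq]
  filter_upwards [hU.mem_nhds hp] with q hq using h q hq

lemma pd_mul {U : Set V} (hU : IsOpen U) {F G : V → ℝ} (hF : Sm U F) (hG : Sm U G) (e : V)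
    {p : V} (hp : p ∈ U) : pd e (fun q => F q * G q) p = pd e F p * G p + F p * pd e G p := by
  unfold pd
  rw [fderiv_fun_mul (hF.diffAt hU hp) (hG.diffAt hU hp)]
  simp; ring

lemma pd_add {U : Set V} (hU : IsOpen U) {F G : V → ℝ} (hF : Sm U F) (hG : Sm U G) (e : V)
    {p : V} (hp : p ∈ U) : pd e (fun q => F q + G q) p = pd e F p + pd e G p := by
  unfold pd
  rw [fderiv_fun_add (hF.diffAt hU hp) (hG.diffAt hU hp)]
  simp

lemma pd_sub {U : Set V} (hU : IsOpen U) {F G : V → ℝ} (hF : Sm U F) (hG : Sm U G) (e : V)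
    {p : V} (hp : p ∈ U) : pd e (fun q => F q - G q) p = pd e F p - pd e G p := by
  unfold pd
  rw [fderiv_fun_sub (hF.diffAt hU hp) (hG.diffAt hU hp)]
  simp

lemma pd_const (c : ℝ) (e p : V) : pd e (fun _ => c) p = 0 := by
  unfold pd; simp

lemma pd_sum {ι : Type*} {U : Set V} (hU : IsOpen U) {s : Finset ι} {F : ι → V → ℝ}
    (hF : ∀ i, Sm U (F i)) (e : V)
    {p : V} (hp : p ∈ U) : pd e (fun q => ∑ i ∈ s, F i q) p = ∑ i ∈ s, pd e (F i) p := by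
  unfold pd
  rw [fderiv_fun_sum (fun i _ => (hF i).diffAt hU hp)]
  simp

lemma pd_exp {U : Set V} (hU : IsOpen U) {F : V → ℝ} (hF : Sm U F) (e : V)
    {p : V} (hp : p ∈ U) : pd e (fun q => Real.exp (F q)) p = Real.exp (F p) * pd e F p := by
  unfold pd
  rw [fderiv_exp (hF.diffAt hU hp)]
  simp

lemma pd_comm {U : Set V} (hU : IsOpen U) {F : V → ℝ} (hF : Sm U F) (e f : V)
    {p : V} (hp : p ∈ U) : pd e (pd f F) p = pd f (pd e F) p := by
  have h1 := (hF.contDiffAt (hU.mem_nhds hp)).isSymmSndFDerivAt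
    (by rw [minSmoothness_of_isRCLikeNormedField]; exact ENat.LEInfty.out)
  have h2 : DifferentiableAt ℝ (fderiv ℝ F) p :=
    ((ContDiffOn.fderiv_of_isOpen (m := ∞) hF hU (by simp)).contDiffAt
      (hU.mem_nhds hp)).differentiableAt (by simp)
  have h3 : ∀ e f : V, pd e (pd f F) p = fderiv ℝ (fderiv ℝ F) p e f := by
    intro e f
    unfold pd
    rw [fderiv_clm_apply h2 (differentiableAt_const _)]
    simp
  rw [h3, h3]
  exact h1 e f

lemma pd_zero_off {S : Set V} (hS : IsClosed S) {F : V → ℝ} (hF : ∀ p, p ∉ S → F p = 0) (e : V)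
    {p : V} (hp : p ∉ S) : pd e F p = 0 := by
  have := pd_congr (U := Sᶜ) hS.isOpen_compl (F := F) (G := fun _ => 0) (fun q hq => hF q hq) e hp
  rw [this, pd_const]

variable [MeasurableSpace V] [BorelSpace V] [FiniteDimensional ℝ V]
  (μ : Measure V) [μ.IsAddHaarMeasure]

/-- Integrable with zero integral. -/
def Nul (U : Set V) (F : V → ℝ) : Prop := IntegrableOn F U μ ∧ ∫ p in U, F p ∂μ = 0

variable {μ}

lemma Nul.add {U : Set V} {F G : V → ℝ} (h : Nul μ U F) (h' : Nul μ U G) :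
    Nul μ U (fun p => F p + G p) :=
  ⟨h.1.add h'.1, by rw [integral_add h.1 h'.1, h.2, h'.2, add_zero]⟩

lemma Nul.sum {ι : Type*} {s : Finset ι} {U : Set V} {F : ι → V → ℝ} (h : ∀ i, Nul μ U (F i)) :
    Nul μ U (fun p => ∑ i ∈ s, F i p) :=
  ⟨integrable_finsetSum _ (fun i _ => (h i).1), by
    rw [integral_finsetSum _ (fun i _ => (h i).1)]; simp [(h _).2]⟩

lemma Nul.congr {U : Set V} (hU : IsOpen U) {F G : V → ℝ} (h : Nul μ U F)
    (h' : ∀ p ∈ U, G p = F p) : Nul μ U G :=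
  ⟨h.1.congr_fun (fun p hp => (h' p hp).symm) hU.measurableSet, by
    rw [setIntegral_congr_fun hU.measurableSet (fun p hp => h' p hp), h.2]⟩

lemma integrable_of_cont {U S : Set V} (hU : IsOpen U) (hS : IsCompact S) (hSU : S ⊆ U)
    {F : V → ℝ} (hF : ContinuousOn F U) (h0 : ∀ p, p ∉ S → F p = 0) : Integrable F μ := by
  have hc : Continuous F := by
    rw [continuous_iff_continuousAt]
    intro p
    by_cases hp : p ∈ S
    · exact hF.continuousAt (hU.mem_nhds (hSU hp))
    · have : F =ᶠ[nhds p] fun _ => 0 := by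
        filter_upwards [hS.isClosed.isOpen_compl.mem_nhds hp] with q hq using h0 q hq
      exact continuousAt_const.congr this.symm
  exact hc.integrable_of_hasCompactSupport (HasCompactSupport.intro hS (fun p hp => h0 p hp))

lemma Nul.pd {U S : Set V} (hU : IsOpen U) (hS : IsCompact S) (hSU : S ⊆ U)
    {F : V → ℝ} (hF : Sm U F) (h0 : ∀ p, p ∉ S → F p = 0) (e : V) : Nul μ U (pd e F) := by
  have h1 : Integrable (_root_.pd e F) μ :=
    integrable_of_cont hU hS hSU (hF.pd hU e).continuousOn
      (fun p hp => pd_zero_off hS.isClosed h0 e hp)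
  have h2 : Integrable F μ := integrable_of_cont hU hS hSU hF.continuousOn h0
  refine ⟨h1.integrableOn, ?_⟩
  rw [setIntegral_eq_integral_of_forall_compl_eq_zero
    (fun p hp => pd_zero_off hS.isClosed h0 e (fun h => hp (hSU h)))]
  have hd : ∀ p, DifferentiableAt ℝ F p := by
    intro p
    by_cases hp : p ∈ S
    · exact hF.diffAt hU (hSU hp)
    · have : F =ᶠ[nhds p] fun _ => 0 := by
        filter_upwards [hS.isClosed.isOpen_compl.mem_nhds hp] with q hq using h0 q hq
      exact (differentiableAt_const _).congr_of_eventuallyEq this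
  have := integral_mul_fderiv_eq_neg_fderiv_mul_of_integrable (μ := μ) (f := fun _ : V => (1:ℝ))
    (g := F) (v := e) (by simp) (by simpa [_root_.pd] using (show Integrable (fun x => _root_.pd e F x) μ from h1)) (by simpa using h2)
    (fun _ _ => differentiableAt_const _) (fun p _ => hd p)
  simpa [_root_.pd] using this

end Abstract

section AbstractB

variable {V : Type*} [NormedAddCommGroup V] [NormedSpace ℝ V]
  [MeasurableSpace V] [BorelSpace V] [FiniteDimensional ℝ V]
  {μ : Measure V} [μ.IsAddHaarMeasure]

lemma nul_one {U S : Set V} (hU : IsOpen U) (hS : IsCompact S) (hSU : S ⊆ U)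
    {v : V → ℝ} (hv : Sm U v) (h0 : ∀ p, p ∉ S → v p = 0) (e τ : V) :
    Nul μ U (fun p => 2 * pd e (pd e v) p * pd τ v p) := by
  have z := fun (e : V) (p : V) (hp : p ∉ S) => pd_zero_off hS.isClosed h0 e hp
  have se := hv.pd hU e
  have st := hv.pd hU τ
  refine ((Nul.pd hU hS hSU (F := fun p => 2 * (pd e v p * pd τ v p))
    ((Sm.const 2).mul (se.mul st)) (fun p hp => by simp [z e p hp]) e).add
    (Nul.pd hU hS hSU (F := fun p => (-1) * (pd e v p * pd e v p))
    ((Sm.const (-1)).mul (se.mul se)) (fun p hp => by simp [z e p hp]) τ)).congr hU ?_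
  intro p hp
  rw [pd_mul hU (Sm.const 2) (se.mul st) e hp, pd_mul hU se st e hp,
    pd_mul hU (Sm.const (-1)) (se.mul se) τ hp, pd_mul hU se se τ hp, pd_const, pd_const,
    pd_comm hU hv τ e hp]
  ring

lemma nul_two {U S : Set V} (hU : IsOpen U) (hS : IsCompact S) (hSU : S ⊆ U)
    {v P : V → ℝ} (hv : Sm U v) (hP : Sm U P) (h0 : ∀ p, p ∉ S → v p = 0) (e f : V) :
    Nul μ U (fun p => -4 * pd e (pd e v) p * pd f P p * pd f v p
      - 2 * pd e (pd e v) p * pd f (pd f P) p * v p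
      - (4 * pd e (pd f P) p * pd e v p * pd f v p
        - pd e (pd e (pd f (pd f P))) p * v p ^ 2)) := by
  have z := fun (e : V) (p : V) (hp : p ∉ S) => pd_zero_off hS.isClosed h0 e hp
  have se := hv.pd hU e
  have sf := hv.pd hU f
  have pf := hP.pd hU f
  have pff := pf.pd hU f
  have peff := pff.pd hU e
  refine ((((Nul.pd hU hS hSU (F := fun p => (-4) * (pd e v p * (pd f P p * pd f v p)))
    ((Sm.const (-4)).mul (se.mul (pf.mul sf))) (fun p hp => by simp [z e p hp]) e).add
    (Nul.pd hU hS hSU (F := fun p => 2 * ((pd e v p * pd e v p) * pd f P p))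
    ((Sm.const 2).mul ((se.mul se).mul pf)) (fun p hp => by simp [z e p hp]) f)).add
    (Nul.pd hU hS hSU (F := fun p => (-2) * (pd e v p * (pd f (pd f P) p * v p)))
    ((Sm.const (-2)).mul (se.mul (pff.mul hv))) (fun p hp => by simp [z e p hp]) e)).add
    (Nul.pd hU hS hSU (F := fun p => (v p * v p) * pd e (pd f (pd f P)) p)
    ((hv.mul hv).mul peff) (fun p hp => by simp [h0 p hp]) e)).congr hU ?_
  intro p hp
  rw [pd_mul hU (Sm.const (-4)) (se.mul (pf.mul sf)) e hp, pd_mul hU se (pf.mul sf) e hp,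
    pd_mul hU pf sf e hp,
    pd_mul hU (Sm.const 2) ((se.mul se).mul pf) f hp, pd_mul hU (se.mul se) pf f hp,
    pd_mul hU se se f hp,
    pd_mul hU (Sm.const (-2)) (se.mul (pff.mul hv)) e hp, pd_mul hU se (pff.mul hv) e hp,
    pd_mul hU pff hv e hp, pd_mul hU (hv.mul hv) peff e hp, pd_mul hU hv hv e hp,
    pd_const, pd_const, pd_const, pd_comm hU hv f e hp]
  ring

lemma nul_three {U S : Set V} (hU : IsOpen U) (hS : IsCompact S) (hSU : S ⊆ U)
    {v W : V → ℝ} (hv : Sm U v) (hW : Sm U W) (h0 : ∀ p, p ∉ S → v p = 0) (τ : V) :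
    Nul μ U (fun p => 2 * W p * v p * pd τ v p + pd τ W p * v p ^ 2) := by
  refine (Nul.pd hU hS hSU (F := fun p => W p * (v p * v p))
    (hW.mul (hv.mul hv)) (fun p hp => by simp [h0 p hp]) τ).congr hU ?_
  intro p hp
  rw [pd_mul hU hW (hv.mul hv) τ hp, pd_mul hU hv hv τ hp]
  ring

lemma nul_four {U S : Set V} (hU : IsOpen U) (hS : IsCompact S) (hSU : S ⊆ U)
    {v W P : V → ℝ} (hv : Sm U v) (hW : Sm U W) (hP : Sm U P) (h0 : ∀ p, p ∉ S → v p = 0)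
    (f : V) :
    Nul μ U (fun p => -4 * W p * v p * pd f P p * pd f v p - 2 * W p * pd f (pd f P) p * v p ^ 2
      - 2 * pd f W p * pd f P p * v p ^ 2) := by
  have pf := hP.pd hU f
  refine (Nul.pd hU hS hSU (F := fun p => (-2) * ((W p * pd f P p) * (v p * v p)))
    ((Sm.const (-2)).mul ((hW.mul pf).mul (hv.mul hv))) (fun p hp => by simp [h0 p hp])
    f).congr hU ?_
  intro p hp
  rw [pd_mul hU (Sm.const (-2)) ((hW.mul pf).mul (hv.mul hv)) f hp,
    pd_mul hU (hW.mul pf) (hv.mul hv) f hp, pd_mul hU hW pf f hp, pd_mul hU hv hv f hp, pd_const]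
  ring

lemma nul_five {U S : Set V} (hU : IsOpen U) (hS : IsCompact S) (hSU : S ⊆ U)
    {v h : V → ℝ} (hv : Sm U v) (hh : Sm U h) (h0 : ∀ p, p ∉ S → v p = 0)
    (e : V) :
    Nul μ U (fun p => -2 * h p * v p * pd e (pd e v) p - 2 * h p * pd e v p ^ 2
      + pd e (pd e h) p * v p ^ 2) := by
  have se := hv.pd hU e
  have he := hh.pd hU e
  refine ((Nul.pd hU hS hSU (F := fun p => (-2) * (h p * (v p * pd e v p)))
    ((Sm.const (-2)).mul (hh.mul (hv.mul se))) (fun p hp => by simp [h0 p hp]) e).add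
    (Nul.pd hU hS hSU (F := fun p => pd e h p * (v p * v p))
    (he.mul (hv.mul hv)) (fun p hp => by simp [h0 p hp]) e)).congr hU ?_
  intro p hp
  rw [pd_mul hU (Sm.const (-2)) (hh.mul (hv.mul se)) e hp,
    pd_mul hU hh (hv.mul se) e hp, pd_mul hU hv se e hp, pd_mul hU he (hv.mul hv) e hp,
    pd_mul hU hv hv e hp, pd_const]
  ring

variable {ι : Type*} [Fintype ι]

/-- The zeroth order coefficient. -/
noncomputable def Ncoef (b : ι → V) (τ : V) (P h : V → ℝ) (p : V) : ℝ :=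
  pd τ (pd τ P) p - 4 * ∑ i, pd (b i) P p * pd τ (pd (b i) P) p
    + 4 * ∑ i, ∑ j, pd (b i) (pd (b j) P) p * pd (b i) P p * pd (b j) P p
    - ∑ i, ∑ j, pd (b i) (pd (b i) (pd (b j) (pd (b j) P))) p
    - ∑ i, pd (b i) (pd (b i) h) p
    - 2 * h p * (∑ i, pd (b i) P p ^ 2 - pd τ P p) - h p ^ 2

lemma carl_abs {U S : Set V} (hU : IsOpen U) (hS : IsCompact S) (hSU : S ⊆ U)
    {v h P : V → ℝ} (hv : Sm U v) (hh : Sm U h) (hP : Sm U P) (h0 : ∀ p, p ∉ S → v p = 0)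
    (b : ι → V) (τ : V) :
    ∃ D : V → ℝ, Nul μ U D ∧ ∀ p ∈ U,
      D p + (4 * ∑ i, ∑ j, pd (b i) (pd (b j) P) p * pd (b i) v p * pd (b j) v p
        + 2 * h p * ∑ i, pd (b i) v p ^ 2 + Ncoef b τ P h p * v p ^ 2) ≤
      (pd τ v p + ∑ i, pd (b i) (pd (b i) v) p - 2 * ∑ i, pd (b i) P p * pd (b i) v p
        + (∑ i, pd (b i) P p ^ 2 - pd τ P p - ∑ i, pd (b i) (pd (b i) P) p) * v p) ^ 2 := by
  classical
  set W : V → ℝ := fun p => ∑ i, pd (b i) P p * pd (b i) P p - pd τ P p with hWdef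
  have sP := fun e => hP.pd hU e
  have sW : Sm U W := (Sm.sum (fun i => (sP (b i)).mul (sP (b i)))).sub (sP τ)
  have dW : ∀ e, ∀ p ∈ U, pd e W p =
      2 * ∑ i, pd (b i) P p * pd e (pd (b i) P) p - pd e (pd τ P) p := by
    intro e p hp
    rw [hWdef, pd_sub hU (Sm.sum (fun i => (sP (b i)).mul (sP (b i)))) (sP τ) e hp,
      pd_sum hU (fun i => (sP (b i)).mul (sP (b i))) e hp, Finset.mul_sum]
    congr 1
    refine Finset.sum_congr rfl (fun i _ => ?_)
    rw [pd_mul hU (sP (b i)) (sP (b i)) e hp]; ring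
  refine ⟨_, ((((Nul.sum (s := Finset.univ) (fun i : ι => nul_one hU hS hSU hv h0 (b i) τ)).add
    (Nul.sum (s := Finset.univ) (fun i : ι => Nul.sum (s := Finset.univ)
      (fun j : ι => nul_two hU hS hSU hv hP h0 (b i) (b j))))).add
    (nul_three hU hS hSU hv sW h0 τ)).add
    (Nul.sum (s := Finset.univ) (fun i : ι => nul_four hU hS hSU hv sW hP h0 (b i)))).add
    (Nul.sum (s := Finset.univ) (fun i : ι => nul_five hU hS hSU hv hh h0 (b i))), ?_⟩
  intro p hp
  have hWp : W p = ∑ i, pd (b i) P p ^ 2 - pd τ P p := by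
    simp only [hWdef, sq]
  -- abbreviations
  set A := ∑ i, pd (b i) (pd (b i) v) p with hA
  set B := ∑ i, pd (b i) P p * pd (b i) v p with hB
  set C := ∑ i, pd (b i) (pd (b i) P) p with hC
  set G := ∑ i, pd (b i) v p ^ 2 with hG
  set H := ∑ i, ∑ j, pd (b i) (pd (b j) P) p * pd (b i) v p * pd (b j) v p with hH
  set H3 := ∑ i, ∑ j, pd (b i) (pd (b j) P) p * pd (b i) P p * pd (b j) P p with hH3
  set Z := ∑ i, ∑ j, pd (b i) (pd (b i) (pd (b j) (pd (b j) P))) p with hZ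
  set Lh := ∑ i, pd (b i) (pd (b i) h) p with hLh
  set Q := ∑ i, pd (b i) P p * pd τ (pd (b i) P) p with hQ
  have e1 : ∑ i, 2 * pd (b i) (pd (b i) v) p * pd τ v p = 2 * A * pd τ v p := by
    rw [hA, Finset.mul_sum, Finset.sum_mul]
  have e2 : ∑ i, ∑ j, (-4 * pd (b i) (pd (b i) v) p * pd (b j) P p * pd (b j) v p
      - 2 * pd (b i) (pd (b i) v) p * pd (b j) (pd (b j) P) p * v p
      - (4 * pd (b i) (pd (b j) P) p * pd (b i) v p * pd (b j) v p
        - pd (b i) (pd (b i) (pd (b j) (pd (b j) P))) p * v p ^ 2))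
      = -4 * A * B - 2 * A * C * v p - (4 * H - Z * v p ^ 2) := by
    have a1 : A * B = ∑ i, ∑ j, pd (b i) (pd (b i) v) p * (pd (b j) P p * pd (b j) v p) :=
      Finset.sum_mul_sum _ _ _ _
    have a2 : A * C = ∑ i, ∑ j, pd (b i) (pd (b i) v) p * pd (b j) (pd (b j) P) p :=
      Finset.sum_mul_sum _ _ _ _
    rw [show -4 * A * B - 2 * A * C * v p - (4 * H - Z * v p ^ 2)
      = -4 * (A * B) - 2 * ((A * C) * v p) - (4 * H - Z * v p ^ 2) by ring, a1, a2, hH, hZ]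
    simp only [Finset.mul_sum, Finset.sum_mul, ← Finset.sum_sub_distrib]
    refine Finset.sum_congr rfl (fun i _ => Finset.sum_congr rfl (fun j _ => ?_))
    ring
  have e4a : ∑ i, pd (b i) W p * pd (b i) P p = 2 * H3 - Q := by
    simp only [dW _ p hp]
    rw [hH3, hQ]
    simp only [Finset.mul_sum, Finset.sum_mul, sub_mul, Finset.sum_sub_distrib]
    congr 1
    · refine Finset.sum_congr rfl (fun i _ => Finset.sum_congr rfl (fun j _ => ?_))
      ring
    · refine Finset.sum_congr rfl (fun i _ => ?_)
      rw [pd_comm hU hP (b i) τ hp]; ring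
  have e4 : ∑ i, (-4 * W p * v p * pd (b i) P p * pd (b i) v p
      - 2 * W p * pd (b i) (pd (b i) P) p * v p ^ 2
      - 2 * pd (b i) W p * pd (b i) P p * v p ^ 2)
      = -4 * W p * v p * B - 2 * W p * C * v p ^ 2 - 2 * (2 * H3 - Q) * v p ^ 2 := by
    rw [← e4a, hB, hC]
    simp only [Finset.mul_sum, Finset.sum_mul, ← Finset.sum_sub_distrib]
    refine Finset.sum_congr rfl (fun i _ => ?_)
    ring
  have e5 : ∑ i, (-2 * h p * v p * pd (b i) (pd (b i) v) p - 2 * h p * pd (b i) v p ^ 2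
      + pd (b i) (pd (b i) h) p * v p ^ 2) = -2 * h p * v p * A - 2 * h p * G + Lh * v p ^ 2 := by
    rw [hA, hG, hLh]
    simp only [Finset.mul_sum, Finset.sum_mul, ← Finset.sum_sub_distrib, ← Finset.sum_add_distrib]
  rw [e1, e2, e4, e5, dW τ p hp, ← hQ, Ncoef, ← hQ, ← hH3, ← hZ, ← hLh, ← hWp]
  nlinarith [sq_nonneg (A + W p * v p + h p * v p), sq_nonneg (pd τ v p - 2 * B - C * v p)]

end AbstractB

section AbstractC

variable {V : Type*} [NormedAddCommGroup V] [NormedSpace ℝ V]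
  [MeasurableSpace V] [BorelSpace V] [FiniteDimensional ℝ V]
  {μ : Measure V} [μ.IsAddHaarMeasure] {ι : Type*} [Fintype ι]

lemma carl_u {U S : Set V} (hU : IsOpen U) (hS : IsCompact S) (hSU : S ⊆ U)
    {u h P : V → ℝ} (hu : Sm U u) (hh : Sm U h) (hP : Sm U P) (h0 : ∀ p, p ∉ S → u p = 0)
    (b : ι → V) (τ : V)
    (hpt : ∀ p ∈ U, ∀ w : ι → ℝ, ∀ y : ℝ,
      y ^ 2 + ∑ i, (w i - pd (b i) P p * y) ^ 2 ≤
        4 * ∑ i, ∑ j, pd (b i) (pd (b j) P) p * w i * w j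
        + 2 * h p * ∑ i, w i ^ 2 + Ncoef b τ P h p * y ^ 2) :
    ∫ p in U, Real.exp (2 * P p) * (u p ^ 2 + ∑ i, pd (b i) u p ^ 2) ∂μ ≤
    ∫ p in U, Real.exp (2 * P p) * (pd τ u p + ∑ i, pd (b i) (pd (b i) u) p) ^ 2 ∂μ := by
  set E : V → ℝ := fun p => Real.exp (P p) with hE
  have sE : Sm U E := hP.exp
  have dE : ∀ e, ∀ p ∈ U, pd e E p = E p * pd e P p := fun e p hp => pd_exp hU hP e hp
  set v : V → ℝ := fun p => E p * u p with hvdef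
  have sv : Sm U v := sE.mul hu
  have v0 : ∀ p, p ∉ S → v p = 0 := fun p hp => by simp [hvdef, h0 p hp]
  have dv : ∀ e, ∀ p ∈ U, pd e v p = E p * (pd e u p + pd e P p * u p) := by
    intro e p hp
    rw [hvdef, pd_mul hU sE hu e hp, dE e p hp]; ring
  have ddv : ∀ e, ∀ p ∈ U, pd e (pd e v) p = E p * (pd e (pd e u) p + 2 * pd e P p * pd e u p
      + pd e (pd e P) p * u p + pd e P p ^ 2 * u p) := by
    intro e p hp
    rw [pd_congr hU (dv e) e hp, pd_mul hU sE ((hu.pd hU e).add ((hP.pd hU e).mul hu)) e hp,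
      dE e p hp, pd_add hU (hu.pd hU e) ((hP.pd hU e).mul hu) e hp,
      pd_mul hU (hP.pd hU e) hu e hp]
    ring
  obtain ⟨D, hD, hle⟩ := carl_abs (μ := μ) hU hS hSU sv hh hP v0 b τ
  have hE2 : ∀ p, Real.exp (2 * P p) = E p ^ 2 := by
    intro p; rw [hE, ← Real.exp_nat_mul]; norm_num
  have key : ∀ p ∈ U, Real.exp (2 * P p) * (u p ^ 2 + ∑ i, pd (b i) u p ^ 2) ≤
      Real.exp (2 * P p) * (pd τ u p + ∑ i, pd (b i) (pd (b i) u) p) ^ 2 - D p := by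
    intro p hp
    have h1 := hle p hp
    have h2 := hpt p hp (fun i => pd (b i) v p) (v p)
    have h3 : v p ^ 2 + ∑ i, (pd (b i) v p - pd (b i) P p * v p) ^ 2
        = Real.exp (2 * P p) * (u p ^ 2 + ∑ i, pd (b i) u p ^ 2) := by
      rw [hE2, mul_add, Finset.mul_sum]
      congr 1
      · simp only [hvdef]; ring
      · refine Finset.sum_congr rfl (fun i _ => ?_)
        rw [dv _ p hp]; simp only [hvdef]; ring
    have h4 : pd τ v p + ∑ i, pd (b i) (pd (b i) v) p - 2 * ∑ i, pd (b i) P p * pd (b i) v p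
        + (∑ i, pd (b i) P p ^ 2 - pd τ P p - ∑ i, pd (b i) (pd (b i) P) p) * v p
        = E p * (pd τ u p + ∑ i, pd (b i) (pd (b i) u) p) := by
      have : ∑ i, pd (b i) (pd (b i) v) p - 2 * ∑ i, pd (b i) P p * pd (b i) v p
        + (∑ i, pd (b i) P p ^ 2 - ∑ i, pd (b i) (pd (b i) P) p) * v p
        = E p * ∑ i, pd (b i) (pd (b i) u) p := by
        rw [sub_mul]
        simp only [Finset.mul_sum, Finset.sum_mul, ← Finset.sum_sub_distrib,
          ← Finset.sum_add_distrib]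
        refine Finset.sum_congr rfl (fun i _ => ?_)
        rw [dv _ p hp, ddv _ p hp]; simp only [hvdef]; ring
      have h5 := dv τ p hp
      simp only [hvdef] at this h5 ⊢
      linear_combination this + h5
    rw [h4, show ∀ A B : ℝ, (A * B) ^ 2 = A ^ 2 * B ^ 2 from fun A B => by ring] at h1
    rw [h3] at h2
    rw [hE2] at h2 ⊢
    linarith
  have hint : IntegrableOn
      (fun p => Real.exp (2 * P p) * (pd τ u p + ∑ i, pd (b i) (pd (b i) u) p) ^ 2) U μ := by
    refine Integrable.integrableOn (integrable_of_cont hU hS hSU ?_ ?_)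
    · have s1 : Sm U (fun p => pd τ u p + ∑ i, pd (b i) (pd (b i) u) p) :=
        (hu.pd hU τ).add (Sm.sum (fun i => (hu.pd hU (b i)).pd hU (b i)))
      have s2 : Sm U (fun p => Real.exp (2 * P p)) := ((Sm.const 2).mul hP).exp
      exact (s2.mul (ContDiffOn.pow s1 2)).continuousOn
    · intro p hp
      have z := fun e q (hq : q ∉ S) => pd_zero_off hS.isClosed h0 e hq
      have z2 : ∀ e, pd e (pd e u) p = 0 := fun e => pd_zero_off hS.isClosed (z e) e hp
      simp [z τ p hp, z2]
  have h1 : ∫ p in U, Real.exp (2 * P p) * (u p ^ 2 + ∑ i, pd (b i) u p ^ 2) ∂μ ≤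
      ∫ p in U, (Real.exp (2 * P p) * (pd τ u p + ∑ i, pd (b i) (pd (b i) u) p) ^ 2 - D p) ∂μ := by
    refine integral_mono_of_nonneg ?_ (hint.sub hD.1) ?_
    · refine Filter.Eventually.of_forall (fun p => ?_)
      simp only [Pi.zero_apply]
      positivity
    · exact (ae_restrict_iff' hU.measurableSet).2 (Filter.Eventually.of_forall key)
  rw [integral_sub hint hD.1, hD.2, sub_zero] at h1
  exact h1

end AbstractC

section Concrete

lemma Sm.rpow {V : Type*} [NormedAddCommGroup V] [NormedSpace ℝ V] {U : Set V} {F : V → ℝ}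
    (h : Sm U F) (hpos : ∀ p ∈ U, 0 < F p) (β : ℝ) : Sm U (fun p => F p ^ β) :=
  ContDiffOn.rpow_const_of_ne h (fun p hp => (hpos p hp).ne')

lemma pd_rpow {V : Type*} [NormedAddCommGroup V] [NormedSpace ℝ V] {U : Set V} (hU : IsOpen U)
    {F : V → ℝ} (hF : Sm U F) (hpos : ∀ p ∈ U, 0 < F p) (β : ℝ) (e : V) {p : V} (hp : p ∈ U) :
    pd e (fun q => F q ^ β) p = β * F p ^ (β - 1) * pd e F p := by
  unfold pd
  have := ((hF.diffAt hU hp).hasFDerivAt.rpow_const (p := β) (Or.inl (hpos p hp).ne')).fderiv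
  rw [this]
  simp

variable {n : ℕ}

/-- coordinate functions -/
def crd (i : Fin n) (p : EuclideanSpace ℝ (Fin n) × ℝ) : ℝ := p.1 i

/-- monomials `‖x‖^β x₁^γ` -/
noncomputable def Mon (i0 : Fin n) (β γ : ℝ) (p : EuclideanSpace ℝ (Fin n) × ℝ) : ℝ :=
  ‖p.1‖ ^ β * (p.1 i0) ^ γ

/-- powers of time -/
noncomputable def tp (κ : ℝ) (p : EuclideanSpace ℝ (Fin n) × ℝ) : ℝ := p.2 ^ κ

/-- spatial basis vectors -/
noncomputable def bb (i : Fin n) : EuclideanSpace ℝ (Fin n) × ℝ := (EuclideanSpace.single i 1, 0)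

/-- time direction -/
def tt (n : ℕ) : EuclideanSpace ℝ (Fin n) × ℝ := (0, 1)

/-- Kronecker -/
def kd (i j : Fin n) : ℝ := if i = j then 1 else 0

lemma crd_sm (U : Set (EuclideanSpace ℝ (Fin n) × ℝ)) (i : Fin n) : Sm U (crd i) := by
  have : ContDiff ℝ ∞ (crd i) := by
    unfold crd
    fun_prop
  exact this.contDiffOn

lemma pd_crd (i : Fin n) (e p : EuclideanSpace ℝ (Fin n) × ℝ) : pd e (crd i) p = e.1 i := by
  unfold pd
  have : HasFDerivAt (crd i) ((EuclideanSpace.proj i : EuclideanSpace ℝ (Fin n) →L[ℝ] ℝ).comp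
    (ContinuousLinearMap.fst ℝ _ ℝ)) p :=
    ((EuclideanSpace.proj i : EuclideanSpace ℝ (Fin n) →L[ℝ] ℝ).comp
      (ContinuousLinearMap.fst ℝ _ ℝ)).hasFDerivAt
  rw [this.fderiv]
  simp

lemma snd_sm (U : Set (EuclideanSpace ℝ (Fin n) × ℝ)) : Sm U (fun p => p.2) :=
  contDiff_snd.contDiffOn

lemma pd_snd (e p : EuclideanSpace ℝ (Fin n) × ℝ) : pd e (fun p => p.2) p = e.2 := by
  unfold pd
  rw [fderiv_snd]; simp

lemma nsq_sm (U : Set (EuclideanSpace ℝ (Fin n) × ℝ)) : Sm U (fun p => ‖p.1‖ ^ 2) :=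
  (contDiff_fst.norm_sq ℝ).contDiffOn

lemma pd_nsq (e p : EuclideanSpace ℝ (Fin n) × ℝ) :
    pd e (fun p => ‖p.1‖ ^ 2) p = 2 * inner ℝ p.1 e.1 := by
  unfold pd
  have : HasFDerivAt (fun p : EuclideanSpace ℝ (Fin n) × ℝ => ‖p.1‖ ^ 2) _ p :=
    (hasFDerivAt_fst (p := p)).norm_sq
  rw [this.fderiv]
  simp

variable {U : Set (EuclideanSpace ℝ (Fin n) × ℝ)} {i0 : Fin n}

lemma norm_pos_of {x : EuclideanSpace ℝ (Fin n)} (h : 0 < x i0) : 0 < ‖x‖ := by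
  rw [norm_pos_iff]; rintro rfl; simp at h

lemma nrp_eq (β : ℝ) (x : EuclideanSpace ℝ (Fin n)) : ‖x‖ ^ β = (‖x‖ ^ 2) ^ (β / 2) := by
  rw [← Real.rpow_natCast, ← Real.rpow_mul (norm_nonneg _)]
  congr 1; push_cast; ring

lemma nrp_sm (h1 : ∀ p ∈ U, 0 < p.1 i0) (β : ℝ) : Sm U (fun p => ‖p.1‖ ^ β) := by
  have := (nsq_sm U).rpow (fun p hp => by have := norm_pos_of (h1 p hp); positivity) (β / 2)
  exact this.congr (fun p _ => nrp_eq β p.1)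

lemma pd_nrp (hU : IsOpen U) (h1 : ∀ p ∈ U, 0 < p.1 i0) (β : ℝ)
    (e : EuclideanSpace ℝ (Fin n) × ℝ) {p} (hp : p ∈ U) :
    pd e (fun p => ‖p.1‖ ^ β) p = β * ‖p.1‖ ^ (β - 2) * inner ℝ p.1 e.1 := by
  rw [pd_congr hU (fun p _ => nrp_eq β p.1) e hp,
    pd_rpow hU (nsq_sm U) (fun p hp => by have := norm_pos_of (h1 p hp); positivity) (β / 2) e hp,
    pd_nsq, nrp_eq (β - 2)]
  rw [show (β - 2) / 2 = β / 2 - 1 by ring]; ring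

lemma Mon_sm (h1 : ∀ p ∈ U, 0 < p.1 i0) (β γ : ℝ) : Sm U (Mon i0 β γ) :=
  (nrp_sm h1 β).mul ((crd_sm U i0).rpow h1 γ)

lemma pd_Mon (hU : IsOpen U) (h1 : ∀ p ∈ U, 0 < p.1 i0) (β γ : ℝ)
    (e : EuclideanSpace ℝ (Fin n) × ℝ) {p} (hp : p ∈ U) :
    pd e (Mon i0 β γ) p = β * inner ℝ p.1 e.1 * Mon i0 (β - 2) γ p
      + γ * e.1 i0 * Mon i0 β (γ - 1) p := by
  have := pd_mul hU (nrp_sm h1 β) ((crd_sm U i0).rpow h1 γ) e hp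
  rw [pd_nrp hU h1 β e hp, pd_rpow hU (crd_sm U i0) h1 γ e hp, pd_crd] at this
  change pd e (fun q => ‖q.1‖ ^ β * crd i0 q ^ γ) p = _
  rw [this]
  simp only [Mon, crd]; ring

lemma pd_bb_Mon (hU : IsOpen U) (h1 : ∀ p ∈ U, 0 < p.1 i0) (β γ : ℝ)
    (i : Fin n) {p} (hp : p ∈ U) :
    pd (bb i) (Mon i0 β γ) p = β * (crd i p * Mon i0 (β - 2) γ p)
      + γ * (kd i i0 * Mon i0 β (γ - 1) p) := by
  rw [pd_Mon hU h1 β γ _ hp]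
  have e1 : inner ℝ p.1 (bb i).1 = crd i p := by
    simp [bb, crd, EuclideanSpace.inner_single_right]
  have e2 : (bb i).1 i0 = kd i i0 := by
    simp [bb, kd, eq_comm]
  rw [e1, e2]; ring

lemma pd_tt_Mon (hU : IsOpen U) (h1 : ∀ p ∈ U, 0 < p.1 i0) (β γ : ℝ) {p} (hp : p ∈ U) :
    pd (tt n) (Mon i0 β γ) p = 0 := by
  rw [pd_Mon hU h1 β γ _ hp]; simp [tt]

lemma pd_bb_crd (i j : Fin n) (p : EuclideanSpace ℝ (Fin n) × ℝ) :
    pd (bb i) (crd j) p = kd i j := by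
  rw [pd_crd]; simp [bb, kd, eq_comm]

lemma pd_tt_crd (j : Fin n) (p : EuclideanSpace ℝ (Fin n) × ℝ) :
    pd (tt n) (crd j) p = 0 := by
  rw [pd_crd]; simp [tt]

lemma tp_sm (h2 : ∀ p ∈ U, 0 < p.2) (κ : ℝ) : Sm U (tp κ) := (snd_sm U).rpow h2 κ

lemma pd_bb_tp (hU : IsOpen U) (h2 : ∀ p ∈ U, 0 < p.2) (κ : ℝ) (i : Fin n) {p} (hp : p ∈ U) :
    pd (bb i) (tp κ) p = 0 := by
  have := pd_rpow hU (snd_sm U) h2 κ (bb i) hp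
  rw [pd_snd] at this
  change pd (bb i) (fun q => q.2 ^ κ) p = _
  rw [this]; simp [bb]

lemma pd_tt_tp (hU : IsOpen U) (h2 : ∀ p ∈ U, 0 < p.2) (κ : ℝ) {p} (hp : p ∈ U) :
    pd (tt n) (tp κ) p = κ * tp (κ - 1) p := by
  have := pd_rpow hU (snd_sm U) h2 κ (tt n) hp
  rw [pd_snd] at this
  change pd (tt n) (fun q => q.2 ^ κ) p = _
  rw [this]; simp [tt, tp]

lemma pd_bb_bb_Mon (hU : IsOpen U) (h1 : ∀ p ∈ U, 0 < p.1 i0) (β γ : ℝ)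
    (i j : Fin n) {p} (hp : p ∈ U) :
    pd (bb i) (pd (bb j) (Mon i0 β γ)) p =
      β * kd i j * Mon i0 (β - 2) γ p
      + β * (β - 2) * crd i p * crd j p * Mon i0 (β - 2 - 2) γ p
      + β * γ * (kd i i0 * crd j p + kd j i0 * crd i p) * Mon i0 (β - 2) (γ - 1) p
      + γ * (γ - 1) * kd i i0 * kd j i0 * Mon i0 β (γ - 1 - 1) p := by
  have M := fun β γ => Mon_sm (i0 := i0) h1 β γ
  have c := crd_sm U
  rw [pd_congr hU (fun p hp => pd_bb_Mon hU h1 β γ j hp) _ hp,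
    pd_add hU ((Sm.const β).mul ((c j).mul (M _ _)))
      ((Sm.const γ).mul ((Sm.const (kd j i0)).mul (M _ _))) _ hp,
    pd_mul hU (Sm.const β) ((c j).mul (M _ _)) _ hp,
    pd_mul hU (c j) (M _ _) _ hp,
    pd_mul hU (Sm.const γ) ((Sm.const (kd j i0)).mul (M _ _)) _ hp,
    pd_mul hU (Sm.const (kd j i0)) (M _ _) _ hp, pd_const, pd_const, pd_const, pd_bb_crd,
    pd_bb_Mon hU h1 _ _ i hp, pd_bb_Mon hU h1 _ _ i hp]
  ring

/-- Laplacian -/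
noncomputable def Lap (F : EuclideanSpace ℝ (Fin n) × ℝ → ℝ) (p : EuclideanSpace ℝ (Fin n) × ℝ) : ℝ :=
  ∑ i, pd (bb i) (pd (bb i) F) p

lemma sum_crd_sq (p : EuclideanSpace ℝ (Fin n) × ℝ) : ∑ i, crd i p * crd i p = ‖p.1‖ ^ 2 := by
  rw [EuclideanSpace.norm_sq_eq]
  refine Finset.sum_congr rfl (fun i _ => ?_)
  simp [crd, sq]

lemma Mon_red (h : 0 < (p : EuclideanSpace ℝ (Fin n) × ℝ).1 i0) (β γ : ℝ) :
    ‖p.1‖ ^ 2 * Mon i0 (β - 2) γ p = Mon i0 β γ p := by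
  have := norm_pos_of h
  unfold Mon
  rw [← mul_assoc, ← Real.rpow_natCast, ← Real.rpow_add this]
  congr 2; push_cast; ring

lemma Mon_red' (h : 0 < (p : EuclideanSpace ℝ (Fin n) × ℝ).1 i0) (β γ : ℝ) :
    crd i0 p * Mon i0 β (γ - 1) p = Mon i0 β γ p := by
  unfold Mon crd
  rw [mul_left_comm]
  congr 1
  nth_rewrite 1 [← Real.rpow_one (p.1 i0)]
  rw [← Real.rpow_add h]
  congr 1; ring

lemma Lap_Mon (hU : IsOpen U) (h1 : ∀ p ∈ U, 0 < p.1 i0) (β γ : ℝ) {p} (hp : p ∈ U) :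
    Lap (Mon i0 β γ) p = β * (n + β - 2 + 2 * γ) * Mon i0 (β - 2) γ p
      + γ * (γ - 1) * Mon i0 β (γ - 1 - 1) p := by
  unfold Lap
  simp only [pd_bb_bb_Mon hU h1 _ _ _ _ hp, Finset.sum_add_distrib]
  have s1 : ∑ i : Fin n, β * kd i i * Mon i0 (β - 2) γ p = β * n * Mon i0 (β - 2) γ p := by
    simp [kd]; ring
  have s2 : ∑ i, β * (β - 2) * crd i p * crd i p * Mon i0 (β - 2 - 2) γ p
      = β * (β - 2) * Mon i0 (β - 2) γ p := by
    rw [← Mon_red (h1 p hp) (β - 2) γ, ← sum_crd_sq, Finset.sum_mul, Finset.mul_sum]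
    exact Finset.sum_congr rfl (fun i _ => by ring)
  have s3 : ∑ i, β * γ * (kd i i0 * crd i p + kd i i0 * crd i p) * Mon i0 (β - 2) (γ - 1) p
      = 2 * β * γ * Mon i0 (β - 2) γ p := by
    rw [← Mon_red' (h1 p hp) (β - 2) γ]
    simp only [kd, ite_mul, one_mul, zero_mul, mul_ite, mul_zero, ← two_mul]
    simp; ring
  have s4 : ∑ i, γ * (γ - 1) * kd i i0 * kd i i0 * Mon i0 β (γ - 1 - 1) p
      = γ * (γ - 1) * Mon i0 β (γ - 1 - 1) p := by
    simp [kd]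
  rw [s1, s2, s3, s4]; ring

end Concrete

section Algebra

lemma scal_t2 (ρ a r σ ψ K f p Γ α pM ΓM δ0 : ℝ)
    (hr2 : 1 ≤ r ^ 2) (hσ : 1 ≤ σ) (hψ : 0 ≤ ψ) (hf : 0 ≤ f)
    (hpp : 0 ≤ p) (hpM : p ≤ pM) (hΓ : 0 ≤ Γ) (hΓM : Γ ≤ ΓM) (hδ0 : 0 < δ0)
    (hδ : δ0 ≤ Γ - p * f) (hα1 : 1 ≤ α) (hα2 : α ≤ 2) (hK : 64 ≤ K)
    (hK1 : 10 * ΓM + 4 * pM ^ 2 ≤ 4 * K * δ0) :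
    0 ≤ a ^ 2 * ρ ^ 2 * ψ * (r ^ 2 * σ * (4 * K * (ψ + 1) * (Γ - p * f)
      - ψ * Γ * (α + 7 / 2) + ψ * p * α * f) - 4 * ψ * p ^ 2 - 2 * ψ * r ^ 2 * Γ) := by
  have h1 : 4 * K * ψ * δ0 ≤ 4 * K * (ψ + 1) * (Γ - p * f) := by
    have : 4 * K * ψ ≤ 4 * K * (ψ + 1) := by linarith
    exact mul_le_mul this hδ hδ0.le (by positivity)
  have h2 : ψ * Γ * (α + 7 / 2) ≤ ψ * (6 * ΓM) := by
    rw [mul_assoc]; refine mul_le_mul_of_nonneg_left ?_ hψ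
    have : Γ * (α + 7 / 2) ≤ Γ * 6 := mul_le_mul_of_nonneg_left (by linarith) hΓ
    linarith
  have h3 : 0 ≤ ψ * p * α * f := by positivity
  have h4 : ψ * (4 * pM ^ 2 + 4 * ΓM) ≤ 4 * K * (ψ + 1) * (Γ - p * f)
    - ψ * Γ * (α + 7 / 2) + ψ * p * α * f := by
    have h41 := mul_le_mul_of_nonneg_left hK1 hψ
    have h42 : ψ * (4 * K * δ0) = 4 * K * ψ * δ0 := by ring
    have h43 : ψ * (10 * ΓM + 4 * pM ^ 2) = ψ * (4 * pM ^ 2 + 4 * ΓM) + ψ * (6 * ΓM) := by ring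
    linarith only [h41, h42, h43, h1, h2, h3]
  have h5 : 0 ≤ ψ * (4 * pM ^ 2 + 4 * ΓM) := by
    have : 0 ≤ ΓM := by linarith
    positivity
  have h6 : r ^ 2 * (ψ * (4 * pM ^ 2 + 4 * ΓM)) ≤ r ^ 2 * σ * (4 * K * (ψ + 1) * (Γ - p * f)
    - ψ * Γ * (α + 7 / 2) + ψ * p * α * f) := by
    have : r ^ 2 ≤ r ^ 2 * σ := le_mul_of_one_le_right (by positivity) hσ
    exact mul_le_mul this h4 h5 (by positivity)
  have h7 : 4 * ψ * p ^ 2 ≤ r ^ 2 * (ψ * (4 * pM ^ 2)) := by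
    have h71 : p ^ 2 ≤ pM ^ 2 := pow_le_pow_left₀ hpp hpM 2
    have h72 : ψ * (4 * p ^ 2) ≤ ψ * (4 * pM ^ 2) :=
      mul_le_mul_of_nonneg_left (by linarith) hψ
    have h73 : 0 ≤ ψ * (4 * pM ^ 2) := by positivity
    have h74 := le_mul_of_one_le_left h73 hr2
    linarith
  have h8 : 2 * ψ * r ^ 2 * Γ ≤ r ^ 2 * (ψ * (4 * ΓM)) := by
    have h81 : 2 * Γ ≤ 4 * ΓM := by linarith
    have h82 : 0 ≤ r ^ 2 * ψ := by positivity
    have := mul_le_mul_of_nonneg_left h81 h82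
    linarith
  have : 0 ≤ r ^ 2 * σ * (4 * K * (ψ + 1) * (Γ - p * f)
    - ψ * Γ * (α + 7 / 2) + ψ * p * α * f) - 4 * ψ * p ^ 2 - 2 * ψ * r ^ 2 * Γ := by
    have h9 : r ^ 2 * (ψ * (4 * pM ^ 2 + 4 * ΓM)) = r ^ 2 * (ψ * (4 * pM ^ 2)) + r ^ 2 * (ψ * (4 * ΓM)) := by ring
    linarith only [h9, h6, h7, h8]
  positivity

lemma scal_t1 (a ρ r σ ψ K f α : ℝ)
    (ha : 0 < a) (hρ : 0 < ρ) (hψ : 0 ≤ ψ) (hf : 0 ≤ f)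
    (hα1 : 1 ≤ α) (hα2 : α ≤ 2) (hK : 64 ≤ K) :
    0 ≤ a * ρ * r ^ 2 * f * σ ^ 2 * (K * (K + 1) * (ψ + 1) - α * ψ / 2
      - α * K * (ψ + 1) / 2 + ψ * α * (α - 1) / 16 + α * ψ / 8 + α * ψ - 4 * K * (ψ + 1)) := by
  have h1 : 0 ≤ ψ * α * (α - 1) := by
    have : 0 ≤ α - 1 := by linarith
    positivity
  have h2 : α * K * (ψ + 1) ≤ 2 * (K * (ψ + 1)) := by
    rw [mul_assoc]; exact mul_le_mul_of_nonneg_right hα2 (by positivity)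
  have h3 : 0 ≤ α * ψ := by positivity
  have h4 : 64 * (K * (ψ + 1)) ≤ K * (K * (ψ + 1)) :=
    mul_le_mul_of_nonneg_right hK (by positivity)
  have h5 : 0 ≤ K * (ψ + 1) := by positivity
  have h6 : K * (K + 1) * (ψ + 1) = K * (K * (ψ + 1)) + K * (ψ + 1) := by ring
  have h7 : 4 * K * (ψ + 1) = 4 * (K * (ψ + 1)) := by ring
  have : 0 ≤ K * (K + 1) * (ψ + 1) - α * ψ / 2
    - α * K * (ψ + 1) / 2 + ψ * α * (α - 1) / 16 + α * ψ / 8 + α * ψ - 4 * K * (ψ + 1) := by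
    linarith only [h1, h2, h3, h4, h5, h6, h7]
  positivity

lemma scal_t1b (a ρ r σ ψ K p L p0 pM CL : ℝ)
    (ha : 0 < a) (hρ : 0 < ρ) (hσ : 1 ≤ σ) (hψ : 0 ≤ ψ)
    (hp0 : 0 < p0) (hp : p0 ≤ p) (hpM : p ≤ pM) (hCL : 0 ≤ CL) (hL : L ≤ CL * ρ)
    (hK : 64 ≤ K) (hK2 : 4 * (8 * pM + CL) ≤ K * p0) :
    0 ≤ a * ψ * (ρ * p * σ ^ 2 * (3 * r ^ 2 / 16 + K / 4) - 8 * ρ * p * σ - L) := by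
  have hpp : 0 < p := by linarith
  have h1 : p0 * (K / 4) ≤ p * σ * (3 * r ^ 2 / 16 + K / 4) := by
    have h11 : p0 ≤ p * σ := hp.trans (le_mul_of_one_le_right hpp.le hσ)
    have h12 : K / 4 ≤ 3 * r ^ 2 / 16 + K / 4 := by
      have := sq_nonneg r
      linarith
    exact mul_le_mul h11 h12 (by linarith) (by positivity)
  have h3 : CL ≤ p * σ * (3 * r ^ 2 / 16 + K / 4) - 8 * p := by linarith
  have h4 : CL ≤ σ * (p * σ * (3 * r ^ 2 / 16 + K / 4) - 8 * p) :=
    h3.trans (le_mul_of_one_le_left (hCL.trans h3) hσ)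
  have h5 := mul_le_mul_of_nonneg_left h4 hρ.le
  have h6 : ρ * (σ * (p * σ * (3 * r ^ 2 / 16 + K / 4) - 8 * p)) =
    ρ * p * σ ^ 2 * (3 * r ^ 2 / 16 + K / 4) - 8 * ρ * p * σ := by ring
  have : 0 ≤ ρ * p * σ ^ 2 * (3 * r ^ 2 / 16 + K / 4) - 8 * ρ * p * σ - L := by
    linarith only [h5, h6, hL, mul_comm ρ CL]
  positivity

lemma scal_t0 (r σ K : ℝ) (hσ : 1 ≤ σ) (hK : 64 ≤ K) :
    0 ≤ 15 / 128 * r ^ 2 * σ ^ 3 + K * σ ^ 3 / 8 - 4 * σ ^ 2 - 1 - r ^ 2 * σ ^ 2 / 32 := by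
  have h1 : σ ^ 2 ≤ σ ^ 3 := pow_le_pow_right₀ hσ (by norm_num)
  have h2 : 1 ≤ σ ^ 2 := one_le_pow₀ hσ
  have h3 : 64 * σ ^ 3 ≤ K * σ ^ 3 := mul_le_mul_of_nonneg_right hK (by positivity)
  have h4 := mul_le_mul_of_nonneg_left h1 (by positivity : (0:ℝ) ≤ r ^ 2)
  have h5 : 0 ≤ r ^ 2 * σ ^ 2 := by positivity
  linarith

set_option maxHeartbeats 1000000 in
lemma scal (a ρ r σ T K f p Γ Θ L α p0 pM ΓM δ0 CL N : ℝ)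
    (ha : 0 < a) (hρ : 0 < ρ) (hr : 1 ≤ r) (hσ : 1 ≤ σ) (hT : 1 ≤ T) (hf : 0 ≤ f)
    (hp0 : 0 < p0) (hp : p0 ≤ p) (hpM : p ≤ pM) (hΓ : 0 ≤ Γ) (hΓM : Γ ≤ ΓM) (hδ0 : 0 < δ0)
    (hδ : δ0 ≤ Γ - p * f) (hΘ : p * Γ ≤ Θ) (hCL : 0 ≤ CL) (hL : L ≤ CL * ρ)
    (hα1 : 1 ≤ α) (hα2 : α ≤ 2) (hK : 64 ≤ K) (hK1 : 10 * ΓM + 4 * pM ^ 2 ≤ 4 * K * δ0)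
    (hK2 : 4 * (8 * pM + CL) ≤ K * p0)
    (hN : N = a * (K * (K + 1) * T * σ ^ 2) * (ρ * r ^ 2 * f) - (r ^ 2 + K) * σ ^ 3 / 8
      - 4 * ((a * (T - 1) * ρ * r) * (-(a * K * T * σ * ρ * r)) * Γ
        + (a * (T - 1) * ρ * r) * (r * σ ^ 2 / 8) * (α * f)
        - (-(a * K * T * σ * ρ * r)) * (r * σ / 8) * (α * f) - r ^ 2 * σ ^ 3 / 64)
      + 4 * ((a * (T - 1) * ρ) * ((a * (T - 1) * ρ * r) ^ 2 * Θ
          - 2 * (a * (T - 1) * ρ * r) * (r * σ / 8) * ((α - 1) * Γ)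
          + (r * σ / 8) ^ 2 * ((α - 1) * (α * f)))
        - (σ / 8) * ((a * (T - 1) * ρ * r) ^ 2 * Γ - 2 * (a * (T - 1) * ρ * r) * (r * σ / 8) * (α * f)
          + (r * σ / 8) ^ 2))
      - a * (T - 1) * L
      - 2 * (2 * (a * (T - 1) * ρ) * p + 2 * σ)
        * (((a * (T - 1) * ρ * r) ^ 2 * Γ - 2 * (a * (T - 1) * ρ * r) * (r * σ / 8) * (α * f)
          + (r * σ / 8) ^ 2) - (-(a * K * T * σ) * (ρ * r ^ 2 * f) + (r ^ 2 + K) * σ ^ 2 / 16))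
      - (2 * (a * (T - 1) * ρ) * p + 2 * σ) ^ 2) :
    1 + 2 * ((a * (T - 1) * ρ * r) ^ 2 * Γ - 2 * (a * (T - 1) * ρ * r) * (r * σ / 8) * (α * f)
          + (r * σ / 8) ^ 2) ≤ N := by
  obtain ⟨ψ, rfl⟩ : ∃ ψ, T = ψ + 1 := ⟨T - 1, by ring⟩
  have hψ : 0 ≤ ψ := by linarith only [hT]
  have hpp : 0 ≤ p := by linarith only [hp, hp0]
  have hr2 : 1 ≤ r ^ 2 := one_le_pow₀ hr
  have t3 : 0 ≤ a ^ 3 * ψ ^ 3 * ρ ^ 3 * r ^ 2 * (4 * (Θ - p * Γ)) := by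
    have : 0 ≤ Θ - p * Γ := by linarith only [hΘ]
    positivity
  have t2 := scal_t2 ρ a r σ ψ K f p Γ α pM ΓM δ0 hr2 hσ hψ hf hpp hpM hΓ hΓM hδ0 hδ hα1 hα2 hK hK1
  have t1 := scal_t1 a ρ r σ ψ K f α ha hρ hψ hf hα1 hα2 hK
  have t1b := scal_t1b a ρ r σ ψ K p L p0 pM CL ha hρ hσ hψ hp0 hp hpM hCL hL hK hK2
  have t0 := scal_t0 r σ K hσ hK
  have t4 : 0 ≤ a * ψ * ρ * r ^ 2 * σ * f * α * (1 / 2) := by positivity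
  rw [← sub_nonneg, hN]
  refine le_of_le_of_eq (add_nonneg (add_nonneg (add_nonneg (add_nonneg (add_nonneg t3 t2) t1) t1b) t0) t4) ?_
  ring

lemma sum_kd {n : ℕ} (w v : Fin n → ℝ) : ∑ i, ∑ j, kd i j * w i * v j = ∑ i, w i * v i := by
  simp [kd]

lemma bil {n : ℕ} (y gr : Fin n → ℝ) (hm : Fin n → Fin n → ℝ) (α F Γ Θ b k : ℝ)
    (hgy : ∑ i, gr i * y i = F) (hgg : ∑ i, gr i ^ 2 = Γ)
    (hE : ∀ i, ∑ j, hm i j * y j = (α - 1) * gr i) (hs : ∀ i j, hm i j = hm j i)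
    (hΘ : ∑ i, ∑ j, hm i j * gr i * gr j = Θ) :
    ∑ i, ∑ j, hm i j * (b * gr i - k * y i) * (b * gr j - k * y j)
      = b ^ 2 * Θ - 2 * b * k * ((α - 1) * Γ) + k ^ 2 * ((α - 1) * F) := by
  have h1 : ∑ i, ∑ j, hm i j * gr i * y j = (α - 1) * Γ := by
    rw [← hgg, Finset.mul_sum]
    refine Finset.sum_congr rfl (fun i _ => ?_)
    have := hE i
    calc ∑ j, hm i j * gr i * y j = gr i * ∑ j, hm i j * y j := by
          rw [Finset.mul_sum]; exact Finset.sum_congr rfl (fun j _ => by ring)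
      _ = _ := by rw [this]; ring
  have h2 : ∑ i, ∑ j, hm i j * y i * gr j = (α - 1) * Γ := by
    rw [← h1, Finset.sum_comm]
    refine Finset.sum_congr rfl (fun i _ => Finset.sum_congr rfl (fun j _ => ?_))
    rw [hs j i]; ring
  have h3 : ∑ i, ∑ j, hm i j * y i * y j = (α - 1) * F := by
    rw [← hgy, Finset.mul_sum]
    refine Finset.sum_congr rfl (fun i _ => ?_)
    have := hE i
    calc ∑ j, hm i j * y i * y j = y i * ∑ j, hm i j * y j := by
          rw [Finset.mul_sum]; exact Finset.sum_congr rfl (fun j _ => by ring)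
      _ = _ := by rw [this]; ring
  calc _ = b ^ 2 * ∑ i, ∑ j, hm i j * gr i * gr j - b * k * ∑ i, ∑ j, hm i j * gr i * y j
        - b * k * ∑ i, ∑ j, hm i j * y i * gr j + k ^ 2 * ∑ i, ∑ j, hm i j * y i * y j := by
        simp only [Finset.mul_sum, ← Finset.sum_sub_distrib, ← Finset.sum_add_distrib]
        exact Finset.sum_congr rfl (fun i _ => Finset.sum_congr rfl (fun j _ => by ring))
    _ = _ := by rw [hΘ, h1, h2, h3]; ring

lemma dotl {n : ℕ} (y gr : Fin n → ℝ) (F Γ b k b' k' : ℝ) (hy : ∑ i, y i ^ 2 = 1)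
    (hgy : ∑ i, gr i * y i = F) (hgg : ∑ i, gr i ^ 2 = Γ) :
    ∑ i, (b * gr i - k * y i) * (b' * gr i + k' * y i)
      = b * b' * Γ + b * k' * F - b' * k * F - k * k' := by
  calc _ = b * b' * ∑ i, gr i ^ 2 + b * k' * ∑ i, gr i * y i - b' * k * ∑ i, gr i * y i
        - k * k' * ∑ i, y i ^ 2 := by
        simp only [Finset.mul_sum, ← Finset.sum_sub_distrib, ← Finset.sum_add_distrib]
        exact Finset.sum_congr rfl (fun i _ => by ring)
    _ = _ := by rw [hy, hgy, hgg]; ring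

set_option maxHeartbeats 1000000 in
lemma final_alg {n : ℕ} (y gr : Fin n → ℝ) (hm : Fin n → Fin n → ℝ)
    (a ρ r σ T K f p Γ Θ L α p0 pM ΓM δ0 CL : ℝ)
    (hy : ∑ i, y i ^ 2 = 1)
    (hgy : ∑ i, gr i * y i = α * f) (hgg : ∑ i, gr i ^ 2 = Γ)
    (hE : ∀ i, ∑ j, hm i j * y j = (α - 1) * gr i) (hs : ∀ i j, hm i j = hm j i)
    (hΘ' : ∑ i, ∑ j, hm i j * gr i * gr j = Θ)
    (hpsd : ∀ w : Fin n → ℝ, -p * ∑ i, w i ^ 2 ≤ ∑ i, ∑ j, hm i j * w i * w j)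
    (ha : 0 < a) (hρ : 0 < ρ) (hr : 1 ≤ r) (hσ : 1 ≤ σ) (hT : 1 ≤ T) (hf : 0 ≤ f)
    (hp0 : 0 < p0) (hp : p0 ≤ p) (hpM : p ≤ pM) (hΓM : Γ ≤ ΓM) (hδ0 : 0 < δ0)
    (hδ : δ0 ≤ Γ - p * f) (hΘ : p * Γ ≤ Θ) (hCL : 0 ≤ CL) (hL : L ≤ CL * ρ)
    (hα1 : 1 ≤ α) (hα2 : α ≤ 2) (hK : 64 ≤ K) (hK1 : 10 * ΓM + 4 * pM ^ 2 ≤ 4 * K * δ0)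
    (hK2 : 4 * (8 * pM + CL) ≤ K * p0)
    (P1 Pt1 : Fin n → ℝ) (P2 : Fin n → Fin n → ℝ) (Pt Ptt h N : ℝ)
    (hP1 : ∀ i, P1 i = a * (T - 1) * ρ * r * gr i - r * σ / 8 * y i)
    (hP2 : ∀ i j, P2 i j = a * (T - 1) * ρ * hm i j - σ / 8 * kd i j)
    (hPt1 : ∀ i, Pt1 i = -(a * K * T * σ * ρ * r) * gr i + r * σ ^ 2 / 8 * y i)
    (hPt : Pt = -(a * K * T * σ) * (ρ * r ^ 2 * f) + (r ^ 2 + K) * σ ^ 2 / 16)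
    (hPtt : Ptt = a * (K * (K + 1) * T * σ ^ 2) * (ρ * r ^ 2 * f) - (r ^ 2 + K) * σ ^ 3 / 8)
    (hh : h = 2 * (a * (T - 1) * ρ) * p + 2 * σ)
    (hN : N = Ptt - 4 * ∑ i, P1 i * Pt1 i + 4 * ∑ i, ∑ j, P2 i j * P1 i * P1 j
      - a * (T - 1) * L - 2 * h * (∑ i, P1 i ^ 2 - Pt) - h ^ 2)
    (w : Fin n → ℝ) (v : ℝ) :
    v ^ 2 + ∑ i, (w i - P1 i * v) ^ 2 ≤
      4 * ∑ i, ∑ j, P2 i j * w i * w j + 2 * h * ∑ i, w i ^ 2 + N * v ^ 2 := by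
  set b := a * (T - 1) * ρ * r with hb
  set k := r * σ / 8 with hk
  have hΓ : 0 ≤ Γ := by rw [← hgg]; positivity
  have e1 : ∑ i, P1 i ^ 2 = b ^ 2 * Γ - 2 * b * k * (α * f) + k ^ 2 := by
    have := dotl y gr (α * f) Γ b k b (-k) hy hgy hgg
    calc ∑ i, P1 i ^ 2 = ∑ i, (b * gr i - k * y i) * (b * gr i + (-k) * y i) :=
          Finset.sum_congr rfl (fun i _ => by rw [hP1]; ring)
      _ = _ := by rw [this]; ring
  have e2 : ∑ i, P1 i * Pt1 i = b * (-(a * K * T * σ * ρ * r)) * Γ + b * (r * σ ^ 2 / 8) * (α * f)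
      - (-(a * K * T * σ * ρ * r)) * k * (α * f) - k * (r * σ ^ 2 / 8) := by
    rw [← dotl y gr (α * f) Γ b k (-(a * K * T * σ * ρ * r)) (r * σ ^ 2 / 8) hy hgy hgg]
    exact Finset.sum_congr rfl (fun i _ => by rw [hP1, hPt1])
  have split2 : ∀ w : Fin n → ℝ, ∑ i, ∑ j, P2 i j * w i * w j
      = a * (T - 1) * ρ * ∑ i, ∑ j, hm i j * w i * w j - σ / 8 * ∑ i, w i ^ 2 := by
    intro w
    have hk := sum_kd w w
    have : ∑ i, w i ^ 2 = ∑ i, w i * w i := Finset.sum_congr rfl (fun i _ => by ring)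
    rw [this, ← hk]
    simp only [Finset.mul_sum, ← Finset.sum_sub_distrib]
    exact Finset.sum_congr rfl (fun i _ => Finset.sum_congr rfl (fun j _ => by rw [hP2]; ring))
  have e3 : ∑ i, ∑ j, hm i j * P1 i * P1 j
      = b ^ 2 * Θ - 2 * b * k * ((α - 1) * Γ) + k ^ 2 * ((α - 1) * (α * f)) := by
    rw [← bil y gr hm α (α * f) Γ Θ b k hgy hgg hE hs hΘ']
    simp only [hP1]
  have main := scal a ρ r σ T K f p Γ Θ L α p0 pM ΓM δ0 CL N ha hρ hr hσ hT hf hp0 hp hpM hΓ hΓM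
    hδ0 hδ hΘ hCL hL hα1 hα2 hK hK1 hK2 (by
      rw [hN, split2, e1, e2, e3, hPtt, hPt, hh, hb, hk]; ring)
  rw [← hb, ← hk, ← e1] at main
  have c1 : 0 ≤ a * (T - 1) * ρ := by
    have : 0 ≤ T - 1 := by linarith
    positivity
  have hform : 2 * ∑ i, w i ^ 2 ≤ 4 * ∑ i, ∑ j, P2 i j * w i * w j + 2 * h * ∑ i, w i ^ 2 := by
    rw [split2, hh]
    have h1 := mul_le_mul_of_nonneg_left (hpsd w) c1
    have h2 : 0 ≤ ∑ i, w i ^ 2 := by positivity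
    have h3 : ∑ i, w i ^ 2 ≤ σ * ∑ i, w i ^ 2 := le_mul_of_one_le_left h2 hσ
    linarith only [h1, h2, h3]
  have hsum : ∑ i, (w i - P1 i * v) ^ 2 ≤ 2 * ∑ i, w i ^ 2 + 2 * (∑ i, P1 i ^ 2) * v ^ 2 := by
    simp only [Finset.mul_sum, Finset.sum_mul, ← Finset.sum_add_distrib]
    refine Finset.sum_le_sum (fun i _ => ?_)
    linarith only [sq_nonneg (w i + P1 i * v)]
  have hNv := mul_le_mul_of_nonneg_right main (sq_nonneg v)
  linarith only [hNv, hsum, hform]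

end Algebra

section Numeric

lemma num_R (y : ℝ) (ha : 13/20 ≤ y) (hb : y ≤ 1) :
    0 ≤ (1999/1000)^4*((1-y)^2*(1+23/100*y)^3) - (1999/1000)^2*(123/50)*((1-y)*(1+23/100*y)^2)
      + (123/50)^2*(173/73*y-1)*(2*(1999/1000)^2*(1+23/100*y)-173/50*(123/50)) := by
  have h1 : 0 ≤ y - 13/20 := by linarith
  have h2 : 0 ≤ 1 - y := by linarith
  linarith only [mul_nonneg (pow_nonneg h1 0) (pow_nonneg h2 5), mul_nonneg (pow_nonneg h1 1) (pow_nonneg h2 4), mul_nonneg (pow_nonneg h1 2) (pow_nonneg h2 3), mul_nonneg (pow_nonneg h1 3) (pow_nonneg h2 2), mul_nonneg (pow_nonneg h1 4) (pow_nonneg h2 1), mul_nonneg (pow_nonneg h1 5) (pow_nonneg h2 0)]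

lemma num_P (y : ℝ) (ha : 73/173 ≤ y) (hb : y ≤ 7/10) :
    0 ≤ (1999/1000)^4*(1-9057/10000*y*(77/100+23/65*y))^3
      - (1999/1000)^2*(123/50)*(1-9057/10000*y*(77/100+23/65*y))^2
      + (123/50)^2*(173/73*y-1)*(2*(1999/1000)^2*(1-9057/10000*y*(77/100+23/65*y))
        -173/50*(123/50)*(1-y)) := by
  have h1 : 0 ≤ y - 73/173 := by linarith
  have h2 : 0 ≤ 7/10 - y := by linarith
  linarith only [mul_nonneg (pow_nonneg h1 0) (pow_nonneg h2 6), mul_nonneg (pow_nonneg h1 1) (pow_nonneg h2 5), mul_nonneg (pow_nonneg h1 2) (pow_nonneg h2 4), mul_nonneg (pow_nonneg h1 3) (pow_nonneg h2 3), mul_nonneg (pow_nonneg h1 4) (pow_nonneg h2 2), mul_nonneg (pow_nonneg h1 5) (pow_nonneg h2 1), mul_nonneg (pow_nonneg h1 6) (pow_nonneg h2 0)]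


lemma num_mono (q q0 τ : ℝ) (A : ℝ) (h0 : 0 ≤ q0) (h : q0 ≤ q)
    (hc : (1/16 ≤ τ ∧ 0 ≤ τ) ∨ (3/5 ≤ q0 ∧ 0 ≤ τ))
    (hP : 0 ≤ (1999/1000)^4*q0^3 - (1999/1000)^2*(123/50)*q0^2
      + (123/50)^2*τ*(2*(1999/1000)^2*q0 + A)) :
    0 ≤ (1999/1000)^4*q^3 - (1999/1000)^2*(123/50)*q^2
      + (123/50)^2*τ*(2*(1999/1000)^2*q + A) := by
  have hbr : 0 ≤ (1999/1000)^2*(q^2+q*q0+q0^2) - (123/50)*(q+q0) + 2*(123/50)^2*τ := by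
    rcases hc with ⟨h1, h2⟩ | ⟨h1, h2⟩
    · nlinarith [sq_nonneg (q - q0), sq_nonneg (q + q0 - 41/100)]
    · nlinarith [sq_nonneg (q - q0), mul_nonneg (by linarith : 0 ≤ q - 3/5) (by linarith : 0 ≤ q0 - 3/5)]
  have h3 := mul_nonneg (sub_nonneg.2 h) hbr
  have h4 := mul_nonneg (by norm_num : (0:ℝ) ≤ (1999/1000)^2) h3
  linarith only [h4, hP]

lemma num_c : (13/20:ℝ)^(23/100:ℝ) ≤ 9057/10000 := by
  have h : ((13/20:ℝ)^(23/100:ℝ))^100 ≤ (9057/10000:ℝ)^100 := by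
    rw [← Real.rpow_natCast, ← Real.rpow_mul (by norm_num)]
    rw [show (23/100:ℝ) * ((100:ℕ):ℝ) = ((23:ℕ):ℝ) by norm_num, Real.rpow_natCast]
    norm_num
  exact le_of_pow_le_pow_left₀ (by norm_num) (by norm_num) h

lemma num_pow1 (y : ℝ) (hy : 0 ≤ y) : y^(23/100:ℝ) ≤ 77/100 + 23/100*y := by
  have := rpow_one_add_le_one_add_mul_self (s := y - 1) (by linarith) (p := 23/100)
    (by norm_num) (by norm_num)
  rw [show 1 + (y-1) = y by ring] at this
  linarith

lemma num_pow2 (y : ℝ) (hy : 0 ≤ y) : y^(23/100:ℝ) ≤ 9057/10000*(77/100 + 23/65*y) := by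
  have h1 := num_pow1 (y/(13/20)) (by positivity)
  have h2 : y^(23/100:ℝ) = (13/20:ℝ)^(23/100:ℝ) * (y/(13/20))^(23/100:ℝ) := by
    rw [← Real.mul_rpow (by norm_num) (by positivity)]
    congr 1; ring
  rw [h2]
  refine mul_le_mul num_c (h1.trans (le_of_eq (by ring))) (by positivity) (by norm_num)

lemma num_main (ε s : ℝ) (h0 : 0 < ε) (hε : ε < Real.sqrt (73/173)) (hs : ε < s) (hs1 : s ≤ 1)
    (q τ : ℝ) (hq : q = 1 - (ε/s)^(123/50:ℝ)) (hτ : τ = 1/s^2 - 1) :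
    (0 ≤ (1999/1000)^4*q^3 - (1999/1000)^2*(123/50)*q^2
      + (123/50)^2*τ*(2*(1999/1000)^2*q + (123/50)*((123/50-1)*τ-2)))
    ∧ 1/100 ≤ ((1999/1000)^2+1999/1000)*q^2 - 123/50*q + (123/50)^2*τ ∧ 0 ≤ q ∧ q ≤ 1 ∧ 0 ≤ τ := by
  have hs0 : 0 < s := h0.trans hs
  have hx1 : ε/s ≤ 1 := by rw [div_le_one hs0]; exact hs.le
  have hx0 : 0 < ε/s := by positivity
  have hq0 : 0 ≤ q := by
    rw [hq, sub_nonneg]; exact Real.rpow_le_one hx0.le hx1 (by norm_num)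
  have hq1 : q ≤ 1 := by
    rw [hq]; have := Real.rpow_nonneg hx0.le (123/50); linarith
  have hτ0 : 0 ≤ τ := by
    rw [hτ, sub_nonneg, le_div_iff₀ (by positivity), one_mul]
    exact pow_le_one₀ hs0.le hs1
  have hε2 : ε^2 ≤ 73/173 := by
    have := Real.sq_sqrt (show (0:ℝ) ≤ 73/173 by norm_num)
    rw [← this]; exact pow_le_pow_left₀ h0.le hε.le 2
  obtain ⟨y, hy⟩ : ∃ y, y = 73/173*(1+τ) := ⟨_, rfl⟩
  have hyl : 73/173 ≤ y := by rw [hy]; linarith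
  have hy0 : 0 < y := by linarith
  have hτy : τ = 173/73*y - 1 := by rw [hy]; ring
  have hxy : (ε/s)^2 ≤ y := by
    rw [hy, hτ, div_pow, show (73/173:ℝ)*(1+(1/s^2-1)) = (73/173)/s^2 by ring]
    gcongr
  have hxp : (ε/s)^(123/50:ℝ) ≤ y * y^(23/100:ℝ) := by
    have e1 : (ε/s)^(123/50:ℝ) = ((ε/s)^2)^(123/100:ℝ) := by
      rw [← Real.rpow_natCast, ← Real.rpow_mul hx0.le]; norm_num
    have e2 : y * y^(23/100:ℝ) = y^(123/100:ℝ) := by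
      rw [show (123/100:ℝ) = 1 + 23/100 by norm_num, Real.rpow_add hy0, Real.rpow_one]
    rw [e1, e2]
    exact Real.rpow_le_rpow (by positivity) hxy (by norm_num)
  have b1 : (1-y)*(1+23/100*y) ≤ q := by
    have := mul_le_mul_of_nonneg_left (num_pow1 y hy0.le) hy0.le
    rw [hq]; linarith
  have b2 : 1 - 9057/10000*y*(77/100+23/65*y) ≤ q := by
    have := mul_le_mul_of_nonneg_left (num_pow2 y hy0.le) hy0.le
    rw [hq]; linarith
  have b3 : y ≤ 9/20 → 3/5 ≤ 1 - 9057/10000*y*(77/100+23/65*y) := by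
    intro h
    have := mul_le_mul h h hy0.le (by norm_num)
    linarith
  refine ⟨?_, ?_, hq0, hq1, hτ0⟩
  · rcases le_total 1 y with h | h
    · have g1 : 0 ≤ (123/50)*((123/50-1)*τ-2) := by linarith
      have g2 : 0 ≤ (1999/1000)^2*q^2 - 123/50*q + 2*(123/50)^2*τ := by
        have := sq_nonneg q
        linarith
      have g3 := mul_nonneg (mul_nonneg (by norm_num : (0:ℝ) ≤ (1999/1000)^2) hq0) g2
      have g4 := mul_nonneg (mul_nonneg (by norm_num : (0:ℝ) ≤ (123/50)^2) hτ0) g1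
      linarith only [g3, g4]
    · rcases le_total (7/10) y with h7 | h7
      · refine num_mono q _ τ _ ?_ b1 (Or.inl ⟨by linarith, hτ0⟩) ?_
        · exact mul_nonneg (by linarith) (by linarith)
        · have := mul_nonneg (by linarith : 0 ≤ 1 - y) (num_R y (by linarith) h)
          rw [hτy]
          linarith only [this]
      · refine num_mono q _ τ _ ?_ b2 ?_ ?_
        · have := mul_le_mul h7 h7 hy0.le (by norm_num)
          linarith
        · rcases le_total y (9/20) with h9 | h9
          · exact Or.inr ⟨b3 h9, hτ0⟩
          · exact Or.inl ⟨by linarith, hτ0⟩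
        · have := num_P y hyl h7
          rw [hτy]
          linarith only [this]
  · rcases le_total y (9/20) with h9 | h9
    · have := (b3 h9).trans b2
      have := mul_le_mul this this (by norm_num) hq0
      nlinarith
    · have := sq_nonneg (q - 1/5)
      have h5 : 1/16 ≤ τ := by linarith
      linarith

end Numeric

section Separable

variable {n : ℕ} {U : Set (EuclideanSpace ℝ (Fin n) × ℝ)}

/-- spatial functions -/
def Sp (U : Set (EuclideanSpace ℝ (Fin n) × ℝ)) (g : EuclideanSpace ℝ (Fin n) × ℝ → ℝ) : Prop :=
  Sm U g ∧ ∀ p ∈ U, pd (tt n) g p = 0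

/-- temporal functions -/
def Tm (U : Set (EuclideanSpace ℝ (Fin n) × ℝ)) (g : EuclideanSpace ℝ (Fin n) × ℝ → ℝ) : Prop :=
  Sm U g ∧ ∀ p ∈ U, ∀ i, pd (bb i) g p = 0

/-- sum of two separated products -/
def sep (g1 τ1 g2 τ2 : EuclideanSpace ℝ (Fin n) × ℝ → ℝ) (p : EuclideanSpace ℝ (Fin n) × ℝ) : ℝ :=
  g1 p * τ1 p + g2 p * τ2 p

lemma Sp.bb (hU : IsOpen U) {g} (h : Sp U g) (i : Fin n) : Sp U (pd (bb i) g) :=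
  ⟨h.1.pd hU _, fun p hp => by
    rw [pd_comm hU h.1 _ _ hp, pd_congr hU (G := fun _ => 0) h.2 _ hp, pd_const]⟩

lemma Tm.tt (hU : IsOpen U) {g} (h : Tm U g) : Tm U (pd (tt n) g) :=
  ⟨h.1.pd hU _, fun p hp i => by
    rw [pd_comm hU h.1 _ _ hp, pd_congr hU (G := fun _ => 0) (fun q hq => h.2 q hq i) _ hp, pd_const]⟩

lemma Sp.sum {ι : Type*} {s : Finset ι} (hU : IsOpen U) {g : ι → _ → ℝ} (h : ∀ i, Sp U (g i)) :
    Sp U (fun p => ∑ i ∈ s, g i p) :=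
  ⟨Sm.sum (fun i => (h i).1), fun p hp => by
    rw [pd_sum hU (fun i => (h i).1) _ hp]
    exact Finset.sum_eq_zero (fun i _ => (h i).2 p hp)⟩

lemma Sp.const (c : ℝ) : Sp U (fun _ => c) := ⟨Sm.const c, fun p _ => pd_const c _ p⟩

lemma Sp.add (hU : IsOpen U) {f g} (hf : Sp U f) (hg : Sp U g) : Sp U (fun p => f p + g p) :=
  ⟨hf.1.add hg.1, fun p hp => by rw [pd_add hU hf.1 hg.1 _ hp, hf.2 p hp, hg.2 p hp, add_zero]⟩

lemma Sp.cmul (hU : IsOpen U) {g} (hg : Sp U g) (c : ℝ) : Sp U (fun p => c * g p) :=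
  ⟨(Sm.const c).mul hg.1, fun p hp => by
    rw [pd_mul hU (Sm.const c) hg.1 _ hp, hg.2 p hp, pd_const]; ring⟩

lemma pd_cmul (hU : IsOpen U) {g} (hg : Sm U g) (c : ℝ) (e) {p} (hp : p ∈ U) :
    pd e (fun p => c * g p) p = c * pd e g p := by
  rw [pd_mul hU (Sm.const c) hg _ hp, pd_const]; ring

lemma sep_sm {g1 τ1 g2 τ2} (h1 : Sp U g1) (k1 : Tm U τ1) (h2 : Sp U g2) (k2 : Tm U τ2) :
    Sm U (sep g1 τ1 g2 τ2) := (h1.1.mul k1.1).add (h2.1.mul k2.1)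

lemma sep_bb (hU : IsOpen U) {g1 τ1 g2 τ2} (h1 : Sp U g1) (k1 : Tm U τ1) (h2 : Sp U g2)
    (k2 : Tm U τ2) (i : Fin n) {p} (hp : p ∈ U) :
    pd (bb i) (sep g1 τ1 g2 τ2) p = sep (pd (bb i) g1) τ1 (pd (bb i) g2) τ2 p := by
  unfold sep
  rw [pd_add hU (h1.1.mul k1.1) (h2.1.mul k2.1) _ hp, pd_mul hU h1.1 k1.1 _ hp,
    pd_mul hU h2.1 k2.1 _ hp, k1.2 p hp, k2.2 p hp]
  ring

lemma sep_tt (hU : IsOpen U) {g1 τ1 g2 τ2} (h1 : Sp U g1) (k1 : Tm U τ1) (h2 : Sp U g2)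
    (k2 : Tm U τ2) {p} (hp : p ∈ U) :
    pd (tt n) (sep g1 τ1 g2 τ2) p = sep g1 (pd (tt n) τ1) g2 (pd (tt n) τ2) p := by
  unfold sep
  rw [pd_add hU (h1.1.mul k1.1) (h2.1.mul k2.1) _ hp, pd_mul hU h1.1 k1.1 _ hp,
    pd_mul hU h2.1 k2.1 _ hp, h1.2 p hp, h2.2 p hp]
  ring

lemma sep_bb2 (hU : IsOpen U) {g1 τ1 g2 τ2} (h1 : Sp U g1) (k1 : Tm U τ1) (h2 : Sp U g2)
    (k2 : Tm U τ2) (i j : Fin n) {p} (hp : p ∈ U) :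
    pd (bb i) (pd (bb j) (sep g1 τ1 g2 τ2)) p
      = sep (pd (bb i) (pd (bb j) g1)) τ1 (pd (bb i) (pd (bb j) g2)) τ2 p := by
  rw [pd_congr hU (fun q hq => sep_bb hU h1 k1 h2 k2 j hq) _ hp,
    sep_bb hU (h1.bb hU j) k1 (h2.bb hU j) k2 i hp]

lemma sep_tt_bb (hU : IsOpen U) {g1 τ1 g2 τ2} (h1 : Sp U g1) (k1 : Tm U τ1) (h2 : Sp U g2)
    (k2 : Tm U τ2) (j : Fin n) {p} (hp : p ∈ U) :
    pd (tt n) (pd (bb j) (sep g1 τ1 g2 τ2)) p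
      = sep (pd (bb j) g1) (pd (tt n) τ1) (pd (bb j) g2) (pd (tt n) τ2) p := by
  rw [pd_congr hU (fun q hq => sep_bb hU h1 k1 h2 k2 j hq) _ hp,
    sep_tt hU (h1.bb hU j) k1 (h2.bb hU j) k2 hp]

lemma sep_tt2 (hU : IsOpen U) {g1 τ1 g2 τ2} (h1 : Sp U g1) (k1 : Tm U τ1) (h2 : Sp U g2)
    (k2 : Tm U τ2) {p} (hp : p ∈ U) :
    pd (tt n) (pd (tt n) (sep g1 τ1 g2 τ2)) p
      = sep g1 (pd (tt n) (pd (tt n) τ1)) g2 (pd (tt n) (pd (tt n) τ2)) p := by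
  rw [pd_congr hU (fun q hq => sep_tt hU h1 k1 h2 k2 hq) _ hp,
    sep_tt hU h1 (k1.tt hU) h2 (k2.tt hU) hp]

lemma LapLap (hU : IsOpen U) {g} (h : Sm U g) {p} (hp : p ∈ U) :
    ∑ i : Fin n, ∑ j : Fin n, pd (bb i) (pd (bb i) (pd (bb j) (pd (bb j) g))) p = Lap (Lap g) p := by
  unfold Lap
  refine Finset.sum_congr rfl (fun i _ => ?_)
  have hs : ∀ j : Fin n, Sm U (pd (bb j) (pd (bb j) g)) := fun j => (h.pd hU _).pd hU _
  have e : ∀ q ∈ U, pd (bb i) (fun q => ∑ j : Fin n, pd (bb j) (pd (bb j) g) q) q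
      = ∑ j : Fin n, pd (bb i) (pd (bb j) (pd (bb j) g)) q := fun q hq => pd_sum hU hs _ hq
  rw [pd_congr hU e _ hp, pd_sum hU (fun j => (hs j).pd hU _) _ hp]

lemma sep_LapLap (hU : IsOpen U) {g1 τ1 g2 τ2} (h1 : Sp U g1) (k1 : Tm U τ1) (h2 : Sp U g2)
    (k2 : Tm U τ2) {p} (hp : p ∈ U) :
    ∑ i : Fin n, ∑ j : Fin n, pd (bb i) (pd (bb i) (pd (bb j) (pd (bb j) (sep g1 τ1 g2 τ2)))) p
      = Lap (Lap g1) p * τ1 p + Lap (Lap g2) p * τ2 p := by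
  rw [← LapLap hU h1.1 hp, ← LapLap hU h2.1 hp]
  simp only [Finset.sum_mul, ← Finset.sum_add_distrib]
  refine Finset.sum_congr rfl (fun i _ => Finset.sum_congr rfl (fun j _ => ?_))
  have e : ∀ q ∈ U, pd (bb i) (pd (bb j) (pd (bb j) (sep g1 τ1 g2 τ2))) q =
      pd (bb i) (sep (pd (bb j) (pd (bb j) g1)) τ1 (pd (bb j) (pd (bb j) g2)) τ2) q :=
    fun q hq => pd_congr hU (fun q hq => sep_bb2 hU h1 k1 h2 k2 j j hq) _ hq
  rw [pd_congr hU e _ hp, sep_bb2 hU ((h1.bb hU j).bb hU j) k1 ((h2.bb hU j).bb hU j) k2 i i hp]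
  rfl

lemma sep_Lap (hU : IsOpen U) {g1 τ1 g2 τ2} (h1 : Sp U g1) (k1 : Tm U τ1) (h2 : Sp U g2)
    (k2 : Tm U τ2) {p} (hp : p ∈ U) :
    ∑ i : Fin n, pd (bb i) (pd (bb i) (sep g1 τ1 g2 τ2)) p
      = Lap g1 p * τ1 p + Lap g2 p * τ2 p := by
  unfold Lap
  simp only [Finset.sum_mul, ← Finset.sum_add_distrib]
  exact Finset.sum_congr rfl (fun i _ => sep_bb2 hU h1 k1 h2 k2 i i hp)

lemma Lap_congr (hU : IsOpen U) {F G : EuclideanSpace ℝ (Fin n) × ℝ → ℝ} (h : ∀ p ∈ U, F p = G p)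
    {p} (hp : p ∈ U) : Lap F p = Lap G p :=
  Finset.sum_congr rfl (fun i _ => pd_congr hU (fun _ hq => pd_congr hU h _ hq) _ hp)

lemma Lap_lin (hU : IsOpen U) {F G : EuclideanSpace ℝ (Fin n) × ℝ → ℝ} (hF : Sm U F) (hG : Sm U G)
    (c d : ℝ) {p} (hp : p ∈ U) : Lap (fun p => c * F p + d * G p) p = c * Lap F p + d * Lap G p := by
  unfold Lap
  simp only [Finset.mul_sum, ← Finset.sum_add_distrib]
  refine Finset.sum_congr rfl (fun i _ => ?_)
  have e : ∀ q ∈ U, pd (bb i) (fun p => c * F p + d * G p) q = c * pd (bb i) F q + d * pd (bb i) G q :=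
    fun q hq => by
      rw [pd_add hU ((Sm.const c).mul hF) ((Sm.const d).mul hG) _ hq, pd_cmul hU hF _ _ hq,
        pd_cmul hU hG _ _ hq]
  rw [pd_congr hU e _ hp, pd_add hU ((Sm.const c).mul (hF.pd hU _)) ((Sm.const d).mul (hG.pd hU _)) _ hp,
    pd_cmul hU (hF.pd hU _) _ _ hp, pd_cmul hU (hG.pd hU _) _ _ hp]

end Separable

section Concrete

variable {n : ℕ} {U : Set (EuclideanSpace ℝ (Fin n) × ℝ)} {i0 : Fin n}

/-- the weight -/
noncomputable def phh (i0 : Fin n) (α m e : ℝ) (p : EuclideanSpace ℝ (Fin n) × ℝ) : ℝ :=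
  1 * Mon i0 (α - m) m p + (-e) * Mon i0 α 0 p

/-- the shift -/
noncomputable def ghh (i0 : Fin n) (α m e : ℝ) (p : EuclideanSpace ℝ (Fin n) × ℝ) : ℝ :=
  (2 * (m - α)) * Mon i0 (α - m - 2) m p + (2 * α * e) * Mon i0 (α - 2) 0 p

/-- time factor -/
noncomputable def tf (a K : ℝ) (p : EuclideanSpace ℝ (Fin n) × ℝ) : ℝ := a * (tp (-K) p + (-1))

/-- gaussian spatial factor -/
noncomputable def gf (i0 : Fin n) (K : ℝ) (p : EuclideanSpace ℝ (Fin n) × ℝ) : ℝ :=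
  (-(1 / 16)) * Mon i0 2 0 p + (-(1 / 16) * K)

lemma Mon_sp (hU : IsOpen U) (h1 : ∀ p ∈ U, 0 < p.1 i0) (β γ : ℝ) : Sp U (Mon i0 β γ) :=
  ⟨Mon_sm h1 β γ, fun _ hp => pd_tt_Mon hU h1 β γ hp⟩

lemma tp_tm (hU : IsOpen U) (h2 : ∀ p ∈ U, 0 < p.2) (κ : ℝ) : Tm U (tp κ) :=
  ⟨tp_sm h2 κ, fun _ hp i => pd_bb_tp hU h2 κ i hp⟩

lemma phh_sp (hU : IsOpen U) (h1 : ∀ p ∈ U, 0 < p.1 i0) (α m e : ℝ) : Sp U (phh i0 α m e) :=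
  ((Mon_sp hU h1 _ _).cmul hU _).add hU ((Mon_sp hU h1 _ _).cmul hU _)

lemma ghh_sp (hU : IsOpen U) (h1 : ∀ p ∈ U, 0 < p.1 i0) (α m e : ℝ) : Sp U (ghh i0 α m e) :=
  ((Mon_sp hU h1 _ _).cmul hU _).add hU ((Mon_sp hU h1 _ _).cmul hU _)

lemma gf_sp (hU : IsOpen U) (h1 : ∀ p ∈ U, 0 < p.1 i0) (K : ℝ) : Sp U (gf i0 K) :=
  ((Mon_sp hU h1 _ _).cmul hU _).add hU (Sp.const _)

lemma tf_sm (h2 : ∀ p ∈ U, 0 < p.2) (a K : ℝ) : Sm U (tf a K) :=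
  (Sm.const a).mul ((tp_sm h2 (-K)).add (Sm.const (-1)))

lemma pd_tf (hU : IsOpen U) (h2 : ∀ p ∈ U, 0 < p.2) (a K : ℝ) (e) {p} (hp : p ∈ U) :
    pd e (tf a K) p = a * pd e (tp (-K)) p := by
  unfold tf
  rw [pd_cmul hU ((tp_sm h2 (-K)).add (Sm.const (-1))) _ _ hp,
    pd_add hU (tp_sm h2 (-K)) (Sm.const (-1)) _ hp, pd_const, add_zero]

lemma tf_tm (hU : IsOpen U) (h2 : ∀ p ∈ U, 0 < p.2) (a K : ℝ) : Tm U (tf a K) :=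
  ⟨tf_sm h2 a K, fun p hp i => by rw [pd_tf hU h2 _ _ _ hp, pd_bb_tp hU h2 _ _ hp, mul_zero]⟩

lemma pd_tt_tf (hU : IsOpen U) (h2 : ∀ p ∈ U, 0 < p.2) (a K : ℝ) {p} (hp : p ∈ U) :
    pd (tt n) (tf a K) p = a * (-K) * tp (-K - 1) p := by
  rw [pd_tf hU h2 _ _ _ hp, pd_tt_tp hU h2 _ hp]; ring

lemma pd_tt_tt_tf (hU : IsOpen U) (h2 : ∀ p ∈ U, 0 < p.2) (a K : ℝ) {p} (hp : p ∈ U) :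
    pd (tt n) (pd (tt n) (tf a K)) p = a * (-K) * ((-K - 1) * tp (-K - 1 - 1) p) := by
  rw [pd_congr hU (fun q hq => pd_tt_tf hU h2 a K hq) _ hp, pd_cmul hU (tp_sm h2 _) _ _ hp,
    pd_tt_tp hU h2 _ hp]

lemma pd_tt_tt_tp (hU : IsOpen U) (h2 : ∀ p ∈ U, 0 < p.2) (κ : ℝ) {p} (hp : p ∈ U) :
    pd (tt n) (pd (tt n) (tp κ)) p = κ * ((κ - 1) * tp (κ - 1 - 1) p) := by
  rw [pd_congr hU (fun q hq => pd_tt_tp hU h2 κ hq) _ hp, pd_cmul hU (tp_sm h2 _) _ _ hp,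
    pd_tt_tp hU h2 _ hp]

lemma pd_lin (hU : IsOpen U) {F G : EuclideanSpace ℝ (Fin n) × ℝ → ℝ} (hF : Sm U F) (hG : Sm U G)
    (c d : ℝ) (v) {p} (hp : p ∈ U) : pd v (fun p => c * F p + d * G p) p = c * pd v F p + d * pd v G p := by
  rw [pd_add hU ((Sm.const c).mul hF) ((Sm.const d).mul hG) _ hp, pd_cmul hU hF _ _ hp,
        pd_cmul hU hG _ _ hp]

lemma pd_phh (hU : IsOpen U) (h1 : ∀ p ∈ U, 0 < p.1 i0) (α m e : ℝ) (i : Fin n) {p} (hp : p ∈ U) :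
    pd (bb i) (phh i0 α m e) p = 1 * pd (bb i) (Mon i0 (α - m) m) p
      + (-e) * pd (bb i) (Mon i0 α 0) p :=
  pd_lin hU (Mon_sm h1 _ _) (Mon_sm h1 _ _) _ _ _ hp

lemma pd2_phh (hU : IsOpen U) (h1 : ∀ p ∈ U, 0 < p.1 i0) (α m e : ℝ) (i j : Fin n) {p} (hp : p ∈ U) :
    pd (bb i) (pd (bb j) (phh i0 α m e)) p = 1 * pd (bb i) (pd (bb j) (Mon i0 (α - m) m)) p
      + (-e) * pd (bb i) (pd (bb j) (Mon i0 α 0)) p := by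
  rw [pd_congr hU (fun q hq => pd_phh hU h1 α m e j hq) _ hp]
  exact pd_lin hU ((Mon_sm h1 _ _).pd hU _) ((Mon_sm h1 _ _).pd hU _) _ _ _ hp

lemma pd_gf (hU : IsOpen U) (h1 : ∀ p ∈ U, 0 < p.1 i0) (K : ℝ) (i : Fin n) {p} (hp : p ∈ U) :
    pd (bb i) (gf i0 K) p = (-(1 / 16)) * pd (bb i) (Mon i0 2 0) p := by
  unfold gf
  rw [pd_add hU ((Sm.const _).mul (Mon_sm h1 _ _)) (Sm.const _) _ hp, pd_const, add_zero,
    pd_cmul hU (Mon_sm h1 _ _) _ _ hp]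

lemma pd2_gf (hU : IsOpen U) (h1 : ∀ p ∈ U, 0 < p.1 i0) (K : ℝ) (i j : Fin n) {p} (hp : p ∈ U) :
    pd (bb i) (pd (bb j) (gf i0 K)) p = (-(1 / 16)) * pd (bb i) (pd (bb j) (Mon i0 2 0)) p := by
  rw [pd_congr hU (fun q hq => pd_gf hU h1 K j hq) _ hp]
  exact pd_cmul hU ((Mon_sm h1 _ _).pd hU _) _ _ hp

lemma Lap_Mon_sm (hU : IsOpen U) (h1 : ∀ p ∈ U, 0 < p.1 i0) (β γ : ℝ) : Sm U (Lap (Mon i0 β γ)) :=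
  Sm.sum (fun i => ((Mon_sm h1 β γ).pd hU (bb i)).pd hU (bb i))

lemma LapLap_Mon (hU : IsOpen U) (h1 : ∀ p ∈ U, 0 < p.1 i0) (β γ : ℝ) {p} (hp : p ∈ U) :
    Lap (Lap (Mon i0 β γ)) p = β * (n + β - 2 + 2 * γ) * Lap (Mon i0 (β - 2) γ) p
      + γ * (γ - 1) * Lap (Mon i0 β (γ - 1 - 1)) p := by
  rw [Lap_congr hU (fun q hq => Lap_Mon hU h1 β γ hq) hp,
    Lap_lin hU (Mon_sm h1 _ _) (Mon_sm h1 _ _) _ _ hp]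

lemma LapLap_phh (hU : IsOpen U) (h1 : ∀ p ∈ U, 0 < p.1 i0) (α m e : ℝ) {p} (hp : p ∈ U) :
    Lap (Lap (phh i0 α m e)) p = 1 * Lap (Lap (Mon i0 (α - m) m)) p
      + (-e) * Lap (Lap (Mon i0 α 0)) p := by
  have e' : ∀ q ∈ U, Lap (phh i0 α m e) q = 1 * Lap (Mon i0 (α - m) m) q
      + (-e) * Lap (Mon i0 α 0) q :=
    fun q hq => Lap_lin hU (Mon_sm h1 _ _) (Mon_sm h1 _ _) _ _ hq
  rw [Lap_congr hU e' hp, Lap_lin hU (Lap_Mon_sm hU h1 _ _) (Lap_Mon_sm hU h1 _ _) _ _ hp]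

lemma Lap_const (c : ℝ) (p : EuclideanSpace ℝ (Fin n) × ℝ) :
    Lap (fun _ => c) p = 0 := by
  unfold Lap
  refine Finset.sum_eq_zero (fun i _ => ?_)
  rw [pd_congr isOpen_univ (G := fun _ => 0) (fun q _ => pd_const c _ q) _ (mem_univ p), pd_const]

lemma LapLap_gf (hU : IsOpen U) (h1 : ∀ p ∈ U, 0 < p.1 i0) (K : ℝ) {p} (hp : p ∈ U) :
    Lap (Lap (gf i0 K)) p = 0 := by
  have e : ∀ q ∈ U, Lap (gf i0 K) q = (-(1/16)) * Lap (Mon i0 2 0) q + 0 * Lap (Mon i0 2 0) q := by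
    intro q hq
    rw [zero_mul, add_zero]
    unfold Lap
    rw [Finset.mul_sum]
    exact Finset.sum_congr rfl (fun i _ => pd2_gf hU h1 K i i hq)
  rw [Lap_congr hU e hp, Lap_lin hU (Lap_Mon_sm hU h1 _ _) (Lap_Mon_sm hU h1 _ _) _ _ hp,
    LapLap_Mon hU h1 _ _ hp, Lap_Mon hU h1 _ _ hp]
  norm_num

/-- bounded by a multiple of `‖x‖^κ` -/
def Bd (U : Set (EuclideanSpace ℝ (Fin n) × ℝ)) (κ : ℝ) (F : EuclideanSpace ℝ (Fin n) × ℝ → ℝ) : Prop :=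
  ∃ C, 0 ≤ C ∧ ∀ p ∈ U, |F p| ≤ C * ‖p.1‖ ^ κ

lemma Bd.lin {κ : ℝ} {F G : EuclideanSpace ℝ (Fin n) × ℝ → ℝ} (hF : Bd U κ F) (hG : Bd U κ G) (c d : ℝ) :
    Bd U κ (fun p => c * F p + d * G p) := by
  obtain ⟨C, hC, h⟩ := hF
  obtain ⟨D, hD, h'⟩ := hG
  refine ⟨|c| * C + |d| * D, by positivity, fun p hp => ?_⟩
  refine (abs_add_le _ _).trans ?_
  rw [abs_mul, abs_mul, add_mul, mul_assoc, mul_assoc]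
  exact add_le_add (mul_le_mul_of_nonneg_left (h p hp) (abs_nonneg _))
    (mul_le_mul_of_nonneg_left (h' p hp) (abs_nonneg _))

lemma Bd.congr {κ : ℝ} {F G : EuclideanSpace ℝ (Fin n) × ℝ → ℝ} (hF : Bd U κ F)
    (h : ∀ p ∈ U, G p = F p) : Bd U κ G := by
  obtain ⟨C, hC, h1⟩ := hF
  exact ⟨C, hC, fun p hp => by rw [h p hp]; exact h1 p hp⟩

lemma crd_le (p : EuclideanSpace ℝ (Fin n) × ℝ) (i : Fin n) : p.1 i ≤ ‖p.1‖ :=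
  (le_abs_self _).trans (PiLp.norm_apply_le p.1 i)

lemma Mon_eq {p : EuclideanSpace ℝ (Fin n) × ℝ} (h : 0 < p.1 i0) (β γ : ℝ) :
    Mon i0 β γ p = ‖p.1‖ ^ (β + γ) * (p.1 i0 / ‖p.1‖) ^ γ := by
  have hr := norm_pos_of h
  unfold Mon
  rw [Real.div_rpow h.le hr.le, Real.rpow_add hr]
  have := (Real.rpow_pos_of_pos hr γ).ne'
  field_simp

lemma Mon_bd {ε : ℝ} (hε : 0 < ε) (h1 : ∀ p ∈ U, 1 < p.1 i0) (h3 : ∀ p ∈ U, ‖p.1‖ * ε < p.1 i0)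
    (κ β γ : ℝ) (h : β + γ ≤ κ) : Bd U κ (Mon i0 β γ) := by
  refine ⟨1 + ε ^ γ, by positivity, fun p hp => ?_⟩
  have h0 : 0 < p.1 i0 := by linarith [h1 p hp]
  have hr := norm_pos_of h0
  have hr1 : 1 ≤ ‖p.1‖ := (h1 p hp).le.trans (crd_le p i0)
  have hs0 : 0 < p.1 i0 / ‖p.1‖ := by positivity
  have hs1 : p.1 i0 / ‖p.1‖ ≤ 1 := by rw [div_le_one hr]; exact crd_le p i0
  have hs2 : ε ≤ p.1 i0 / ‖p.1‖ := by rw [le_div_iff₀ hr, mul_comm]; exact (h3 p hp).le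
  rw [Mon_eq h0, abs_of_nonneg (by positivity), mul_comm]
  refine mul_le_mul ?_ (Real.rpow_le_rpow_of_exponent_le hr1 h) (by positivity) (by positivity)
  rcases le_total 0 γ with hγ | hγ
  · have := Real.rpow_le_one hs0.le hs1 hγ
    have := Real.rpow_nonneg hε.le γ
    linarith
  · have := Real.rpow_le_rpow_of_nonpos hε hs2 hγ
    linarith

lemma Lap_Mon_bd (hU : IsOpen U) {ε : ℝ} (hε : 0 < ε) (h1 : ∀ p ∈ U, 1 < p.1 i0)
    (h3 : ∀ p ∈ U, ‖p.1‖ * ε < p.1 i0)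
    (κ β γ : ℝ) (h : β + γ ≤ κ + 2) : Bd U κ (Lap (Mon i0 β γ)) := by
  have h1' : ∀ p ∈ U, 0 < p.1 i0 := fun p hp => by linarith [h1 p hp]
  exact ((Mon_bd hε h1 h3 κ (β - 2) γ (by linarith)).lin
    (Mon_bd hε h1 h3 κ β (γ - 1 - 1) (by linarith)) _ _).congr (fun p hp => Lap_Mon hU h1' β γ hp)

lemma LapLap_Mon_bd (hU : IsOpen U) {ε : ℝ} (hε : 0 < ε) (h1 : ∀ p ∈ U, 1 < p.1 i0)
    (h3 : ∀ p ∈ U, ‖p.1‖ * ε < p.1 i0)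
    (κ β γ : ℝ) (h : β + γ ≤ κ + 4) : Bd U κ (Lap (Lap (Mon i0 β γ))) := by
  have h1' : ∀ p ∈ U, 0 < p.1 i0 := fun p hp => by linarith [h1 p hp]
  exact ((Lap_Mon_bd hU hε h1 h3 κ (β - 2) γ (by linarith)).lin
    (Lap_Mon_bd hU hε h1 h3 κ β (γ - 1 - 1) (by linarith)) _ _).congr (fun p hp => LapLap_Mon hU h1' β γ hp)

lemma L_bd (hU : IsOpen U) {ε : ℝ} (hε : 0 < ε) (h1 : ∀ p ∈ U, 1 < p.1 i0)
    (h3 : ∀ p ∈ U, ‖p.1‖ * ε < p.1 i0) (α m e : ℝ) :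
    ∃ C, 0 ≤ C ∧ ∀ p ∈ U, Lap (Lap (phh i0 α m e)) p + Lap (ghh i0 α m e) p ≤ C * ‖p.1‖ ^ (α - 2) := by
  have h1' : ∀ p ∈ U, 0 < p.1 i0 := fun p hp => by linarith [h1 p hp]
  have b1 : Bd U (α - 2) (Lap (Lap (phh i0 α m e))) :=
    ((LapLap_Mon_bd hU hε h1 h3 (α - 2) (α - m) m (by linarith)).lin
      (LapLap_Mon_bd hU hε h1 h3 (α - 2) α 0 (by linarith)) _ _).congr
      (fun p hp => LapLap_phh hU h1' α m e hp)
  have b2 : Bd U (α - 2) (Lap (ghh i0 α m e)) :=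
    ((Lap_Mon_bd hU hε h1 h3 (α - 2) (α - m - 2) m (by linarith)).lin
      (Lap_Mon_bd hU hε h1 h3 (α - 2) (α - 2) 0 (by linarith)) _ _).congr
      (fun p hp => Lap_lin hU (Mon_sm h1' _ _) (Mon_sm h1' _ _) _ _ hp)
  obtain ⟨C, hC, h⟩ := b1.lin b2 1 1
  refine ⟨C, hC, fun p hp => ?_⟩
  have := (le_abs_self _).trans (h p hp)
  linarith

end Concrete

section Geometry

variable {n : ℕ}

lemma quad_hm (y w : Fin n → ℝ) (i0 : Fin n) (p A B C : ℝ) :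
    ∑ i, ∑ j, (-p * kd i j + A * (y i * y j) + B * (y i * kd j i0 + y j * kd i i0)
      + C * (kd i i0 * kd j i0)) * w i * w j
    = -p * ∑ i, w i ^ 2 + A * (∑ i, w i * y i) ^ 2 + 2 * B * (∑ i, w i * y i) * w i0
      + C * w i0 ^ 2 := by
  have k1 : ∑ i, kd i i0 * w i = w i0 := by simp [kd]
  have k2 := sum_kd w w
  have e1 : ∑ i, w i ^ 2 = ∑ i, w i * w i := Finset.sum_congr rfl (fun i _ => by ring)
  have e2 : ∑ i, ∑ j, (-p * kd i j + A * (y i * y j) + B * (y i * kd j i0 + y j * kd i i0)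
      + C * (kd i i0 * kd j i0)) * w i * w j
      = -p * ∑ i, ∑ j, kd i j * w i * w j + A * ∑ i, ∑ j, (w i * y i) * (w j * y j)
        + B * ∑ i, ∑ j, (w i * y i) * (kd j i0 * w j) + B * ∑ i, ∑ j, (kd i i0 * w i) * (w j * y j)
        + C * ∑ i, ∑ j, (kd i i0 * w i) * (kd j i0 * w j) := by
    simp only [Finset.mul_sum, ← Finset.sum_add_distrib]
    exact Finset.sum_congr rfl (fun i _ => Finset.sum_congr rfl (fun j _ => by ring))
  rw [e2, k2, e1]
  simp only [← Finset.sum_mul_sum, k1]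
  ring

lemma psd_form (m α z e A B C s ie X W p : ℝ) (hm : m = 123/50) (hα : α = 1999/1000) (hz : 0 ≤ z) (he : 0 ≤ e)
    (hs : s * ie = 1)
    (hA : A = (m - α) * (m + 2 - α) * z + e * α * (2 - α)) (hB : B = -((m - α) * m * z * ie))
    (hC : C = m * (m - 1) * z * ie ^ 2) (S : ℝ) :
    -p * S ≤ -p * S + A * X ^ 2 + 2 * B * X * W + C * W ^ 2 := by
  have h1 : 0 ≤ (m - α) * (m + 2 - α) * X ^ 2 - 2 * (m - α) * m * X * (ie * W) + m * (m - 1) * (ie * W) ^ 2 := by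
    subst hm hα
    nlinarith [sq_nonneg (X - ie * W), sq_nonneg X, sq_nonneg (ie * W)]
  have h2 : 0 ≤ e * α * (2 - α) * X ^ 2 := by
    have : 0 ≤ e * α * (2 - α) := by subst hα; linarith
    positivity
  have h3 := mul_nonneg hz h1
  have h4 : A * X ^ 2 + 2 * B * X * W + C * W ^ 2 = z * ((m - α) * (m + 2 - α) * X ^ 2
    - 2 * (m - α) * m * X * (ie * W) + m * (m - 1) * (ie * W) ^ 2) + e * α * (2 - α) * X ^ 2 := by
    rw [hA, hB, hC]; ring
  linarith only [h2, h3, h4]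

set_option maxHeartbeats 1000000 in
lemma pt_alg (y : Fin n → ℝ) (i0 : Fin n) (hy : ∑ i, y i ^ 2 = 1)
    (ε s m α e z ie p A B C d : ℝ) (hmv : m = 123/50) (hαv : α = 1999/1000)
    (hε0 : 0 < ε) (hε1 : ε < Real.sqrt (73/173)) (hεs : ε < s) (hs1 : s ≤ 1)
    (hys : y i0 = s) (hev : e = ε ^ m) (hz : z = s ^ m) (hie : s * ie = 1)
    (hp : p = (m - α) * z + α * e)
    (hA : A = (m - α) * (m + 2 - α) * z + e * α * (2 - α)) (hB : B = -((m - α) * m * z * ie))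
    (hC : C = m * (m - 1) * z * ie ^ 2) (hd : d = m * z * ie)
    (a ρ r σ T K L CL : ℝ)
    (ha : 0 < a) (hρ : 0 < ρ) (hr : 1 ≤ r) (hσ : 1 ≤ σ) (hT : 1 ≤ T)
    (hCL : 0 ≤ CL) (hL : L ≤ CL * ρ)
    (hK : 64 ≤ K) (hK1 : 10 * (2 * m ^ 2) + 4 * m ^ 2 ≤ 4 * K * (e ^ 2 / 100))
    (hK2 : 4 * (8 * m + CL) ≤ K * (α * e))
    (P1 Pt1 : Fin n → ℝ) (P2 : Fin n → Fin n → ℝ) (Pt Ptt h N : ℝ)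
    (hP1 : ∀ i, P1 i = a * (T - 1) * ρ * r * (-p * y i + d * kd i i0) - r * σ / 8 * y i)
    (hP2 : ∀ i j, P2 i j = a * (T - 1) * ρ * (-p * kd i j + A * (y i * y j)
      + B * (y i * kd j i0 + y j * kd i i0) + C * (kd i i0 * kd j i0)) - σ / 8 * kd i j)
    (hPt1 : ∀ i, Pt1 i = -(a * K * T * σ * ρ * r) * (-p * y i + d * kd i i0) + r * σ ^ 2 / 8 * y i)
    (hPt : Pt = -(a * K * T * σ) * (ρ * r ^ 2 * (z - e)) + (r ^ 2 + K) * σ ^ 2 / 16)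
    (hPtt : Ptt = a * (K * (K + 1) * T * σ ^ 2) * (ρ * r ^ 2 * (z - e)) - (r ^ 2 + K) * σ ^ 3 / 8)
    (hh : h = 2 * (a * (T - 1) * ρ) * p + 2 * σ)
    (hN : N = Ptt - 4 * ∑ i, P1 i * Pt1 i + 4 * ∑ i, ∑ j, P2 i j * P1 i * P1 j
      - a * (T - 1) * L - 2 * h * (∑ i, P1 i ^ 2 - Pt) - h ^ 2)
    (w : Fin n → ℝ) (v : ℝ) :
    v ^ 2 + ∑ i, (w i - P1 i * v) ^ 2 ≤
      4 * ∑ i, ∑ j, P2 i j * w i * w j + 2 * h * ∑ i, w i ^ 2 + N * v ^ 2 := by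
  have hs0 : 0 < s := hε0.trans hεs
  have hiev : ie = 1 / s := by rw [eq_div_iff hs0.ne']; linarith
  have hz0 : 0 < z := by rw [hz]; positivity
  have he0 : 0 < e := by rw [hev]; positivity
  have hm0 : 0 < m := by rw [hmv]; norm_num
  have hez : e ≤ z := by rw [hev, hz]; exact Real.rpow_le_rpow hε0.le hεs.le hm0.le
  have hz1 : z ≤ 1 := by rw [hz]; exact Real.rpow_le_one hs0.le hs1 hm0.le
  have hzs : z ≤ s := by
    rw [hz]
    calc s ^ m ≤ s ^ (1:ℝ) :=
          Real.rpow_le_rpow_of_exponent_ge hs0 hs1 (by rw [hmv]; norm_num)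
      _ = s := Real.rpow_one s
  have hzi : z * ie ≤ 1 := by rw [hiev, mul_one_div, div_le_one hs0]; exact hzs
  have hie0 : 0 < ie := by rw [hiev]; positivity
  obtain ⟨q, hq⟩ : ∃ q, q = 1 - (ε / s) ^ m := ⟨_, rfl⟩
  obtain ⟨τ, hτ⟩ : ∃ τ, τ = 1 / s ^ 2 - 1 := ⟨_, rfl⟩
  have hτ' : ie ^ 2 = 1 + τ := by rw [hτ, hiev]; ring
  have hzq : e = z * (1 - q) := by
    rw [hq, hev, hz, Real.div_rpow hε0.le hs0.le]
    have := (Real.rpow_pos_of_pos hs0 m).ne'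
    field_simp
    ring
  obtain ⟨n1, n2, n3, n4, n5⟩ := num_main ε s hε0 hε1 hεs hs1 q τ (by rw [hq, hmv]) hτ
  rw [← hmv, ← hαv] at n1 n2
  have kk : ∑ i, kd i i0 * y i = s := by rw [← hys]; simp [kd]
  have kk2 : ∑ i, kd i i0 * kd i i0 = 1 := by simp [kd]
  have ki : kd i0 i0 = 1 := by simp [kd]
  have hy' : ∑ i, y i * y i = 1 := by rw [← hy]; exact Finset.sum_congr rfl (fun i _ => by ring)
  have hds : d * s = m * z := by rw [hd]; linear_combination m * z * hie
  have hgy : ∑ i, (-p * y i + d * kd i i0) * y i = α * (z - e) := by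
    calc _ = -p * ∑ i, y i * y i + d * ∑ i, kd i i0 * y i := by
          simp only [Finset.mul_sum, ← Finset.sum_add_distrib]
          exact Finset.sum_congr rfl (fun i _ => by ring)
      _ = _ := by rw [hy', kk, hp, hds]; ring
  have hgg : ∑ i, (-p * y i + d * kd i i0) ^ 2 = z ^ 2 * (α ^ 2 * q ^ 2 + m ^ 2 * τ) := by
    calc _ = p ^ 2 * ∑ i, y i * y i - 2 * p * d * ∑ i, kd i i0 * y i
          + d ^ 2 * ∑ i, kd i i0 * kd i i0 := by
          simp only [Finset.mul_sum, ← Finset.sum_add_distrib, ← Finset.sum_sub_distrib]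
          exact Finset.sum_congr rfl (fun i _ => by ring)
      _ = _ := by
          rw [hy', kk, kk2, mul_assoc (2 * p), hds, hd, hp, hzq]
          linear_combination m ^ 2 * z ^ 2 * hτ'
  have hE : ∀ i, ∑ j, (-p * kd i j + A * (y i * y j) + B * (y i * kd j i0 + y j * kd i i0)
      + C * (kd i i0 * kd j i0)) * y j = (α - 1) * (-p * y i + d * kd i i0) := by
    intro i
    have k3 : ∑ j, kd i j * y j = y i := by simp [kd]
    calc _ = -p * ∑ j, kd i j * y j + A * y i * ∑ j, y j * y j
          + B * y i * ∑ j, kd j i0 * y j + B * kd i i0 * ∑ j, y j * y j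
          + C * kd i i0 * ∑ j, kd j i0 * y j := by
          simp only [Finset.mul_sum, ← Finset.sum_add_distrib]
          exact Finset.sum_congr rfl (fun i _ => by ring)
      _ = _ := by
          rw [k3, hy', kk, hA, hB, hC, hd, hp]
          linear_combination (-(m - α) * m * z * y i + m * (m - 1) * z * ie * kd i i0) * hie
  have hJ : ie * (-p * s + d) = z * (α * q + m * τ) := by
    rw [hd, hp, hzq]
    linear_combination (-((m - α) * z + α * (z * (1 - q)))) * hie + m * z * hτ'
  have hΘ' := quad_hm y (fun i => -p * y i + d * kd i i0) i0 p A B C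
  rw [hgy, hgg, hys, ki, mul_one] at hΘ'
  have hΘ : p * (z ^ 2 * (α ^ 2 * q ^ 2 + m ^ 2 * τ)) ≤ -p * (z ^ 2 * (α ^ 2 * q ^ 2 + m ^ 2 * τ))
      + A * (α * (z - e)) ^ 2 + 2 * B * (α * (z - e)) * (-p * s + d) + C * (-p * s + d) ^ 2 := by
    have h3 := mul_nonneg (by positivity : 0 ≤ z ^ 3) n1
    rw [← sub_nonneg]
    refine le_of_le_of_eq h3 ?_
    have e1 : B * (-p * s + d) = -((m - α) * m * z) * (z * (α * q + m * τ)) := by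
      rw [hB, ← hJ]; ring
    have e2 : C * (-p * s + d) ^ 2 = m * (m - 1) * z * (z * (α * q + m * τ)) ^ 2 := by
      rw [hC, ← hJ]; ring
    rw [e2, show 2 * B * (α * (z - e)) * (-p * s + d) = 2 * (α * (z - e)) * (B * (-p * s + d)) by ring,
      e1, hA, hp, hzq]
    ring
  have hqz : z - e = z * q := by rw [hzq]; ring
  have hα0 : 0 < α := by rw [hαv]; norm_num
  have hαm : 0 < m - α := by rw [hmv, hαv]; norm_num
  have hp0 : α * e ≤ p := by rw [hp]; linarith only [mul_pos hαm hz0]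
  have hpz : p = m * z - α * (z - e) := by rw [hp]; ring
  have hpM : p ≤ m := by
    rw [hpz]
    have h1 := mul_nonneg hα0.le (sub_nonneg.2 hez)
    have h2 := mul_le_mul_of_nonneg_left hz1 hm0.le
    linarith only [h1, h2]
  have hpp : 0 ≤ p := (mul_pos hα0 he0).le.trans hp0
  refine final_alg y (fun i => -p * y i + d * kd i i0)
    (fun i j => -p * kd i j + A * (y i * y j) + B * (y i * kd j i0 + y j * kd i i0)
      + C * (kd i i0 * kd j i0)) a ρ r σ T K (z - e) p _ _ L α (α * e) m (2 * m ^ 2) (e ^ 2 / 100) CL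
    hy hgy hgg hE ?_ hΘ' ?_ ha hρ hr hσ hT (sub_nonneg.2 hez) (mul_pos hα0 he0) hp0 hpM ?_
    (by positivity) ?_ hΘ hCL hL (by rw [hαv]; norm_num) (by rw [hαv]; norm_num) hK hK1 hK2 P1 Pt1 P2
    Pt Ptt h N hP1 hP2 hPt1 hPt hPtt hh hN w v
  · intro i j
    have : kd i j = kd j i := by simp [kd, eq_comm]
    rw [this]; ring
  · intro w
    rw [quad_hm]
    exact psd_form m α z e A B C s ie _ _ p hmv hαv hz0.le he0.le hie hA hB hC _
  · have e1 : z ^ 2 * (α ^ 2 * q ^ 2 + m ^ 2 * τ) = p ^ 2 - 2 * (p * (m * z)) + m ^ 2 * (z * ie) ^ 2 := by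
      rw [hp, hzq]; linear_combination (-(m ^ 2 * z ^ 2)) * hτ'
    rw [e1]
    have e2 : p ^ 2 ≤ m ^ 2 := pow_le_pow_left₀ hpp hpM 2
    have e3 : 0 ≤ p * (m * z) := by positivity
    have e4 : (z * ie) ^ 2 ≤ 1 := pow_le_one₀ (by positivity) hzi
    have e5 := mul_le_mul_of_nonneg_left e4 (sq_nonneg m)
    linarith only [e2, e3, e5]
  · have e1 : z ^ 2 * (α ^ 2 * q ^ 2 + m ^ 2 * τ) - p * (z - e) =
        z ^ 2 * ((α ^ 2 + α) * q ^ 2 - m * q + m ^ 2 * τ) := by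
      rw [hpz, hqz]; ring
    rw [e1]
    have e2 : e ^ 2 ≤ z ^ 2 := pow_le_pow_left₀ he0.le hez 2
    have e3 := mul_le_mul_of_nonneg_left n2 (sq_nonneg z)
    linarith only [e2, e3]

end Geometry

section Point

variable {n : ℕ} {U : Set (EuclideanSpace ℝ (Fin n) × ℝ)} {i0 : Fin n}

lemma tp_vals {p : EuclideanSpace ℝ (Fin n) × ℝ} (h : 0 < p.2) (κ : ℝ) :
    tp (κ - 1) p = tp κ p * p.2⁻¹ := by
  unfold tp
  rw [Real.rpow_sub_one h.ne', div_eq_mul_inv]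

set_option maxHeartbeats 1000000 in
lemma point_ineq (hU : IsOpen U) (h1 : ∀ p ∈ U, 1 < p.1 i0) {ε : ℝ} (hε0 : 0 < ε)
    (hε1 : ε < Real.sqrt (73/173))
    (h3 : ∀ p ∈ U, ‖p.1‖ * ε < p.1 i0) (h2 : ∀ p ∈ U, 0 < p.2 ∧ p.2 < 1)
    (m α e : ℝ) (hmv : m = 123/50) (hαv : α = 1999/1000) (hev : e = ε ^ m)
    (a K CL : ℝ) (ha : 0 < a) (hCL : 0 ≤ CL)
    (hL : ∀ p ∈ U, Lap (Lap (phh i0 α m e)) p + Lap (ghh i0 α m e) p ≤ CL * ‖p.1‖ ^ (α - 2))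
    (hK : 64 ≤ K) (hK1 : 10 * (2 * m ^ 2) + 4 * m ^ 2 ≤ 4 * K * (e ^ 2 / 100))
    (hK2 : 4 * (8 * m + CL) ≤ K * (α * e)) (p) (hp : p ∈ U) (w : Fin n → ℝ) (v : ℝ) :
    v ^ 2 + ∑ i, (w i - pd (bb i) (sep (phh i0 α m e) (tf a K) (gf i0 K) (tp (-1))) p * v) ^ 2 ≤
        4 * ∑ i, ∑ j, pd (bb i) (pd (bb j)
          (sep (phh i0 α m e) (tf a K) (gf i0 K) (tp (-1)))) p * w i * w j
        + 2 * sep (ghh i0 α m e) (tf a K) (fun _ => 2) (tp (-1)) p * ∑ i, w i ^ 2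
        + Ncoef bb (tt n) (sep (phh i0 α m e) (tf a K) (gf i0 K) (tp (-1)))
          (sep (ghh i0 α m e) (tf a K) (fun _ => 2) (tp (-1))) p * v ^ 2 := by
  have h1' : ∀ p ∈ U, 0 < p.1 i0 := fun p hp => by linarith [h1 p hp]
  have h2' : ∀ p ∈ U, 0 < p.2 := fun p hp => (h2 p hp).1
  have s1 := phh_sp hU h1' α m e
  have s2 := gf_sp hU h1' K
  have s3 := ghh_sp hU h1' α m e
  have s4 : Sp U (fun _ => (2:ℝ)) := Sp.const 2
  have k1 := tf_tm hU h2' a K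
  have k2 := tp_tm hU h2' (-1)
  have hx0 := h1' p hp
  have hr := norm_pos_of hx0
  have ht := h2' p hp
  obtain ⟨r, hrv⟩ : ∃ r, r = ‖p.1‖ := ⟨_, rfl⟩
  obtain ⟨s, hsv⟩ : ∃ s, s = p.1 i0 / ‖p.1‖ := ⟨_, rfl⟩
  obtain ⟨σ, hσv⟩ : ∃ σ, σ = p.2⁻¹ := ⟨_, rfl⟩
  obtain ⟨ρ, hρv⟩ : ∃ ρ, ρ = ‖p.1‖ ^ (α - 2) := ⟨_, rfl⟩
  obtain ⟨z, hz⟩ : ∃ z, z = s ^ m := ⟨_, rfl⟩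
  obtain ⟨T, hTv⟩ : ∃ T, T = tp (-K) p := ⟨_, rfl⟩
  obtain ⟨y, hyv⟩ : ∃ y : Fin n → ℝ, ∀ i, y i = p.1 i / ‖p.1‖ := ⟨_, fun _ => rfl⟩
  have hs0 : 0 < s := by rw [hsv]; positivity
  have hr0 : 0 < r := by rw [hrv]; exact hr
  have hcrd : ∀ i, crd i p = r * y i := fun i => by
    rw [hyv, hrv]; unfold crd; field_simp
  have Me : ∀ β γ, Mon i0 β γ p = r ^ (β + γ) * s ^ γ := fun β γ => by
    rw [Mon_eq hx0, hrv, hsv]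
  have hρr : ρ = r ^ (α - 2) := by rw [hρv, hrv]
  have r2 : r ^ α = ρ * r ^ 2 := by
    rw [hρr, ← Real.rpow_natCast, ← Real.rpow_add hr0]; congr 1; push_cast; ring
  have r1 : r ^ (α - 1) = ρ * r := by
    rw [hρr]; nth_rewrite 3 [← Real.rpow_one r]; rw [← Real.rpow_add hr0]; congr 1; ring
  have r3 : r ^ (α - 3) = ρ * r⁻¹ := by
    rw [hρr, ← Real.rpow_neg_one, ← Real.rpow_add hr0]; congr 1; ring
  have r4 : r ^ (α - 4) = ρ * r⁻¹ * r⁻¹ := by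
    rw [hρr, ← Real.rpow_neg_one, ← Real.rpow_add hr0, ← Real.rpow_add hr0]; congr 1; ring
  have z1 : s ^ (m - 1) = z * s⁻¹ := by
    rw [Real.rpow_sub_one hs0.ne', hz, div_eq_mul_inv]
  have z2 : s ^ (m - 1 - 1) = z * s⁻¹ * s⁻¹ := by
    rw [Real.rpow_sub_one hs0.ne', z1, div_eq_mul_inv]
  have M1 : Mon i0 (α - m) m p = ρ * r ^ 2 * z := by
    rw [Me, ← hz, ← r2]; congr 2; ring
  have M2 : Mon i0 α 0 p = ρ * r ^ 2 := by
    rw [Me, Real.rpow_zero, add_zero, r2, mul_one]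
  have M3 : Mon i0 (α - m - 2) m p = ρ * z := by
    rw [Me, ← hz, hρr]; congr 2; ring
  have M4 : Mon i0 (α - 2) 0 p = ρ := by
    rw [Me, Real.rpow_zero, add_zero, ← hρr, mul_one]
  have M5 : Mon i0 (α - m) (m - 1) p = ρ * r * (z * s⁻¹) := by
    rw [Me, z1, ← r1]; congr 2; ring
  have M6 : Mon i0 (α - m - 2 - 2) m p = ρ * r⁻¹ * r⁻¹ * z := by
    rw [Me, ← hz, ← r4]; congr 2; ring
  have M7 : Mon i0 (α - m - 2) (m - 1) p = ρ * r⁻¹ * (z * s⁻¹) := by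
    rw [Me, z1, ← r3]; congr 2; ring
  have M8 : Mon i0 (α - m) (m - 1 - 1) p = ρ * (z * s⁻¹ * s⁻¹) := by
    rw [Me, z2, hρr]; congr 2; ring
  have M9 : Mon i0 (α - 2 - 2) 0 p = ρ * r⁻¹ * r⁻¹ := by
    rw [Me, Real.rpow_zero, add_zero, ← r4, mul_one]; congr 1; ring
  have M10 : Mon i0 2 0 p = r ^ 2 := by
    rw [Me, Real.rpow_zero, add_zero, mul_one]; norm_cast
  have M11 : Mon i0 (2 - 2) 0 p = 1 := by
    rw [Me]; norm_num
  have t1 : tp (-1) p = σ := by unfold tp; rw [Real.rpow_neg_one, hσv]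
  have t2 : tp (-1 - 1) p = σ ^ 2 := by rw [tp_vals ht, t1, ← hσv]; ring
  have t3 : tp (-1 - 1 - 1) p = σ ^ 3 := by rw [tp_vals ht, t2, ← hσv]; ring
  have T1 : tp (-K - 1) p = T * σ := by rw [tp_vals ht, ← hTv, ← hσv]
  have T2 : tp (-K - 1 - 1) p = T * σ ^ 2 := by rw [tp_vals ht, T1, ← hσv]; ring
  have tfv : tf a K p = a * (T - 1) := by unfold tf; rw [← hTv]; ring
  have g1 : ∀ i, pd (bb i) (phh i0 α m e) p = ρ * r * (-((m - α) * z + α * e) * y i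
      + (m * z * s⁻¹) * kd i i0) := by
    intro i
    rw [pd_phh hU h1' _ _ _ _ hp, pd_bb_Mon hU h1' _ _ _ hp, pd_bb_Mon hU h1' _ _ _ hp, hcrd,
      M3, M4, M5]
    ring
  have g2 : ∀ i j, pd (bb i) (pd (bb j) (phh i0 α m e)) p = ρ * (-((m - α) * z + α * e) * kd i j
      + ((m - α) * (m + 2 - α) * z + e * α * (2 - α)) * (y i * y j)
      + (-((m - α) * m * z * s⁻¹)) * (y i * kd j i0 + y j * kd i i0)
      + (m * (m - 1) * z * s⁻¹ ^ 2) * (kd i i0 * kd j i0)) := by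
    intro i j
    rw [pd2_phh hU h1' _ _ _ _ _ hp, pd_bb_bb_Mon hU h1' _ _ _ _ hp, pd_bb_bb_Mon hU h1' _ _ _ _ hp,
      hcrd, hcrd, M3, M6, M7, M8, M4, M9]
    have : r * r⁻¹ = 1 := mul_inv_cancel₀ hr0.ne'
    have hrr : ∀ x : ℝ, r * (r⁻¹ * x) = x := fun x => by rw [← mul_assoc, this, one_mul]
    field_simp
    ring
  have f1 : ∀ i, pd (bb i) (gf i0 K) p = -(1/8) * (r * y i) := by
    intro i
    rw [pd_gf hU h1' _ _ hp, pd_bb_Mon hU h1' _ _ _ hp, hcrd, M11]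
    ring
  have f2 : ∀ i j, pd (bb i) (pd (bb j) (gf i0 K)) p = -(1/8) * kd i j := by
    intro i j
    rw [pd2_gf hU h1' _ _ _ hp, pd_bb_bb_Mon hU h1' _ _ _ _ hp, M11]
    ring
  have hr1 : 1 ≤ r := by rw [hrv]; exact (h1 p hp).le.trans (crd_le p i0)
  have hσ1 : 1 ≤ σ := by rw [hσv]; exact (one_le_inv₀ ht).2 (h2 p hp).2.le
  refine pt_alg y i0 ?_ ε s m α e z s⁻¹ _ _ _ _ _ hmv hαv hε0 hε1 ?_ ?_ ?_ hev hz
    (mul_inv_cancel₀ hs0.ne') rfl rfl rfl rfl rfl a ρ r σ T K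
    (Lap (Lap (phh i0 α m e)) p + Lap (ghh i0 α m e) p) CL ha ?_ hr1 hσ1 ?_ hCL ?_ hK hK1 hK2
    (fun i => pd (bb i) (sep (phh i0 α m e) (tf a K) (gf i0 K) (tp (-1))) p)
    (fun i => pd (tt n) (pd (bb i) (sep (phh i0 α m e) (tf a K) (gf i0 K) (tp (-1)))) p)
    (fun i j => pd (bb i) (pd (bb j) (sep (phh i0 α m e) (tf a K) (gf i0 K) (tp (-1)))) p)
    (pd (tt n) (sep (phh i0 α m e) (tf a K) (gf i0 K) (tp (-1))) p)
    (pd (tt n) (pd (tt n) (sep (phh i0 α m e) (tf a K) (gf i0 K) (tp (-1)))) p)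
    (sep (ghh i0 α m e) (tf a K) (fun _ => 2) (tp (-1)) p) _ ?_ ?_ ?_ ?_ ?_ ?_ ?_ w v
  · have := sum_crd_sq p
    simp only [hcrd] at this
    rw [← hrv] at this
    have h5 : r ^ 2 * ∑ i, y i ^ 2 = r ^ 2 * 1 := by
      rw [mul_one, ← this, Finset.mul_sum]
      rw [this]
      conv_rhs => rw [← this]
      exact Finset.sum_congr rfl (fun i _ => by ring)
    exact mul_left_cancel₀ (by positivity) h5
  · rw [hsv, lt_div_iff₀ hr, mul_comm]; exact h3 p hp
  · rw [hsv, div_le_one hr]; exact crd_le p i0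
  · rw [hyv, hsv]
  · rw [hρr]; positivity
  · rw [hTv]; unfold tp
    exact Real.one_le_rpow_of_pos_of_le_one_of_nonpos ht (h2 p hp).2.le (by linarith)
  · rw [hρv]; exact hL p hp
  · intro i
    rw [sep_bb hU s1 k1 s2 k2 i hp]
    unfold sep
    rw [g1, f1, tfv, t1]; ring
  · intro i j
    rw [sep_bb2 hU s1 k1 s2 k2 i j hp]
    unfold sep
    rw [g2, f2, tfv, t1]; ring
  · intro i
    rw [sep_tt_bb hU s1 k1 s2 k2 i hp]
    unfold sep
    rw [g1, f1, pd_tt_tf hU h2' _ _ hp, pd_tt_tp hU h2' _ hp, T1, t2]; ring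
  · rw [sep_tt hU s1 k1 s2 k2 hp]
    unfold sep
    rw [pd_tt_tf hU h2' _ _ hp, pd_tt_tp hU h2' _ hp, T1, t2]
    unfold phh gf
    rw [M1, M2, M10]; ring
  · rw [sep_tt2 hU s1 k1 s2 k2 hp]
    unfold sep
    rw [pd_tt_tt_tf hU h2' _ _ hp, pd_tt_tt_tp hU h2' _ hp, T2, t3]
    unfold phh gf
    rw [M1, M2, M10]; ring
  · unfold sep ghh
    rw [M3, M4, tfv, t1]; ring
  · unfold Ncoef
    rw [sep_LapLap hU s1 k1 s2 k2 hp, sep_Lap hU s3 k1 s4 k2 hp, LapLap_gf hU h1' _ hp, Lap_const, tfv]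
    ring

end Point

section Assembly

variable {n : ℕ}

lemma grad_eq (u : EuclideanSpace ℝ (Fin n) × ℝ → ℝ) (hu : ContDiff ℝ ∞ u)
    (p : EuclideanSpace ℝ (Fin n) × ℝ) :
    ‖gradient (fun y => u (y, p.2)) p.1‖ ^ 2 = ∑ i, pd (bb i) u p ^ 2 := by
  have hd : HasFDerivAt (fun y => u (y, p.2))
      ((fderiv ℝ u p).comp (ContinuousLinearMap.inl ℝ _ ℝ)) p.1 := by
    have h1 : HasFDerivAt u (fderiv ℝ u p) (p.1, p.2) :=
      (hu.differentiable (by simp) p).hasFDerivAt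
    exact h1.comp p.1 (hasFDerivAt_prodMk_left p.1 p.2)
  rw [EuclideanSpace.norm_sq_eq]
  refine Finset.sum_congr rfl (fun i _ => ?_)
  rw [Real.norm_eq_abs, sq_abs]
  congr 1
  have e1 : ∀ v : EuclideanSpace ℝ (Fin n), v i = inner ℝ v (EuclideanSpace.single i 1) := by
    intro v
    simp [EuclideanSpace.inner_single_right]
  rw [e1, inner_gradient_left, hd.fderiv]
  simp [pd, bb]

lemma deriv_eq_pd (u : EuclideanSpace ℝ (Fin n) × ℝ → ℝ) (hu : ContDiff ℝ ∞ u)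
    (p : EuclideanSpace ℝ (Fin n) × ℝ) :
    deriv (fun s => u (p.1, s)) p.2 = pd (tt n) u p := by
  have h1 : HasFDerivAt u (fderiv ℝ u p) (p.1, p.2) :=
    (hu.differentiable (by simp) p).hasFDerivAt
  have h2 := (h1.comp p.2 (hasFDerivAt_prodMk_right p.1 p.2)).hasDerivAt.deriv
  change deriv (u ∘ fun s => (p.1, s)) p.2 = _
  rw [h2]
  simp [pd, tt]

lemma lap_eq (u : EuclideanSpace ℝ (Fin n) × ℝ → ℝ) (hu : ContDiff ℝ ∞ u)
    (p : EuclideanSpace ℝ (Fin n) × ℝ) :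
    lap (fun y => u (y, p.2)) p.1 = ∑ i, pd (bb i) (pd (bb i) u) p := by
  unfold lap
  refine Finset.sum_congr rfl (fun i _ => ?_)
  have key : ∀ (F : EuclideanSpace ℝ (Fin n) × ℝ → ℝ) (hF : ContDiff ℝ ∞ F)
      (x : EuclideanSpace ℝ (Fin n)),
      fderiv ℝ (fun y => F (y, p.2)) x (EuclideanSpace.single i 1) = pd (bb i) F (x, p.2) := by
    intro F hF x
    have h1 : HasFDerivAt F (fderiv ℝ F (x, p.2)) (x, p.2) :=
      (hF.differentiable (by simp) _).hasFDerivAt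
    have h2 : HasFDerivAt (fun y => F (y, p.2)) _ x := h1.comp x (hasFDerivAt_prodMk_left x p.2)
    rw [h2.fderiv]
    simp [pd, bb]
  have hs : ContDiff ℝ ∞ (fun y => u (y, p.2)) := hu.comp (contDiff_id.prodMk contDiff_const)
  have hpd : ContDiff ℝ ∞ (pd (bb i) u) := by
    rw [← contDiffOn_univ]
    exact Sm.pd isOpen_univ (contDiffOn_univ.2 hu) _
  rw [iteratedFDeriv_two_apply]
  simp only [Matrix.cons_val_zero, Matrix.cons_val_one]
  have h3 : DifferentiableAt ℝ (fderiv ℝ (fun y => u (y, p.2))) p.1 :=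
    ((hs.fderiv_right (m := ∞) (by simp)).differentiable (by simp)) p.1
  have h4 : fderiv ℝ (fderiv ℝ (fun y => u (y, p.2))) p.1 (EuclideanSpace.single i 1)
      (EuclideanSpace.single i 1) = fderiv ℝ (fun x => fderiv ℝ (fun y => u (y, p.2)) x
        (EuclideanSpace.single i 1)) p.1 (EuclideanSpace.single i 1) := by
    rw [fderiv_clm_apply h3 (differentiableAt_const _)]
    simp
  rw [h4]
  have h5 : (fun x => fderiv ℝ (fun y => u (y, p.2)) x (EuclideanSpace.single i 1))
      = fun x => pd (bb i) u (x, p.2) := funext (key u hu)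
  rw [h5, key _ hpd]

lemma Q_open (hn : 0 < n) (θ : ℝ) : IsOpen (Qset (n := n) hn θ) := by
  unfold Qset cone
  have c1 : Continuous fun p : EuclideanSpace ℝ (Fin n) × ℝ => p.1 ⟨0, hn⟩ := by fun_prop
  refine IsOpen.inter ?_ (IsOpen.inter ?_ ?_)
  · exact isOpen_lt (by fun_prop) c1
  · exact isOpen_lt continuous_const c1
  · exact isOpen_Ioo.preimage continuous_snd

lemma wt_eq (hn : 0 < n) (ε α K a : ℝ) (p : EuclideanSpace ℝ (Fin n) × ℝ)
    (hx : 0 < p.1 ⟨0, hn⟩) (ht : 0 < p.2) :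
    2 * a * (p.2 ^ (-K) - 1) * φ hn (123/50 : ℝ) ε α p.1 - (‖p.1‖ ^ 2 + K) / (8 * p.2)
    = 2 * sep (phh ⟨0, hn⟩ α (123/50) (ε ^ (123/50:ℝ))) (tf a K) (gf ⟨0, hn⟩ K) (tp (-1)) p := by
  unfold sep phh tf gf φ
  rw [Mon_eq hx, Mon_eq hx, Mon_eq hx]
  simp only [tp, Real.rpow_zero, add_zero, sub_add_cancel, Real.rpow_neg_one, mul_one]
  rw [show ‖p.1‖ ^ (2:ℝ) = ‖p.1‖ ^ 2 by norm_cast]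
  field_simp
  ring

end Assembly

/-- the Carleman inequality. With `m = 2.46`,
`ε₀ = √((m−1)/(m+1)) = √(73/173)`: for every `ε ∈ (0,ε₀)` and `θ = 2 arccos ε`,
there are `α ∈ (1,2)` and `K > 0` such that for every smooth `u` compactly
supported in `Q` and every `a > 0`:
`∫_Q e^{2a(t^{−K}−1)φ(x) − (|x|²+K)/(8t)} (|u|² + |∇u|²)
  ≤ ∫_Q e^{2a(t^{−K}−1)φ(x) − (|x|²+K)/(8t)} |∂ₜu + Δu|²`. -/
theorem stmt_1 (n : ℕ) (hn : 2 ≤ n) (ε θ : ℝ)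
    (hε : ε ∈ Ioo 0 (Real.sqrt (73 / 173))) (hθ : θ = 2 * Real.arccos ε) :
    ∃ α ∈ Ioo (1 : ℝ) 2, ∃ K > (0 : ℝ),
      ∀ u : EuclideanSpace ℝ (Fin n) × ℝ → ℝ,
        ContDiff ℝ (⊤ : ℕ∞) u → HasCompactSupport u →
        tsupport u ⊆ Qset (by omega) θ →
        ∀ a : ℝ, 0 < a →
          (∫ p in Qset (n := n) (by omega) θ,
              Real.exp (2 * a * (p.2 ^ (-K) - 1) * φ (by omega) (2.46 : ℝ) ε α p.1
                  - (‖p.1‖ ^ 2 + K) / (8 * p.2))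
                * (|u p| ^ 2 + ‖gradient (fun y => u (y, p.2)) p.1‖ ^ 2))
            ≤ ∫ p in Qset (n := n) (by omega) θ,
                Real.exp (2 * a * (p.2 ^ (-K) - 1) * φ (by omega) (2.46 : ℝ) ε α p.1
                    - (‖p.1‖ ^ 2 + K) / (8 * p.2))
                  * |deriv (fun s => u (p.1, s)) p.2 + lap (fun y => u (y, p.2)) p.1| ^ 2 := by
  have hn0 : 0 < n := by omega
  obtain ⟨hε0, hε1⟩ := hε
  have hlt1 : ε < 1 := hε1.trans_le (Real.sqrt_le_one.2 (by norm_num))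
  have hcos : Real.cos (θ / 2) = ε := by
    rw [hθ, mul_div_cancel_left₀ _ (two_ne_zero), Real.cos_arccos (by linarith) hlt1.le]
  set U : Set (EuclideanSpace ℝ (Fin n) × ℝ) := Qset hn0 θ with hUdef
  have hU : IsOpen U := Q_open hn0 θ
  have h1 : ∀ p ∈ U, 1 < p.1 ⟨0, hn0⟩ := fun p hp => hp.2.1
  have h1' : ∀ p ∈ U, 0 < p.1 ⟨0, hn0⟩ := fun p hp => by linarith [h1 p hp]
  have h2 : ∀ p ∈ U, 0 < p.2 ∧ p.2 < 1 := fun p hp => ⟨hp.2.2.1, hp.2.2.2⟩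
  have h2' : ∀ p ∈ U, 0 < p.2 := fun p hp => (h2 p hp).1
  have h3 : ∀ p ∈ U, ‖p.1‖ * ε < p.1 ⟨0, hn0⟩ := fun p hp => by
    have := hp.1
    simp only [cone, mem_setOf_eq, hcos] at this
    exact this
  obtain ⟨e, he⟩ : ∃ e : ℝ, e = ε ^ (123/50 : ℝ) := ⟨_, rfl⟩
  have hepos : 0 < e := by rw [he]; exact Real.rpow_pos_of_pos hε0 _
  obtain ⟨CL, hCL, hL⟩ := L_bd (i0 := ⟨0, hn0⟩) hU hε0 h1 h3 (1999/1000) (123/50) e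
  obtain ⟨K, hKdef⟩ : ∃ K : ℝ, K = 64 + 600 * (123/50)^2 / e^2
    + 4 * (8 * (123/50) + CL) / ((1999/1000) * e) := ⟨_, rfl⟩
  have t1 : 0 ≤ 600 * (123/50 : ℝ)^2 / e^2 := by positivity
  have t2 : 0 ≤ 4 * (8 * (123/50 : ℝ) + CL) / ((1999/1000) * e) := by positivity
  have hK : 64 ≤ K := by linarith
  have hK1 : 10 * (2 * (123/50 : ℝ) ^ 2) + 4 * (123/50) ^ 2 ≤ 4 * K * (e ^ 2 / 100) := by
    have : 600 * (123/50 : ℝ)^2 / e^2 ≤ K := by linarith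
    rw [div_le_iff₀ (by positivity)] at this
    linarith
  have hK2 : 4 * (8 * (123/50 : ℝ) + CL) ≤ K * ((1999/1000) * e) := by
    have : 4 * (8 * (123/50 : ℝ) + CL) / ((1999/1000) * e) ≤ K := by linarith
    rwa [div_le_iff₀ (by positivity)] at this
  refine ⟨1999/1000, ⟨by norm_num, by norm_num⟩, K, by linarith, ?_⟩
  intro u hu hcs hsupp a ha
  have hu' : ContDiff ℝ ∞ u := hu
  haveI : (volume : Measure (EuclideanSpace ℝ (Fin n) × ℝ)).IsAddHaarMeasure :=
    inferInstanceAs ((volume : Measure (EuclideanSpace ℝ (Fin n))).prod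
      (volume : Measure ℝ)).IsAddHaarMeasure
  have main := carl_u (μ := volume) hU hcs.isCompact hsupp (u := u)
    (h := sep (ghh ⟨0, hn0⟩ (1999/1000) (123/50) e) (tf a K) (fun _ => 2) (tp (-1)))
    (P := sep (phh ⟨0, hn0⟩ (1999/1000) (123/50) e) (tf a K) (gf ⟨0, hn0⟩ K) (tp (-1)))
    hu'.contDiffOn
    (sep_sm (ghh_sp hU h1' _ _ _) (tf_tm hU h2' a K) (Sp.const 2) (tp_tm hU h2' (-1)))
    (sep_sm (phh_sp hU h1' _ _ _) (tf_tm hU h2' a K) (gf_sp hU h1' K) (tp_tm hU h2' (-1)))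
    (fun p hp => image_eq_zero_of_notMem_tsupport hp) bb (tt n)
    (fun p hp w y => point_ineq hU h1 hε0 hε1 h3 h2 (123/50) (1999/1000) e rfl rfl he a K CL ha
      hCL hL hK hK1 hK2 p hp w y)
  have h246 : (2.46 : ℝ) = 123/50 := by norm_num
  rw [h246]
  refine le_of_eq_of_le (setIntegral_congr_fun hU.measurableSet (fun p hp => ?_))
    (main.trans_eq (setIntegral_congr_fun hU.measurableSet (fun p hp => ?_)))
  · have hw := wt_eq hn0 ε (1999/1000) K a p (h1' p hp) (h2' p hp)
    beta_reduce
    rw [hw, grad_eq u hu' p, sq_abs, he]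
  · have hw := wt_eq hn0 ε (1999/1000) K a p (h1' p hp) (h2' p hp)
    beta_reduce
    rw [hw, deriv_eq_pd u hu' p, lap_eq u hu' p, sq_abs, he]
end

section
/- Let 2 < m < 3, 1 < α ≤ 2, 0 < ε < 1, and h ∈ [ε,1]. Then (α² − 2α) f(h) + (3 − 2α) h f'(h) + h² f''(h) ≥ 0. -/
/-- `f(h) = h^m - ε^m` (real powers). -/
noncomputable def f (m ε h : ℝ) : ℝ := h ^ m - ε ^ m

/-- `f'(h) = m h^{m-1}`. -/
noncomputable def f' (m h : ℝ) : ℝ := m * h ^ (m - 1)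

/-- `f''(h) = m (m-1) h^{m-2}`. -/
noncomputable def f'' (m h : ℝ) : ℝ := m * (m - 1) * h ^ (m - 2)

/-- for `2 < m < 3`, `1 < α ≤ 2`, `0 < ε < 1` and `h ∈ [ε,1]`,
`(α² − 2α) f(h) + (3 − 2α) h f'(h) + h² f''(h) ≥ 0`. -/
theorem stmt_3 (m α ε h : ℝ) (hm₁ : 2 < m) (hm₂ : m < 3) (hα₁ : 1 < α) (hα₂ : α ≤ 2)
    (hε₁ : 0 < ε) (hε₂ : ε < 1) (hh : h ∈ Set.Icc ε 1) :
    (α ^ 2 - 2 * α) * f m ε h + (3 - 2 * α) * h * f' m h + h ^ 2 * f'' m h ≥ 0 := by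
  obtain ⟨h1, h2⟩ := hh
  have hp : 0 < h := lt_of_lt_of_le hε₁ h1
  have e1 : h * h ^ (m - 1) = h ^ m := by
    rw [Real.rpow_sub_one hp.ne']; field_simp
  have e2 : h ^ 2 * h ^ (m - 2) = h ^ m := by
    rw [← Real.rpow_natCast h 2, ← Real.rpow_add hp]; norm_num
  have hA : 0 ≤ h ^ m := (Real.rpow_pos_of_pos hp m).le
  have hB : 0 ≤ ε ^ m := (Real.rpow_pos_of_pos hε₁ m).le
  have key : (α ^ 2 - 2 * α) * f m ε h + (3 - 2 * α) * h * f' m h + h ^ 2 * f'' m h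
      = (m - α) * (m - α + 2) * h ^ m + α * (2 - α) * ε ^ m := by
    unfold f f' f''
    linear_combination (3 - 2 * α) * m * e1 + m * (m - 1) * e2
  rw [key]
  have a1 : 0 ≤ m - α := by linarith
  have a2 : 0 ≤ m - α + 2 := by linarith
  have a3 : 0 ≤ α := by linarith
  have a4 : 0 ≤ 2 - α := by linarith
  exact add_nonneg (mul_nonneg (mul_nonneg a1 a2) hA) (mul_nonneg (mul_nonneg a3 a4) hB)
end

section
/- Let 2 < m < 3, 1 < α ≤ 2, 0 < ε < 1, and h ∈ [ε,1]. Then (α−1)² f'(h)² + (2α − α²) f(h) f''(h) − h f'(h) f''(h) ≤ 0. -/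
/-- for `2 < m < 3`, `1 < α ≤ 2`, `0 < ε < 1` and `h ∈ [ε,1]`,
`(α−1)² f'(h)² + (2α − α²) f(h) f''(h) − h f'(h) f''(h) ≤ 0`. -/
theorem stmt_4 (m α ε h : ℝ) (hm₁ : 2 < m) (hm₂ : m < 3) (hα₁ : 1 < α) (hα₂ : α ≤ 2)
    (hε₁ : 0 < ε) (hε₂ : ε < 1) (hh : h ∈ Set.Icc ε 1) :
    (α - 1) ^ 2 * f' m h ^ 2 + (2 * α - α ^ 2) * f m ε h * f'' m h
      - h * f' m h * f'' m h ≤ 0 := by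
  have hpos : 0 < h := lt_of_lt_of_le hε₁ hh.1
  have he : 0 < ε ^ m := Real.rpow_pos_of_pos hε₁ m
  have hp : 0 < h ^ (m - 2) := Real.rpow_pos_of_pos hpos _
  have h1 : h ^ (m - 1) = h ^ (m - 2) * h := by
    rw [← Real.rpow_add_one hpos.ne']
    congr 1
    ring
  have h2 : h ^ m = h ^ (m - 2) * h * h := by
    rw [← h1, ← Real.rpow_add_one hpos.ne']
    congr 1
    ring
  unfold f f' f''
  rw [h1, h2]
  generalize h ^ (m - 2) = p at *
  generalize ε ^ m = e at *
  have ht : (α - 1) ^ 2 ≤ 1 := by nlinarith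
  have hs : 0 ≤ 1 - (α - 1) ^ 2 := by linarith
  have hm : 0 ≤ m := by linarith
  have hm' : 0 ≤ m - 1 := by linarith
  have key : 0 ≤ m * (m - 1) - (m - 1 + (α - 1) ^ 2) := by nlinarith
  have a1 : 0 ≤ m * (p * h) ^ 2 * (m * (m - 1) - (m - 1 + (α - 1) ^ 2)) :=
    mul_nonneg (by positivity) key
  have a2 : 0 ≤ (1 - (α - 1) ^ 2) * e * (m * (m - 1) * p) :=
    mul_nonneg (mul_nonneg hs he.le) (mul_nonneg (mul_nonneg hm hm') hp.le)
  linarith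
end

section
/- Let 2 < m < 3, 1 < α ≤ 2, 0 < ε < 1, and let x ∈ ℝⁿ with x ≠ 0 and x₁ ≥ ε|x| (so that h = x₁/|x| ∈ [ε,1]). Then the Hessian matrix D²φ(x) satisfies, for every ξ ∈ ℝⁿ, ⟨D²φ(x) ξ, ξ⟩ ≥ |x|^{α−2} (α f(h) − h f'(h)) |ξ|². -/
/-- The Hessian quadratic form `⟨D²g(x) ξ, ξ⟩` of `g` at `x` applied to `ξ`. -/
noncomputable def hessQ {n : ℕ} (g : EuclideanSpace ℝ (Fin n) → ℝ)
    (x ξ : EuclideanSpace ℝ (Fin n)) : ℝ :=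
  iteratedFDeriv ℝ 2 g x ![ξ, ξ]


open Filter Topology

lemma hess_line {n : ℕ} (g : EuclideanSpace ℝ (Fin n) → ℝ) (x ξ : EuclideanSpace ℝ (Fin n))
    (hg : ContDiffAt ℝ 2 g x) (u : ℝ → ℝ) (D : ℝ)
    (h1 : ∀ᶠ t in 𝓝 (0:ℝ), HasDerivAt (fun t : ℝ => g (x + t • ξ)) (u t) t)
    (h2 : HasDerivAt u D 0) : hessQ g x ξ = D := by
  unfold hessQ
  rw [iteratedFDeriv_two_apply]
  simp only [Matrix.cons_val_zero, Matrix.cons_val_one]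
  have hl : ∀ t : ℝ, HasDerivAt (fun t : ℝ => x + t • ξ) ξ t := by
    intro t
    simpa using ((hasDerivAt_id t).smul_const ξ).const_add x
  have hd : DifferentiableAt ℝ (fderiv ℝ g) x := by
    have := hg.fderiv_right (m := 1) (by norm_num)
    exact this.differentiableAt (by norm_num)
  have hev : ∀ᶠ y in 𝓝 x, DifferentiableAt ℝ g y := by
    filter_upwards [hg.eventually (by simp)] with y hy
    exact hy.differentiableAt two_ne_zero
  have hc : Tendsto (fun t : ℝ => x + t • ξ) (𝓝 0) (𝓝 x) := by
    have := (hl 0).continuousAt.tendsto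
    simpa using this
  have hu : u =ᶠ[𝓝 0] fun t => fderiv ℝ g (x + t • ξ) ξ := by
    filter_upwards [h1, hc.eventually hev] with t ht hy
    have h5 := HasFDerivAt.comp_hasDerivAt (l := g) t hy.hasFDerivAt (hl t)
    exact HasDerivAt.unique ht h5
  have h3 : HasDerivAt (fun t : ℝ => fderiv ℝ g (x + t • ξ) ξ) (fderiv ℝ (fderiv ℝ g) x ξ ξ) 0 := by
    have hd' : HasFDerivAt (fderiv ℝ g) (fderiv ℝ (fderiv ℝ g) x) (x + (0:ℝ) • ξ) := by
      simpa using hd.hasFDerivAt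
    have h6 : HasDerivAt (fun t : ℝ => fderiv ℝ g (x + t • ξ)) (fderiv ℝ (fderiv ℝ g) x ξ) 0 :=
      HasFDerivAt.comp_hasDerivAt (l := fderiv ℝ g) (0:ℝ) hd' (hl 0)
    exact HasFDerivAt.comp_hasDerivAt (l := fun T : EuclideanSpace ℝ (Fin n) →L[ℝ] ℝ => T ξ)
      (0:ℝ) (ContinuousLinearMap.apply ℝ ℝ ξ).hasFDerivAt h6
  exact (h3.congr_of_eventuallyEq hu).unique h2

lemma quad_ineq (m α h a b e : ℝ) (hm : 2 < m) (hα₁ : 1 < α) (hα₂ : α ≤ 2) (he : 0 ≤ e) :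
    0 ≤ (α - m) * (α - m - 2) * h ^ 2 * a ^ 2 + 2 * m * (α - m) * h * a * b
      + m * (m - 1) * b ^ 2 + e * α * (2 - α) * a ^ 2 := by
  have h1 : 0 ≤ e * α * (2 - α) * a ^ 2 := by
    have : 0 ≤ 2 - α := by linarith
    positivity
  have key : 0 ≤ (m - 1) * ((α - m) * (α - m - 2) * h ^ 2 * a ^ 2 + 2 * m * (α - m) * h * a * b
      + m * (m - 1) * b ^ 2) := by
    have e1 : (m - 1) * ((α - m) * (α - m - 2) * h ^ 2 * a ^ 2 + 2 * m * (α - m) * h * a * b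
      + m * (m - 1) * b ^ 2) = m * ((m - 1) * b + (α - m) * (h * a)) ^ 2
        + (m - α) * (m + α - 2) * (h * a) ^ 2 := by ring
    rw [e1]
    have : 0 ≤ m - α := by linarith
    have : 0 ≤ m + α - 2 := by linarith
    positivity
  have := nonneg_of_mul_nonneg_right key (by linarith)
  linarith

/-- for `x ≠ 0` with `x₁ ≥ ε|x|` and `h = x₁/|x| ∈ [ε,1]`, the Hessian
of `φ` satisfies `⟨D²φ(x) ξ, ξ⟩ ≥ |x|^{α−2}(α f(h) − h f'(h)) |ξ|²` for all `ξ`. -/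
theorem stmt_6 (n : ℕ) (hn : 0 < n) (m α ε : ℝ) (hm₁ : 2 < m) (hm₂ : m < 3)
    (hα₁ : 1 < α) (hα₂ : α ≤ 2) (hε₁ : 0 < ε) (hε₂ : ε < 1)
    (x : EuclideanSpace ℝ (Fin n)) (hx : x ≠ 0) (hx₁ : ε * ‖x‖ ≤ x ⟨0, hn⟩)
    (ξ : EuclideanSpace ℝ (Fin n)) :
    hessQ (φ hn m ε α) x ξ
      ≥ ‖x‖ ^ (α - 2) * (α * f m ε (x ⟨0, hn⟩ / ‖x‖)
          - (x ⟨0, hn⟩ / ‖x‖) * f' m (x ⟨0, hn⟩ / ‖x‖)) * ‖ξ‖ ^ 2 := by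
  set x1 := x ⟨0, hn⟩ with hx1
  set b := ξ ⟨0, hn⟩ with hb
  set A : ℝ := inner ℝ x ξ with hA
  have hr : 0 < ‖x‖ := norm_pos_iff.2 hx
  have hx1p : 0 < x1 := lt_of_lt_of_le (by positivity) hx₁
  let N : ℝ → ℝ := fun t => ‖x‖ ^ 2 + 2 * A * t + ‖ξ‖ ^ 2 * t ^ 2
  let N' : ℝ → ℝ := fun t => 2 * A + 2 * ‖ξ‖ ^ 2 * t
  let L : ℝ → ℝ := fun t => x1 + t * b
  have hN : ∀ t, N t = ‖x + t • ξ‖ ^ 2 := by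
    intro t
    rw [norm_add_sq_real, inner_smul_right, norm_smul, mul_pow, Real.norm_eq_abs, sq_abs]
    simp only [N]; ring
  have dN : ∀ t, HasDerivAt N (N' t) t := by
    intro t
    have := (((hasDerivAt_id t).const_mul (2 * A)).const_add (‖x‖ ^ 2)).add
      (((hasDerivAt_id t).pow 2).const_mul (‖ξ‖ ^ 2))
    refine this.congr_deriv ?_
    simp [N']; ring
  have dN' : ∀ t, HasDerivAt N' (2 * ‖ξ‖ ^ 2) t := by
    intro t
    have := ((hasDerivAt_id t).const_mul (2 * ‖ξ‖ ^ 2)).const_add (2 * A)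
    exact this.congr_deriv (by simp)
  have dL : ∀ t, HasDerivAt L b t := by
    intro t
    have := ((hasDerivAt_id t).mul_const b).const_add x1
    exact this.congr_deriv (by simp)
  have N0 : N 0 = ‖x‖ ^ 2 := by simp [N]
  have N'0 : N' 0 = 2 * A := by simp [N']
  have L0 : L 0 = x1 := by simp [L]
  have evN : ∀ᶠ t in 𝓝 (0:ℝ), 0 < N t :=
    (dN 0).continuousAt.eventually (lt_mem_nhds (by rw [N0]; positivity))
  have evL : ∀ᶠ t in 𝓝 (0:ℝ), 0 < L t :=
    (dL 0).continuousAt.eventually (lt_mem_nhds (by rw [L0]; positivity))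
  have pN : ∀ t, 0 < N t → ∀ k : ℝ, HasDerivAt (fun t => N t ^ k) (N' t * k * N t ^ (k - 1)) t :=
    fun t ht k => (dN t).rpow_const (Or.inl ht.ne')
  have pL : ∀ t, 0 < L t → ∀ k : ℝ, HasDerivAt (fun t => L t ^ k) (b * k * L t ^ (k - 1)) t :=
    fun t ht k => (dL t).rpow_const (Or.inl ht.ne')
  have hφ : ∀ t, 0 < N t → 0 < L t →
      φ hn m ε α (x + t • ξ) = N t ^ ((α - m) / 2) * L t ^ m - ε ^ m * N t ^ (α / 2) := by
    intro t h1 h2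
    have e0 : (x + t • ξ) ⟨0, hn⟩ = L t := by simp [L, x1, b]
    have hp : 0 < ‖x + t • ξ‖ := by
      rw [hN] at h1
      exact (norm_nonneg _).lt_of_ne' (by intro h; simp [h] at h1)
    unfold φ
    rw [e0, hN, ← Real.rpow_natCast_mul hp.le, ← Real.rpow_natCast_mul hp.le,
      Real.div_rpow h2.le hp.le]
    have e1 : ((2:ℕ):ℝ) * ((α - m) / 2) = α - m := by push_cast; ring
    have e2 : ((2:ℕ):ℝ) * (α / 2) = α := by push_cast; ring
    rw [e1, e2, Real.rpow_sub hp]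
    ring
  have hC : ContDiffAt ℝ 2 (φ hn m ε α) x := by
    unfold φ
    have c1 : ContDiffAt ℝ 2 (fun y : EuclideanSpace ℝ (Fin n) => ‖y‖) x := contDiffAt_norm ℝ hx
    have c2 : ContDiffAt ℝ 2 (fun y : EuclideanSpace ℝ (Fin n) => y ⟨0, hn⟩) x := by fun_prop
    exact (c1.rpow_const_of_ne hr.ne').mul
      (((c2.div c1 hr.ne').rpow_const_of_ne (div_pos hx1p hr).ne').sub contDiffAt_const)
  have H := hess_line (φ hn m ε α) x ξ hC
    (fun t => (N' t * ((α - m) / 2) * N t ^ ((α - m) / 2 - 1)) * L t ^ m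
      + N t ^ ((α - m) / 2) * (b * m * L t ^ (m - 1))
      - ε ^ m * (N' t * (α / 2) * N t ^ (α / 2 - 1))) _ (by
      filter_upwards [evN, evL, evN.eventually_nhds, evL.eventually_nhds] with t h1 h2 h3 h4
      have := ((pN t h1 ((α - m) / 2)).mul (pL t h2 m)).sub ((pN t h1 (α / 2)).const_mul (ε ^ m))
      refine this.congr_of_eventuallyEq ?_
      filter_upwards [h3, h4] with s h5 h6
      exact hφ s h5 h6)
    ((((((dN' 0).mul_const ((α - m) / 2)).mul (pN 0 evN.self_of_nhds ((α - m) / 2 - 1))).mul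
        (pL 0 evL.self_of_nhds m)).add
      ((pN 0 evN.self_of_nhds ((α - m) / 2)).mul ((pL 0 evL.self_of_nhds (m - 1)).const_mul (b * m)))).sub
      ((((dN' 0).mul_const (α / 2)).mul (pN 0 evN.self_of_nhds (α / 2 - 1))).const_mul (ε ^ m)))
  rw [H]
  simp only [Pi.mul_apply, N0, N'0, L0]
  have hh : 0 < x1 / ‖x‖ := div_pos hx1p hr
  set h := x1 / ‖x‖ with hhd
  have hx1e : x1 = h * ‖x‖ := by rw [hhd]; field_simp
  set r := ‖x‖ with hrd
  have r2 : 0 < r ^ 2 := by positivity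
  have E1 : (r ^ 2) ^ ((α - m) / 2) = r ^ α / r ^ m := by
    rw [← Real.rpow_natCast_mul hr.le, ← Real.rpow_sub hr]; congr 1; push_cast; ring
  have E2 : (r ^ 2) ^ (α / 2) = r ^ α := by
    rw [← Real.rpow_natCast_mul hr.le]; congr 1; push_cast; ring
  have E3 : r ^ (α - 2) = r ^ α / r ^ 2 := by
    rw [Real.rpow_sub hr]; norm_num
  unfold f f'
  rw [hx1e]
  simp only [Real.rpow_sub r2, Real.rpow_sub (mul_pos hh hr), Real.rpow_sub hh, Real.rpow_one,
    E1, E2, E3, Real.mul_rpow hh.le hr.le]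
  have hP : 0 < h ^ m := Real.rpow_pos_of_pos hh _
  have hQ : 0 < r ^ α := Real.rpow_pos_of_pos hr _
  have hM : 0 < r ^ m := Real.rpow_pos_of_pos hr _
  have hE : 0 < ε ^ m := Real.rpow_pos_of_pos hε₁ _
  generalize h ^ m = P at *
  generalize r ^ α = Q at *
  generalize r ^ m = M at *
  generalize ε ^ m = E at *
  have q := quad_ineq m α h (A / r) b (E * h ^ 2 / P) hm₁ hα₁ hα₂ (by positivity)
  have q2 := mul_nonneg (show 0 ≤ Q * P / (r ^ 2 * h ^ 2) by positivity) q
  rw [ge_iff_le, ← sub_nonneg]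
  refine q2.trans_eq ?_
  field_simp
  ring
end

section
/- Let 2 < m < 3, 1 < α ≤ 2, 0 < ε < 1, and let x ∈ ℝⁿ with x ≠ 0 and x₁ > 0, h = x₁/|x|. Then 4⟨D²φ(x) ∇φ(x), ∇φ(x)⟩ + 4|x|^{α−2}(α f(h) − h f'(h)) |∇φ(x)|² = 4 |x|^{3α−4} l₁(α,h). -/
/-- `l₁(α,h) = α⁴ f³ − α² h f² f' + 2α²(1−h²) f f'² − 2h(1−h²) f'³ + (1−h²)² f'² f''`. -/
noncomputable def l₁ (m ε α h : ℝ) : ℝ :=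
  α ^ 4 * f m ε h ^ 3 - α ^ 2 * h * f m ε h ^ 2 * f' m h
    + 2 * α ^ 2 * (1 - h ^ 2) * f m ε h * f' m h ^ 2
    - 2 * h * (1 - h ^ 2) * f' m h ^ 3 + (1 - h ^ 2) ^ 2 * f' m h ^ 2 * f'' m h

section aux
variable {n : ℕ}

lemma aux_norm (p : ℝ) (y : EuclideanSpace ℝ (Fin n)) (hy : y ≠ 0) :
    HasFDerivAt (fun z : EuclideanSpace ℝ (Fin n) => ‖z‖ ^ p)
      ((p * ‖y‖ ^ (p - 2)) • innerSL ℝ y) y := by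
  have hr : 0 < ‖y‖ := norm_pos_iff.2 hy
  have h1 := (hasStrictFDerivAt_norm_sq y).hasFDerivAt
  have h2 := h1.rpow_const (p := p / 2) (Or.inl (by positivity))
  have e : (fun z : EuclideanSpace ℝ (Fin n) => ‖z‖ ^ p)
      = fun z => (‖z‖ ^ 2) ^ (p / 2) := by
    funext z
    rw [← Real.rpow_natCast, ← Real.rpow_mul (norm_nonneg _)]
    congr 1; push_cast; ring
  rw [e]
  refine h2.congr_fderiv ?_
  have e2 : (‖y‖ ^ 2) ^ (p / 2 - 1) = ‖y‖ ^ (p - 2) := by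
    rw [← Real.rpow_natCast, ← Real.rpow_mul (norm_nonneg _)]
    congr 1; push_cast; ring
  ext v
  simp [e2]
  ring

lemma aux_coord (i : Fin n) (p : ℝ) (y : EuclideanSpace ℝ (Fin n)) (hy : 0 < y i) :
    HasFDerivAt (fun z : EuclideanSpace ℝ (Fin n) => (z i) ^ p)
      ((p * (y i) ^ (p - 1)) • (EuclideanSpace.proj i : EuclideanSpace ℝ (Fin n) →L[ℝ] ℝ)) y := by
  have h1 : HasFDerivAt (fun z : EuclideanSpace ℝ (Fin n) => z i)
      (EuclideanSpace.proj i : EuclideanSpace ℝ (Fin n) →L[ℝ] ℝ) y :=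
    (EuclideanSpace.proj i : EuclideanSpace ℝ (Fin n) →L[ℝ] ℝ).hasFDerivAt
  exact h1.rpow_const (Or.inl hy.ne')

lemma aux_ne (i : Fin n) (y : EuclideanSpace ℝ (Fin n)) (hy : 0 < y i) : y ≠ 0 := by
  rintro rfl; simp at hy

lemma aux_ev (i : Fin n) (y : EuclideanSpace ℝ (Fin n)) (hy : 0 < y i) :
    ∀ᶠ z : EuclideanSpace ℝ (Fin n) in nhds y, 0 < z i := by
  have : Continuous (fun z : EuclideanSpace ℝ (Fin n) => z i) := by fun_prop
  exact this.continuousAt.eventually (lt_mem_nhds hy)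

noncomputable def auxA (i : Fin n) (m ε α : ℝ) (y : EuclideanSpace ℝ (Fin n)) : ℝ :=
  (α - m) * (‖y‖ ^ (α - m - 2) * (y i) ^ m) - α * ε ^ m * ‖y‖ ^ (α - 2)

noncomputable def auxB (i : Fin n) (m α : ℝ) (y : EuclideanSpace ℝ (Fin n)) : ℝ :=
  m * (‖y‖ ^ (α - m) * (y i) ^ (m - 1))

noncomputable def auxG (i : Fin n) (m ε α : ℝ) (y : EuclideanSpace ℝ (Fin n)) :
    EuclideanSpace ℝ (Fin n) :=
  auxA i m ε α y • y + auxB i m α y • EuclideanSpace.single i 1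

lemma aux_phi (hn : 0 < n) (m ε α : ℝ) (y : EuclideanSpace ℝ (Fin n)) (hy : 0 < y ⟨0, hn⟩) :
    HasFDerivAt (φ hn m ε α) (innerSL ℝ (auxG ⟨0, hn⟩ m ε α y)) y := by
  set i : Fin n := ⟨0, hn⟩
  have hy0 := aux_ne i y hy
  have h := ((aux_norm (α - m) y hy0).mul (aux_coord i m y hy)).sub
    ((aux_norm α y hy0).const_mul (ε ^ m))
  have e : φ hn m ε α =ᶠ[nhds y]
      fun z => ‖z‖ ^ (α - m) * (z i) ^ m - ε ^ m * ‖z‖ ^ α := by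
    filter_upwards [aux_ev i y hy] with z hz
    have hr : 0 < ‖z‖ := norm_pos_iff.2 (aux_ne i z hz)
    have : (0:ℝ) < ‖z‖ ^ m := by positivity
    rw [φ, Real.div_rpow hz.le hr.le, Real.rpow_sub hr]
    field_simp
  refine (h.congr_of_eventuallyEq e).congr_fderiv ?_
  ext v
  simp [auxG, auxA, auxB, inner_add_left, inner_smul_left, EuclideanSpace.inner_single_left]
  ring

lemma aux_A (i : Fin n) (m ε α : ℝ) (y : EuclideanSpace ℝ (Fin n)) (hy : 0 < y i) :
    HasFDerivAt (auxA i m ε α)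
      ((((α - m) * (α - m - 2) * ‖y‖ ^ (α - m - 4) * (y i) ^ m
        - α * (α - 2) * ε ^ m * ‖y‖ ^ (α - 4))) • innerSL ℝ y
       + ((α - m) * m * ‖y‖ ^ (α - m - 2) * (y i) ^ (m - 1)) •
        (EuclideanSpace.proj i : EuclideanSpace ℝ (Fin n) →L[ℝ] ℝ)) y := by
  have hy0 := aux_ne i y hy
  have h := (((aux_norm (α - m - 2) y hy0).mul (aux_coord i m y hy)).const_mul (α - m)).sub
    ((aux_norm (α - 2) y hy0).const_mul (α * ε ^ m))
  refine HasFDerivAt.congr_fderiv (f := auxA i m ε α) h ?_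
  ext v
  simp [show α - m - 2 - 2 = α - m - 4 by ring, show α - 2 - 2 = α - 4 by ring]
  ring

lemma aux_B (i : Fin n) (m α : ℝ) (y : EuclideanSpace ℝ (Fin n)) (hy : 0 < y i) :
    HasFDerivAt (auxB i m α)
      ((m * (α - m) * ‖y‖ ^ (α - m - 2) * (y i) ^ (m - 1)) • innerSL ℝ y
       + (m * (m - 1) * ‖y‖ ^ (α - m) * (y i) ^ (m - 2)) •
        (EuclideanSpace.proj i : EuclideanSpace ℝ (Fin n) →L[ℝ] ℝ)) y := by
  have hy0 := aux_ne i y hy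
  have h := ((aux_norm (α - m) y hy0).mul (aux_coord i (m - 1) y hy)).const_mul m
  refine HasFDerivAt.congr_fderiv (f := auxB i m α) h ?_
  ext v
  simp [show m - 1 - 1 = m - 2 by ring]
  ring

lemma aux_grad (hn : 0 < n) (m ε α : ℝ) (y : EuclideanSpace ℝ (Fin n)) (hy : 0 < y ⟨0, hn⟩) :
    gradient (φ hn m ε α) y = auxG ⟨0, hn⟩ m ε α y := by
  have h : HasGradientAt (φ hn m ε α) (auxG ⟨0, hn⟩ m ε α y) y := by
    rw [hasGradientAt_iff_hasFDerivAt]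
    exact aux_phi hn m ε α y hy
  exact h.gradient

lemma aux_hess (hn : 0 < n) (m ε α : ℝ) (y v : EuclideanSpace ℝ (Fin n)) (hy : 0 < y ⟨0, hn⟩) :
    hessQ (φ hn m ε α) y v =
      (((α - m) * (α - m - 2) * ‖y‖ ^ (α - m - 4) * (y ⟨0, hn⟩) ^ m
        - α * (α - 2) * ε ^ m * ‖y‖ ^ (α - 4)) * inner ℝ y v
       + ((α - m) * m * ‖y‖ ^ (α - m - 2) * (y ⟨0, hn⟩) ^ (m - 1)) * v ⟨0, hn⟩) * inner ℝ y v
      + auxA ⟨0, hn⟩ m ε α y * inner ℝ v v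
      + ((m * (α - m) * ‖y‖ ^ (α - m - 2) * (y ⟨0, hn⟩) ^ (m - 1)) * inner ℝ y v
       + (m * (m - 1) * ‖y‖ ^ (α - m) * (y ⟨0, hn⟩) ^ (m - 2)) * v ⟨0, hn⟩) * v ⟨0, hn⟩ := by
  set i : Fin n := ⟨0, hn⟩
  have e : fderiv ℝ (φ hn m ε α) =ᶠ[nhds y] fun z => innerSL ℝ (auxG i m ε α z) := by
    filter_upwards [aux_ev i y hy] with z hz
    exact (aux_phi hn m ε α z hz).fderiv
  have hG : HasFDerivAt (auxG i m ε α) _ y :=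
    ((aux_A i m ε α y hy).smul (hasFDerivAt_id y)).add
      ((aux_B i m α y hy).smul_const (EuclideanSpace.single i (1:ℝ)))
  have hF := ((innerSL ℝ : EuclideanSpace ℝ (Fin n) →L[ℝ] _).hasFDerivAt
    (x := auxG i m ε α y)).comp y hG.differentiableAt.hasFDerivAt
  have hF' := (hF.congr_of_eventuallyEq e).fderiv
  rw [hessQ, iteratedFDeriv_two_apply, hF']
  change inner ℝ (fderiv ℝ (auxG i m ε α) y v) v = _
  rw [hG.fderiv]
  simp [inner_add_left, inner_smul_left, EuclideanSpace.inner_single_left]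
  ring

end aux

/-- for `x ≠ 0` with `x₁ > 0` and `h = x₁/|x|`,
`4⟨D²φ(x)∇φ(x), ∇φ(x)⟩ + 4|x|^{α−2}(α f(h) − h f'(h))|∇φ(x)|² = 4|x|^{3α−4} l₁(α,h)`. -/
theorem stmt_7 (n : ℕ) (hn : 0 < n) (m α ε : ℝ) (hm₁ : 2 < m) (hm₂ : m < 3)
    (hα₁ : 1 < α) (hα₂ : α ≤ 2) (hε₁ : 0 < ε) (hε₂ : ε < 1)
    (x : EuclideanSpace ℝ (Fin n)) (hx : x ≠ 0) (hx₁ : 0 < x ⟨0, hn⟩) :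
    4 * hessQ (φ hn m ε α) x (gradient (φ hn m ε α) x)
        + 4 * ‖x‖ ^ (α - 2) * (α * f m ε (x ⟨0, hn⟩ / ‖x‖)
            - (x ⟨0, hn⟩ / ‖x‖) * f' m (x ⟨0, hn⟩ / ‖x‖))
          * ‖gradient (φ hn m ε α) x‖ ^ 2
      = 4 * ‖x‖ ^ (3 * α - 4) * l₁ m ε α (x ⟨0, hn⟩ / ‖x‖) := by
  rw [aux_grad hn m ε α x hx₁, aux_hess hn m ε α x _ hx₁, ← real_inner_self_eq_norm_sq]
  have hr : 0 < ‖x‖ := norm_pos_iff.2 hx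
  have hxx : inner ℝ x x = ‖x‖ ^ 2 := real_inner_self_eq_norm_sq x
  have i1 : inner ℝ x (auxG ⟨0, hn⟩ m ε α x)
      = auxA ⟨0, hn⟩ m ε α x * ‖x‖ ^ 2 + auxB ⟨0, hn⟩ m α x * x ⟨0, hn⟩ := by
    simp [auxG, inner_add_right, inner_smul_right, EuclideanSpace.inner_single_right]
  have i2 : (auxG ⟨0, hn⟩ m ε α x) ⟨0, hn⟩
      = auxA ⟨0, hn⟩ m ε α x * x ⟨0, hn⟩ + auxB ⟨0, hn⟩ m α x := by
    simp [auxG]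
  have i3 : inner ℝ (auxG ⟨0, hn⟩ m ε α x) (auxG ⟨0, hn⟩ m ε α x)
      = auxA ⟨0, hn⟩ m ε α x * inner ℝ x (auxG ⟨0, hn⟩ m ε α x)
        + auxB ⟨0, hn⟩ m α x * (auxG ⟨0, hn⟩ m ε α x) ⟨0, hn⟩ := by
    conv_lhs => enter [2]; unfold auxG
    rw [inner_add_left, inner_smul_left, inner_smul_left, EuclideanSpace.inner_single_left]
    simp
  rw [i3, i1, i2]
  unfold auxA auxB l₁ f f' f''
  generalize x ⟨0, hn⟩ = s at *
  generalize ‖x‖ = r at *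
  have p1 : r ^ (α - m - 2) = r ^ α / r ^ m / r ^ 2 := by
    rw [Real.rpow_sub hr, Real.rpow_sub hr, Real.rpow_ofNat]
  have p2 : r ^ (α - m - 4) = r ^ α / r ^ m / r ^ 4 := by
    rw [Real.rpow_sub hr, Real.rpow_sub hr, Real.rpow_ofNat]
  have p3 : r ^ (α - 2) = r ^ α / r ^ 2 := by rw [Real.rpow_sub hr, Real.rpow_ofNat]
  have p4 : r ^ (α - 4) = r ^ α / r ^ 4 := by rw [Real.rpow_sub hr, Real.rpow_ofNat]
  have p5 : r ^ (α - m) = r ^ α / r ^ m := by rw [Real.rpow_sub hr]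
  have p6 : r ^ (3 * α - 4) = (r ^ α) ^ 3 / r ^ 4 := by
    rw [Real.rpow_sub hr, Real.rpow_ofNat, mul_comm, Real.rpow_mul hr.le, Real.rpow_ofNat]
  have hq : 0 < s / r := by positivity
  have p7 : (s / r) ^ (m - 1) = s ^ m / r ^ m / (s / r) := by
    rw [Real.rpow_sub hq, Real.rpow_one, Real.div_rpow hx₁.le hr.le]
  have p8 : (s / r) ^ (m - 2) = s ^ m / r ^ m / (s / r) ^ 2 := by
    rw [Real.rpow_sub hq, Real.rpow_ofNat, Real.div_rpow hx₁.le hr.le]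
  have p9 : s ^ (m - 1) = s ^ m / s := by rw [Real.rpow_sub hx₁, Real.rpow_one]
  have p10 : s ^ (m - 2) = s ^ m / s ^ 2 := by rw [Real.rpow_sub hx₁, Real.rpow_ofNat]
  rw [p1, p2, p3, p4, p5, p6, p7, p8, p9, p10, Real.div_rpow hx₁.le hr.le]
  have hQ : 0 < r ^ m := by positivity
  generalize r ^ m = Q at *
  generalize r ^ α = R at *
  generalize s ^ m = S at *
  generalize ε ^ m = E at *
  clear p1 p2 p3 p4 p5 p6 p7 p8 p9 p10 i1 i2 i3 hxx
  field_simp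
  ring
end

section
/- Let 2.36 ≤ m < 3, 1/2 < γ ≤ 1, and 0 < ε < 1, and assume: (i) 4(2γ−1) ≥ γ²(4 − γ²(m−1)/4); (ii) ε² < (m−1)/(m+1); (iii) (4 − γ²(m−1)/4 − m) − (4 − γ²(m−1)/4) ε^m > 0. Then there exists δ ∈ (0,1) such that for every α ∈ (2−δ, 2) and every h ∈ [ε,1], l₁(α,h) ≥ 0. -/
lemma aux_alg (c γ τ w : ℝ) (hc : 0 < c) (hγ : 0 < γ) (hτ : 0 ≤ τ) (hw : 0 ≤ w)
    (h1 : γ ^ 2 * (1 - c * γ ^ 2) ≤ 2 * γ - 1)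
    (h2 : 1 < (1 - c * γ ^ 2) * τ + w) :
    0 < (τ - 1) * (c * τ ^ 2 + w) + w ^ 2 := by
  rcases le_or_gt 1 τ with h | h
  · rcases hw.eq_or_lt with h0 | h0
    · subst h0
      have hd : 0 ≤ c * γ ^ 2 * τ := by positivity
      have : 1 < τ := by linarith
      have h3 : 0 < c * τ ^ 2 := by positivity
      nlinarith
    · have : 0 ≤ (τ - 1) * (c * τ ^ 2 + w) := mul_nonneg (by linarith) (by positivity)
      have : 0 < w ^ 2 := by positivity
      linarith
  · have hd : 0 ≤ c * γ ^ 2 * τ := by positivity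
    have hv : c * γ ^ 2 * τ < w - (1 - τ) := by linarith
    have hA : (1 - τ + c * γ ^ 2 * τ) * (c * γ ^ 2 * τ) < w * (w - (1 - τ)) :=
      mul_lt_mul'' (by linarith) hv (by linarith) hd
    have hB : 0 ≤ c * τ * ((τ - γ) ^ 2 + τ * (2 * γ - 1 - γ ^ 2 * (1 - c * γ ^ 2))) := by
      have : 0 ≤ 2 * γ - 1 - γ ^ 2 * (1 - c * γ ^ 2) := by linarith
      positivity
    nlinarith

lemma aux_chord (m ε h : ℝ) (hm : 2 ≤ m) (hε : 0 < ε) (hε2 : ε < 1) (hh : ε ≤ h) (hh1 : h ≤ 1) :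
    ε ^ m / h ^ m ≤ ε ^ m + (1 - ε ^ m) * (((1 - h ^ 2) / h ^ 2) / ((1 - ε ^ 2) / ε ^ 2)) := by
  have hpos : 0 < h := by linarith
  have key : ∀ y : ℝ, 0 < y → (1 / y ^ 2) ^ (m / 2) = 1 / y ^ m := by
    intro y hy
    rw [Real.div_rpow (by norm_num) (by positivity), Real.one_rpow, ← Real.rpow_natCast,
      ← Real.rpow_mul hy.le]
    congr 2
    push_cast; ring
  have hX : 0 < (1 - ε ^ 2) / ε ^ 2 := by
    apply div_pos _ (by positivity); nlinarith
  have hx : 0 ≤ (1 - h ^ 2) / h ^ 2 := by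
    apply div_nonneg _ (by positivity); nlinarith
  have hxX : (1 - h ^ 2) / h ^ 2 ≤ (1 - ε ^ 2) / ε ^ 2 := by
    rw [div_le_div_iff₀ (by positivity) (by positivity)]
    nlinarith
  set p := ((1 - h ^ 2) / h ^ 2) / ((1 - ε ^ 2) / ε ^ 2) with hp
  have hp0 : 0 ≤ p := div_nonneg hx hX.le
  have hp1 : p ≤ 1 := (div_le_one hX).2 hxX
  have hpX : p * ((1 - ε ^ 2) / ε ^ 2) = (1 - h ^ 2) / h ^ 2 := by
    rw [hp]; exact div_mul_cancel₀ _ hX.ne'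
  have hc := (convexOn_rpow (p := m / 2) (by linarith)).2
    (show (1:ℝ) ∈ Set.Ici 0 by simp) (show 1 / ε ^ 2 ∈ Set.Ici 0 by simp; positivity)
    (show 0 ≤ 1 - p by linarith) hp0 (by ring)
  have e1 : (1 - p) • (1 : ℝ) + p • (1 / ε ^ 2) = 1 / h ^ 2 := by
    simp only [smul_eq_mul]
    have a1 : (1 - ε ^ 2) / ε ^ 2 = 1 / ε ^ 2 - 1 := by field_simp
    have a2 : (1 - h ^ 2) / h ^ 2 = 1 / h ^ 2 - 1 := by field_simp
    rw [a1, a2] at hpX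
    linarith
  simp only [] at hc
  rw [e1, key h hpos, key ε hε] at hc
  simp only [smul_eq_mul, Real.one_rpow] at hc
  have he : 0 < ε ^ m := Real.rpow_pos_of_pos hε m
  have := mul_le_mul_of_nonneg_left hc he.le
  have e2 : ε ^ m * ((1 - p) * 1 + p * (1 / ε ^ m)) = ε ^ m + (1 - ε ^ m) * p := by
    field_simp; ring
  rw [e2] at this
  calc _ = ε ^ m * (1 / h ^ m) := by ring
    _ ≤ _ := this

set_option maxHeartbeats 1000000 in
lemma aux_pos (m γ ε h : ℝ) (hm₁ : 2.36 ≤ m) (hm₂ : m < 3)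
    (hγ₁ : 1 / 2 < γ) (hγ₂ : γ ≤ 1) (hε₁ : 0 < ε) (hε₂ : ε < 1)
    (h1 : 4 * (2 * γ - 1) ≥ γ ^ 2 * (4 - γ ^ 2 * (m - 1) / 4))
    (h2 : ε ^ 2 < (m - 1) / (m + 1))
    (h3 : (4 - γ ^ 2 * (m - 1) / 4 - m) - (4 - γ ^ 2 * (m - 1) / 4) * ε ^ m > 0)
    (hh : ε ≤ h) (hh1 : h ≤ 1) : 0 < l₁ m ε 2 h := by
  have hm : (2:ℝ) ≤ m := by norm_num at hm₁; linarith
  have hpos : 0 < h := by linarith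
  have hch := aux_chord m ε h hm hε₁ hε₂ hh hh1
  have hu : 0 < h ^ m := Real.rpow_pos_of_pos hpos m
  have hem : ε ^ m ≤ h ^ m := Real.rpow_le_rpow hε₁.le hh (by linarith)
  have he1 : ε ^ m < 1 := Real.rpow_lt_one hε₁.le hε₂ (by linarith)
  have hX : 0 < (1 - ε ^ 2) / ε ^ 2 := by
    apply div_pos _ (by positivity); nlinarith
  have hx : 0 ≤ (1 - h ^ 2) / h ^ 2 := by
    apply div_nonneg _ (by positivity); nlinarith
  have hxX : (1 - h ^ 2) / h ^ 2 ≤ (1 - ε ^ 2) / ε ^ 2 := by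
    rw [div_le_div_iff₀ (by positivity) (by positivity)]
    nlinarith
  have hXm : 1 < (m - 1) / 2 * ((1 - ε ^ 2) / ε ^ 2) := by
    rw [lt_div_iff₀ (by linarith)] at h2
    rw [← mul_div_assoc, lt_div_iff₀ (by positivity)]
    linarith
  have E1 : h ^ (m - 1) = h ^ m / h := by rw [Real.rpow_sub hpos, Real.rpow_one]
  have E2 : h ^ (m - 2) = h ^ m / h ^ 2 := by
    rw [Real.rpow_sub hpos]; norm_num
  have hxdef : (1 - h ^ 2) = (1 - h ^ 2) / h ^ 2 * h ^ 2 := by field_simp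
  unfold l₁ f f' f''
  rw [E1, E2]
  generalize ε ^ m = e at *
  generalize h ^ m = u at *
  generalize (1 - ε ^ 2) / ε ^ 2 = X at *
  generalize (1 - h ^ 2) / h ^ 2 = x at *
  obtain ⟨s, hs⟩ : ∃ s, s = 1 - e / u := ⟨_, rfl⟩
  have hfs : u - e = u * s := by rw [hs]; field_simp
  have hs0 : 0 ≤ s := by rw [hs]; have := (div_le_one hu).2 hem; linarith
  have hlow : (1 - e) * (1 - x / X) ≤ s := by rw [hs]; linarith
  have hp0 : 0 ≤ x / X := by positivity
  have hp1 : x / X ≤ 1 := (div_le_one hX).2 hxX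
  have hpX : x = x / X * X := by field_simp
  generalize x / X = p at *
  have hK : m < (4 - γ ^ 2 * (m - 1) / 4) * (1 - e) := by linarith
  have hKpos : 0 < 4 - γ ^ 2 * (m - 1) / 4 := by nlinarith
  have hR := aux_alg ((m - 1) / 16) γ (4 * s / m) ((m - 1) / 2 * x) (by linarith) (by linarith)
    (by positivity) (mul_nonneg (by linarith) hx) (by linarith) (by
      have a : (1 - (m - 1) / 16 * γ ^ 2) * (4 * s / m)
          = (4 - γ ^ 2 * (m - 1) / 4) * s / m := by ring
      have b : (4 - γ ^ 2 * (m - 1) / 4) * ((1 - e) * (1 - p)) / m ≤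
          (4 - γ ^ 2 * (m - 1) / 4) * s / m := by gcongr
      rw [a]
      have c : p ≤ (m - 1) / 2 * x := by rw [hpX]; nlinarith
      rcases hp1.eq_or_lt with h | h
      · have : 0 ≤ (4 - γ ^ 2 * (m - 1) / 4) * s / m := by positivity
        rw [h, one_mul] at hpX
        rw [hpX]; linarith
      · have : 1 - p < (4 - γ ^ 2 * (m - 1) / 4) * ((1 - e) * (1 - p)) / m := by
          rw [lt_div_iff₀ (by linarith)]
          have q : 0 < 1 - p := by linarith
          calc (1 - p) * m < (1 - p) * ((4 - γ ^ 2 * (m - 1) / 4) * (1 - e)) :=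
                mul_lt_mul_of_pos_left hK q
            _ = _ := by ring
        linarith)
  rw [hfs, hxdef]
  have hm1 : 0 < m - 1 := by linarith
  have : (0:ℝ) < u ^ 3 * m ^ 3 * (4 / (m - 1)) * ((4 * s / m - 1) *
      ((m - 1) / 16 * (4 * s / m) ^ 2 + (m - 1) / 2 * x) + ((m - 1) / 2 * x) ^ 2) := by positivity
  convert this using 1
  have hm0 : m ≠ 0 := by linarith
  have hm10 := hm1.ne'
  field_simp
  ring

theorem stmt_11 (m γ ε : ℝ) (hm₁ : 2.36 ≤ m) (hm₂ : m < 3)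
    (hγ₁ : 1 / 2 < γ) (hγ₂ : γ ≤ 1) (hε₁ : 0 < ε) (hε₂ : ε < 1)
    (h1 : 4 * (2 * γ - 1) ≥ γ ^ 2 * (4 - γ ^ 2 * (m - 1) / 4))
    (h2 : ε ^ 2 < (m - 1) / (m + 1))
    (h3 : (4 - γ ^ 2 * (m - 1) / 4 - m) - (4 - γ ^ 2 * (m - 1) / 4) * ε ^ m > 0) :
    ∃ δ ∈ Set.Ioo (0 : ℝ) 1, ∀ α ∈ Set.Ioo (2 - δ) 2, ∀ h ∈ Set.Icc ε 1,
      l₁ m ε α h ≥ 0 := by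
  have hm : (2:ℝ) ≤ m := by norm_num at hm₁; linarith
  have hcont : Continuous (fun q : ℝ × ℝ => l₁ m ε q.1 q.2) := by
    have c0 : Continuous (fun q : ℝ × ℝ => q.2 ^ m) :=
      (Real.continuous_rpow_const (by linarith)).comp continuous_snd
    have c1 : Continuous (fun q : ℝ × ℝ => q.2 ^ (m - 1)) :=
      (Real.continuous_rpow_const (by linarith)).comp continuous_snd
    have c2 : Continuous (fun q : ℝ × ℝ => q.2 ^ (m - 2)) :=
      (Real.continuous_rpow_const (by linarith)).comp continuous_snd
    unfold l₁ f f' f''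
    fun_prop
  have hev : ∀ᶠ α in nhds (2:ℝ), ∀ h ∈ Set.Icc ε 1, 0 < l₁ m ε α h := by
    apply isCompact_Icc.eventually_forall_of_forall_eventually
    intro h hh
    exact hcont.continuousAt.eventually (lt_mem_nhds
      (aux_pos m γ ε h hm₁ hm₂ hγ₁ hγ₂ hε₁ hε₂ h1 h2 h3 hh.1 hh.2))
  obtain ⟨r, hr, hball⟩ := Metric.eventually_nhds_iff.1 hev
  refine ⟨min r (1 / 2), ⟨by positivity, by
    have := min_le_right r (1 / 2 : ℝ); linarith⟩, ?_⟩
  intro α hα h hh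
  refine (hball ?_ h hh).le
  rw [Real.dist_eq, abs_lt]
  have := min_le_left r (1 / 2 : ℝ)
  exact ⟨by linarith [hα.1], by linarith [hα.2]⟩
end

section
/- Let m = 2.46 and ε₀ = √((m−1)/(m+1)) = √(73/173). For every ε ∈ (0, ε₀) there exists δ ∈ (0,1) such that for every α ∈ (2−δ, 2) and every h ∈ [ε,1]: (α²+α) f(h)² − h f(h) f'(h) + (1−h²) f'(h)² ≥ 2 ε^{2m}. -/
lemma key_aux (A s p : ℝ) (hA : 5.8 ≤ A) (hs : 0 < s) (hs1 : s ≤ 1) (hp : 1 ≤ p)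
    (hsp : 173 * s ≤ 73 * p) :
    2 * s ^ 2 ≤ A * (1 - s) ^ 2 - 2.46 * (1 - s) + 2.46 ^ 2 * (p - 1) := by
  have h1 : 5.8 * (1 - s) ^ 2 ≤ A * (1 - s) ^ 2 :=
    mul_le_mul_of_nonneg_right hA (sq_nonneg _)
  rcases le_total (173 * s) 73 with h | h
  · nlinarith [mul_nonneg (sub_nonneg.2 h) (sub_nonneg.2 h)]
  · nlinarith [mul_nonneg (sub_nonneg.2 h) (sub_nonneg.2 h)]

theorem stmt_14 (ε : ℝ) (hε : ε ∈ Set.Ioo 0 (Real.sqrt (73 / 173))) :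
    let m : ℝ := 2.46
    ∃ δ ∈ Set.Ioo (0 : ℝ) 1, ∀ α ∈ Set.Ioo (2 - δ) 2, ∀ h ∈ Set.Icc ε 1,
      (α ^ 2 + α) * f m ε h ^ 2 - h * f m ε h * f' m h + (1 - h ^ 2) * f' m h ^ 2
        ≥ 2 * ε ^ (2 * m) := by
  intro m
  obtain ⟨h0, hlt⟩ := hε
  have hsq : ε ^ 2 < 73 / 173 := (Real.lt_sqrt h0.le).1 hlt
  refine ⟨0.04, by norm_num, ?_⟩
  rintro α ⟨ha, -⟩ h ⟨hh, hh1⟩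
  have hA : 5.8 ≤ α ^ 2 + α := by nlinarith
  have hpos : 0 < h := lt_of_lt_of_le h0 hh
  have hy : 0 < h ^ m := Real.rpow_pos_of_pos hpos m
  have ht : 0 < ε ^ m := Real.rpow_pos_of_pos h0 m
  have hty : ε ^ m ≤ h ^ m := Real.rpow_le_rpow h0.le hh (by norm_num [m])
  have e1 : ∀ x : ℝ, 0 < x → x ^ m = x ^ 2 * x ^ (0.46 : ℝ) := by
    intro x hx
    rw [← Real.rpow_natCast x 2, ← Real.rpow_add hx]
    norm_num [m]
  have hk : ε ^ (0.46 : ℝ) ≤ h ^ (0.46 : ℝ) := Real.rpow_le_rpow h0.le hh (by norm_num)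
  have htw : ε ^ m * h ^ 2 ≤ ε ^ 2 * h ^ m := by
    rw [e1 ε h0, e1 h hpos]
    have := mul_le_mul_of_nonneg_left hk (by positivity : 0 ≤ ε ^ 2 * h ^ 2)
    linarith
  have hd : h ^ (m - 1) = h ^ m / h := Real.rpow_sub_one hpos.ne' m
  have h2 : ε ^ (2 * m) = (ε ^ m) ^ 2 := by
    rw [mul_comm, Real.rpow_mul h0.le]; norm_cast
  unfold f f'
  rw [hd, h2]
  generalize h ^ m = y at *
  generalize ε ^ m = t at *
  have K := key_aux (α ^ 2 + α) (t / y) (1 / h ^ 2) hA (by positivity)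
    ((div_le_one hy).2 hty) ((one_le_div (by positivity)).2 (by nlinarith)) (by
      rw [mul_div_assoc', mul_one_div, div_le_div_iff₀ hy (by positivity)]
      nlinarith)
  have K2 := mul_le_mul_of_nonneg_right K (sq_nonneg y)
  have l : 2 * (t / y) ^ 2 * y ^ 2 = 2 * t ^ 2 := by field_simp
  rw [l] at K2
  refine K2.trans_eq ?_
  simp only [m]
  field_simp
end
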